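/- Let (d_i, e_i)_{0 ≤ i ≤ 3} be a lexicographically ordered tuple with d_i, e_i ≥ 0, all d_i of the same parity, all e_i of the same parity, and d₃ ≥ 3, e₃ ≥ 3. Let X → ℙ¹ × ℙ¹ be a very general complex projective quadric surface bundle of type (d_i, e_i)_{0 ≤ i ≤ 3}. Then: (1) X is rational if d₂ = 0, or d₁ = e₁ = e₀ = 0, or e₀ = e₁ = e₂ = 0; (2) X is not stably rational otherwise. -/

import Mathlib

/-!
Rationality, stable rationality and stable birationality, expressed via function fields:
a variety `X` over `k` with function field `F` (a `k`-algebra via `c : k →+* F`) is rational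
iff `F ≅ k(t₁,…,t_n)` over `k`, and stably rational iff `F(t₁,…,t_m) ≅ k(t₁,…,t_n)` over `k`
for some `m, n`. Two varieties are stably birational iff their function fields become
isomorphic after adjoining finitely many indeterminates.
-/

noncomputable section

/-- The rational function field `k(t₁, …, t_n)`. -/
def ratFuncField (k : Type) [Field k] (n : ℕ) : Type :=
  FractionRing (MvPolynomial (Fin n) k)

instance (k : Type) [Field k] (n : ℕ) : Field (ratFuncField k n) := by
  unfold ratFuncField; infer_instance

/-- The canonical map `k → k(t₁, …, t_n)`. -/
def ratFuncFieldMap (k : Type) [Field k] (n : ℕ) : k →+* ratFuncField k n :=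
  (algebraMap (MvPolynomial (Fin n) k) (FractionRing (MvPolynomial (Fin n) k))).comp
    (MvPolynomial.C)

/-- Given a function field `F` over `k` (via `c : k →+* F`), the canonical map
`k → Frac(F[t₁,…,t_m]) = F(t₁,…,t_m)`. -/
def adjoinIndetsMap {k F : Type} [CommRing k] [CommRing F] (c : k →+* F) (m : ℕ) :
    k →+* FractionRing (MvPolynomial (Fin m) F) :=
  (algebraMap (MvPolynomial (Fin m) F) (FractionRing (MvPolynomial (Fin m) F))).comp
    ((MvPolynomial.C).comp c)

/-- A variety over `k` with function field `F` (via `c : k →+* F`) is rational iff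
`F ≅ k(t₁,…,t_n)` as `k`-algebras for some `n`. -/
def IsRationalFunctionField {k F : Type} [Field k] [CommRing F] (c : k →+* F) : Prop :=
  ∃ (n : ℕ) (e : F ≃+* ratFuncField k n), (e : F →+* ratFuncField k n).comp c =
    ratFuncFieldMap k n

/-- A variety over `k` with function field `F` (via `c : k →+* F`) is stably rational iff
`F(t₁,…,t_m) ≅ k(t₁,…,t_n)` as `k`-algebras for some `m, n`. -/
def IsStablyRationalFunctionField {k F : Type} [Field k] [CommRing F] (c : k →+* F) : Prop :=
  ∃ (m n : ℕ) (e : FractionRing (MvPolynomial (Fin m) F) ≃+* ratFuncField k n),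
    (e : FractionRing (MvPolynomial (Fin m) F) →+* ratFuncField k n).comp
      (adjoinIndetsMap c m) = ratFuncFieldMap k n

/-- Two varieties over `K` with function fields `L₁, L₂` (via `i₁ : K →+* L₁`,
`i₂ : K →+* L₂`) are stably birational over `K` iff `L₁(t₁,…,t_a) ≅ L₂(t₁,…,t_b)`
as `K`-algebras for some `a, b`. -/
def StablyBirationalOver {K L₁ L₂ : Type} [Field K] [CommRing L₁] [CommRing L₂]
    (i₁ : K →+* L₁) (i₂ : K →+* L₂) : Prop :=
  ∃ (a b : ℕ) (e : FractionRing (MvPolynomial (Fin a) L₁) ≃+*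
      FractionRing (MvPolynomial (Fin b) L₂)),
    (e : FractionRing (MvPolynomial (Fin a) L₁) →+*
      FractionRing (MvPolynomial (Fin b) L₂)).comp (adjoinIndetsMap i₁ a) =
      adjoinIndetsMap i₂ b

end

/-!
Very general members of linear families, and quadric surface bundles over `ℙ²` given by
symmetric matrices of homogeneous forms, described via affine charts and function fields.
-/

noncomputable section

/-- A polynomial function on a `ℂ`-vector space `P`: a function factoring through finitely
many linear coordinates via a polynomial. -/
def IsPolynomialFun {P : Type} [AddCommGroup P] [Module ℂ P] (f : P → ℂ) : Prop :=
  ∃ (N : ℕ) (l : Fin N → (P →ₗ[ℂ] ℂ)) (F : MvPolynomial (Fin N) ℂ),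
    ∀ p : P, f p = MvPolynomial.eval (fun i => l i p) F

/-- A property `Q` holds for a very general member of the linear parameter space `P` if it
holds away from a countable union of proper algebraic hypersurfaces, i.e. if there are
countably many nonzero polynomial functions on `P` such that `Q p` holds whenever none of
them vanishes at `p`. -/
def VeryGeneral {P : Type} [AddCommGroup P] [Module ℂ P] (Q : P → Prop) : Prop :=
  ∃ 𝒞 : Set (P → ℂ), 𝒞.Countable ∧ (∀ f ∈ 𝒞, IsPolynomialFun f ∧ f ≠ 0) ∧
    ∀ p : P, (∀ f ∈ 𝒞, f p ≠ 0) → Q p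

/-- Dehomogenization `ℂ[x,y,z] → ℂ[x,y] ⊆ ℂ[x,y,z₁,z₂,z₃]` at the chart `z = 1` of `ℙ²`
(the first two variables of `Fin 5` are the base coordinates). -/
def dehomP2 : MvPolynomial (Fin 3) ℂ →+* MvPolynomial (Fin 5) ℂ :=
  (MvPolynomial.aeval ![MvPolynomial.X 0, MvPolynomial.X 1, 1]).toRingHom

/-- Dehomogenization `ℂ[x,y,z] → ℂ[x,y]` at the chart `z = 1`. -/
def dehomP2' : MvPolynomial (Fin 3) ℂ →+* MvPolynomial (Fin 2) ℂ :=
  (MvPolynomial.aeval ![MvPolynomial.X 0, MvPolynomial.X 1, 1]).toRingHom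

/-- The defining polynomial `∑_{i,j} a_{ij}(x,y,1) z_i z_j` (with `z₀ = 1`) of the affine
chart of the quadric surface bundle `X = {∑ a_{ij} z_i z_j = 0} ⊆ ℙ(E)` over `ℙ²`. -/
def quadricBundleChartPoly (A : Fin 4 → Fin 4 → MvPolynomial (Fin 3) ℂ) :
    MvPolynomial (Fin 5) ℂ :=
  ∑ i : Fin 4, ∑ j : Fin 4, dehomP2 (A i j) *
    (![1, MvPolynomial.X 2, MvPolynomial.X 3, MvPolynomial.X 4] i) *
    (![1, MvPolynomial.X 2, MvPolynomial.X 3, MvPolynomial.X 4] j)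

/-- The coordinate ring of the affine chart (`z = 1` on `ℙ²` and `z₀ = 1` on the fibre)
of the quadric surface bundle `X ⊆ ℙ(E)` over `ℙ²` determined by the symmetric matrix
`(a_{ij})`. -/
def quadricBundleChartRing (A : Fin 4 → Fin 4 → MvPolynomial (Fin 3) ℂ) : Type :=
  MvPolynomial (Fin 5) ℂ ⧸ Ideal.span {quadricBundleChartPoly A}

instance (A : Fin 4 → Fin 4 → MvPolynomial (Fin 3) ℂ) :
    CommRing (quadricBundleChartRing A) :=
  Ideal.Quotient.commRing _

/-- The function field `ℂ(X)` of the quadric surface bundle `X` over `ℙ²` given by the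
matrix `(a_{ij})`, as the fraction ring of the affine chart. -/
def quadricBundleFunctionField (A : Fin 4 → Fin 4 → MvPolynomial (Fin 3) ℂ) : Type :=
  FractionRing (quadricBundleChartRing A)

instance (A : Fin 4 → Fin 4 → MvPolynomial (Fin 3) ℂ) :
    CommRing (quadricBundleFunctionField A) := by
  unfold quadricBundleFunctionField; infer_instance

/-- The canonical map `ℂ → ℂ(X)`. -/
def quadricBundleFFMap (A : Fin 4 → Fin 4 → MvPolynomial (Fin 3) ℂ) :
    ℂ →+* quadricBundleFunctionField A :=
  (algebraMap (quadricBundleChartRing A) (FractionRing (quadricBundleChartRing A))).comp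
    ((Ideal.Quotient.mk _).comp (MvPolynomial.C))

/-- The conditions for the symmetric matrix `(a_{ij})` of forms to define a quadric surface
bundle over `ℙ²`: the quadratic form is generically nondegenerate, and nonzero on every
fibre (so that `X → ℙ²` is flat). Homogeneity of the `a_{ij}` of the correct degrees is
part of the choice of parameter space. -/
def IsQuadricBundleP2 (A : Fin 4 → Fin 4 → MvPolynomial (Fin 3) ℂ) : Prop :=
  Matrix.det (Matrix.of fun i j => A i j + A j i) ≠ 0 ∧
  ∀ v : Fin 3 → ℂ, v ≠ 0 → ∃ i j, MvPolynomial.eval v (A i j + A j i) ≠ 0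

/-- The quadric surface bundle over `ℙ²` given by `(a_{ij})` admits a rational section:
there are rational functions `σ₀, …, σ₃` on `ℙ²`, not all zero, with
`∑ a_{ij} σ_i σ_j = 0`. -/
def HasRationalSectionP2 (A : Fin 4 → Fin 4 → MvPolynomial (Fin 3) ℂ) : Prop :=
  ∃ σ : Fin 4 → FractionRing (MvPolynomial (Fin 2) ℂ), σ ≠ 0 ∧
    ∑ i : Fin 4, ∑ j : Fin 4,
      (algebraMap (MvPolynomial (Fin 2) ℂ) (FractionRing (MvPolynomial (Fin 2) ℂ)))
        (dehomP2' (A i j)) * σ i * σ j = 0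

end

/-!
Quadric surface bundles over `ℙ¹ × ℙ¹`, via the affine chart `x₀ = y₀ = 1` and the fibre
chart `z₀ = 1`. Base coordinates are `x₀, x₁, y₀, y₁` (the variables of `Fin 4`).
-/

noncomputable section

/-- The weight vector selecting the first `ℙ¹`-factor's variables. -/
def p1p1Weight1 : Fin 4 → ℕ := ![1, 1, 0, 0]

/-- The weight vector selecting the second `ℙ¹`-factor's variables. -/
def p1p1Weight2 : Fin 4 → ℕ := ![0, 0, 1, 1]

/-- Dehomogenization `ℂ[x₀,x₁,y₀,y₁] → ℂ[x,y] ⊆ ℂ[x,y,z₁,z₂,z₃]` at the chart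
`x₀ = y₀ = 1`. -/
def dehomP1P1 : MvPolynomial (Fin 4) ℂ →+* MvPolynomial (Fin 5) ℂ :=
  (MvPolynomial.aeval ![1, MvPolynomial.X 0, 1, MvPolynomial.X 1]).toRingHom

/-- The defining polynomial `∑_{i,j} a_{ij}(1,x,1,y) z_i z_j` (with `z₀ = 1`) of the
affine chart of the quadric surface bundle `X = {∑ a_{ij} z_i z_j = 0} ⊆ ℙ(E)` over
`ℙ¹ × ℙ¹`. -/
def p1p1BundleChartPoly (A : Fin 4 → Fin 4 → MvPolynomial (Fin 4) ℂ) :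
    MvPolynomial (Fin 5) ℂ :=
  ∑ i : Fin 4, ∑ j : Fin 4, dehomP1P1 (A i j) *
    (![1, MvPolynomial.X 2, MvPolynomial.X 3, MvPolynomial.X 4] i) *
    (![1, MvPolynomial.X 2, MvPolynomial.X 3, MvPolynomial.X 4] j)

/-- The coordinate ring of the affine chart of the quadric surface bundle over
`ℙ¹ × ℙ¹`. -/
def p1p1BundleChartRing (A : Fin 4 → Fin 4 → MvPolynomial (Fin 4) ℂ) : Type :=
  MvPolynomial (Fin 5) ℂ ⧸ Ideal.span {p1p1BundleChartPoly A}

instance (A : Fin 4 → Fin 4 → MvPolynomial (Fin 4) ℂ) :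
    CommRing (p1p1BundleChartRing A) :=
  Ideal.Quotient.commRing _

/-- The canonical map `ℂ → ℂ(X)` for the quadric surface bundle `X` over `ℙ¹ × ℙ¹`. -/
def p1p1BundleFFMap (A : Fin 4 → Fin 4 → MvPolynomial (Fin 4) ℂ) :
    ℂ →+* FractionRing (p1p1BundleChartRing A) :=
  (algebraMap (p1p1BundleChartRing A) (FractionRing (p1p1BundleChartRing A))).comp
    ((Ideal.Quotient.mk _).comp (MvPolynomial.C))

/-- The conditions for the matrix `(a_{ij})` of bihomogeneous forms to define a quadric
surface bundle over `ℙ¹ × ℙ¹`: generic nondegeneracy, and the quadratic form is nonzero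
on every fibre. -/
def IsQuadricBundleP1P1 (A : Fin 4 → Fin 4 → MvPolynomial (Fin 4) ℂ) : Prop :=
  Matrix.det (Matrix.of fun i j => A i j + A j i) ≠ 0 ∧
  ∀ v : Fin 4 → ℂ, (![v 0, v 1] : Fin 2 → ℂ) ≠ 0 → (![v 2, v 3] : Fin 2 → ℂ) ≠ 0 →
    ∃ i j, MvPolynomial.eval v (A i j + A j i) ≠ 0

/-- The type `(dᵢ, eᵢ)` is lexicographically ordered. -/
def LexOrderedType (d e : Fin 4 → ℕ) : Prop :=
  ∀ i : Fin 3, d i.castSucc < d i.succ ∨ (d i.castSucc = d i.succ ∧ e i.castSucc ≤ e i.succ)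

end

section Conics

/-- The conic `a u² + b v² = w²` has a nontrivial point. -/
def ConicSplit {L : Type} [Field L] (a b : L) : Prop :=
  ∃ u v w : L, (u ≠ 0 ∨ v ≠ 0 ∨ w ≠ 0) ∧ a * u ^ 2 + b * v ^ 2 = w ^ 2

variable {L L' : Type} [Field L] [Field L']

theorem ConicSplit.symm {a b : L} (h : ConicSplit a b) : ConicSplit b a := by
  obtain ⟨u, v, w, h0, h⟩ := h
  exact ⟨v, u, w, by tauto, by rw [← h]; ring⟩

theorem ConicSplit.comm {a b : L} : ConicSplit a b ↔ ConicSplit b a :=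
  ⟨ConicSplit.symm, ConicSplit.symm⟩

theorem ConicSplit.of_isSquare_left {a : L} (b : L) (h : IsSquare a) : ConicSplit a b := by
  obtain ⟨s, rfl⟩ := h
  exact ⟨1, 0, s, by simp, by ring⟩

theorem ConicSplit.of_isSquare_right (a : L) {b : L} (h : IsSquare b) : ConicSplit a b :=
  (ConicSplit.of_isSquare_left a h).symm

theorem ConicSplit.of_isSquare_mul {a b : L} (hi : IsSquare (-1 : L)) (h : IsSquare (a * b)) :
    ConicSplit a b := by
  by_cases hb : b = 0
  · exact ConicSplit.of_isSquare_right a (by simp [hb])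
  obtain ⟨i, hi⟩ := hi
  obtain ⟨s, hs⟩ := h
  exact ⟨b, i * s, 0, by simp [hb], by linear_combination b * hs + (-b * s ^ 2) * hi⟩

theorem ConicSplit.map (f : L →+* L') {a b : L} (h : ConicSplit a b) :
    ConicSplit (f a) (f b) := by
  obtain ⟨u, v, w, h0, h⟩ := h
  refine ⟨f u, f v, f w, by simpa using h0, ?_⟩
  rw [← map_pow, ← map_pow, ← map_pow, ← map_mul, ← map_mul, ← map_add, h]

theorem ConicSplit.mul_sq_left {a b c : L} (hc : c ≠ 0) :
    ConicSplit (a * c ^ 2) b ↔ ConicSplit a b := by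
  constructor
  · rintro ⟨u, v, w, h0, h⟩
    exact ⟨c * u, v, w, by simpa [hc] using h0, by rw [← h]; ring⟩
  · rintro ⟨u, v, w, h0, h⟩
    refine ⟨u / c, v, w, by simpa [hc] using h0, ?_⟩
    rw [← h]
    field_simp

theorem ConicSplit.mul_sq_right {a b c : L} (hc : c ≠ 0) :
    ConicSplit a (b * c ^ 2) ↔ ConicSplit a b := by
  rw [ConicSplit.comm, ConicSplit.mul_sq_left hc, ConicSplit.comm]

theorem ConicSplit.inv_left {a b : L} : ConicSplit a⁻¹ b ↔ ConicSplit a b := by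
  by_cases ha : a = 0
  · simp [ha]
  have : a⁻¹ = a * (a⁻¹) ^ 2 := by field_simp
  rw [this, ConicSplit.mul_sq_left (inv_ne_zero ha)]

theorem ConicSplit.inv_right {a b : L} : ConicSplit a b⁻¹ ↔ ConicSplit a b := by
  rw [ConicSplit.comm, ConicSplit.inv_left, ConicSplit.comm]

/-- If `f f'` is a norm from `L(√g)` then `(f, g)` and `(f', g)` split simultaneously. -/
theorem ConicSplit.of_norm {f f' g h r : L} (hf : f ≠ 0) (hn : f * f' = h ^ 2 - g * r ^ 2)
    (hs : ConicSplit f g) : ConicSplit f' g := by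
  obtain ⟨u, v, w, h0, hs⟩ := hs
  by_cases hu : u = 0
  · subst hu
    have hv : v ≠ 0 := by
      rintro rfl
      have : w = 0 := by
        have : w ^ 2 = 0 := by rw [← hs]; ring
        simpa using this
      simp [this] at h0
    refine ConicSplit.of_isSquare_right _ ⟨w / v, ?_⟩
    field_simp
    linear_combination hs
  · refine ⟨f * u, h * v + r * w, h * w + g * r * v, by simp [hf, hu], ?_⟩
    linear_combination (f * u ^ 2) * hn + (h ^ 2 - g * r ^ 2) * hs

theorem ConicSplit.norm_iff {f f' g h r : L} (hf : f ≠ 0) (hf' : f' ≠ 0)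
    (hn : f * f' = h ^ 2 - g * r ^ 2) : ConicSplit f g ↔ ConicSplit f' g :=
  ⟨ConicSplit.of_norm hf hn, ConicSplit.of_norm hf' (by rw [mul_comm, hn])⟩

/-- An isotropic Pfister form `⟨1, x, y, xy⟩` has split quaternion algebra. -/
theorem ConicSplit.of_pfister (hi : IsSquare (-1 : L)) {x y z₀ z₁ z₂ z₃ : L}
    (h0 : z₀ ≠ 0 ∨ z₁ ≠ 0 ∨ z₂ ≠ 0 ∨ z₃ ≠ 0)
    (h : z₀ ^ 2 + x * z₁ ^ 2 + y * z₂ ^ 2 + x * y * z₃ ^ 2 = 0) : ConicSplit x y := by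
  obtain ⟨i, hi⟩ := hi
  have key : ∀ a b : L, (a ≠ 0 ∨ b ≠ 0) → a ^ 2 + x * b ^ 2 = 0 → ConicSplit x y := by
    intro a b hab h
    have hb : b ≠ 0 := by
      rintro rfl
      have : a = 0 := by simpa using h
      simp [this] at hab
    refine ConicSplit.of_isSquare_left _ ⟨i * a / b, ?_⟩
    field_simp
    linear_combination h + a ^ 2 * hi
  by_cases hn : z₂ ^ 2 + x * z₃ ^ 2 = 0
  · have hn' : z₀ ^ 2 + x * z₁ ^ 2 = 0 := by linear_combination h - y * hn
    by_cases h2 : z₂ ≠ 0 ∨ z₃ ≠ 0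
    · exact key _ _ h2 hn
    · exact key _ _ (by tauto) hn'
  · refine ⟨z₀ * z₃ + z₁ * z₂, z₂ ^ 2 + x * z₃ ^ 2, i * (z₀ * z₂ - x * z₁ * z₃),
      Or.inr (Or.inl hn), ?_⟩
    linear_combination (z₂ ^ 2 + x * z₃ ^ 2) * h + (z₀ * z₂ - x * z₁ * z₃) ^ 2 * hi

end Conics

section PrimitiveVectors

/-- Over the fraction field of a valuation ring, a nonzero vector can be rescaled to an integral
vector with an entry `1`. -/
theorem ValuationRing.exists_primitive {R L ι : Type} [CommRing R] [IsDomain R] [ValuationRing R]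
    [Field L] [Algebra R L] [IsFractionRing R L] [Finite ι] (u : ι → L) (hu : ∃ i, u i ≠ 0) :
    ∃ c : L, c ≠ 0 ∧ ∃ u' : ι → R, (∀ i, c * u i = algebraMap R L (u' i)) ∧ ∃ i, u' i = 1 := by
  obtain ⟨i₀, hi₀⟩ := hu
  have : Nonempty ι := ⟨i₀⟩
  obtain ⟨j, hj⟩ := Finite.exists_max (fun i => ValuationRing.valuation R L (u i))
  have hj0 : u j ≠ 0 := by
    intro h0
    have := hj i₀
    simp only [h0, map_zero, le_zero_iff, map_eq_zero] at this
    exact hi₀ this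
  have hmem : ∀ i, ∃ a : R, algebraMap R L a = (u j)⁻¹ * u i := by
    intro i
    rw [← ValuationRing.mem_integer_iff, Valuation.mem_integer_iff, map_mul, map_inv₀]
    rw [inv_mul_le_iff₀ ((Valuation.pos_iff _).2 hj0), mul_one]
    exact hj i
  choose u' hu' using hmem
  refine ⟨(u j)⁻¹, inv_ne_zero hj0, u', fun i => (hu' i).symm, j, ?_⟩
  apply IsFractionRing.injective R L
  rw [hu', inv_mul_cancel₀ hj0, map_one]

end PrimitiveVectors

section PowerSeriesConics

variable {k : Type} [Field k] [CharZero k]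

open PowerSeries in
theorem PowerSeries.isSquare_of_constantCoeff (f : k⟦X⟧) (h0 : constantCoeff f ≠ 0)
    (h : IsSquare (constantCoeff f)) : IsSquare f := by
  obtain ⟨c, hc⟩ := h
  have hc0 : c ≠ 0 := by rintro rfl; simp at hc; exact h0 hc
  let B : k⟦X⟧ := binomialSeries k (1 / 2 : ℚ)
  have hB : B * B = 1 + X := by
    rw [← binomialSeries_add]
    have := binomialSeries_nat (R := ℚ) (A := k) 1
    norm_num at this ⊢
    exact this
  let g : k⟦X⟧ := C (c⁻¹ * c⁻¹) * f - 1
  have hg : constantCoeff g = 0 := by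
    simp only [g, map_sub, map_mul, constantCoeff_C, hc, map_one]
    field_simp
    ring
  have hs : HasSubst g := HasSubst.of_constantCoeff_zero' hg
  refine ⟨C c * B.subst g, ?_⟩
  have h1 : (B.subst g : k⟦X⟧) * B.subst g = 1 + g := by
    have := congrArg (substAlgHom hs) hB
    rw [map_mul, map_add, map_one, substAlgHom_X] at this
    simpa [coe_substAlgHom] using this
  have h2 : f = C (c * c) * (1 + g) := by
    simp only [g]
    rw [add_sub_cancel, ← mul_assoc, ← map_mul]
    have : c * c * (c⁻¹ * c⁻¹) = 1 := by field_simp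
    rw [this, map_one, one_mul]
  rw [h2, ← h1, map_mul]
  ring

/-- The quadratic form `⟨1, x, y, xyF⟩` with `F = (x+1)²(y+1)² + xy`. -/
def specialForm {L : Type} [CommRing L] (x y z₀ z₁ z₂ z₃ : L) : L :=
  z₀ ^ 2 + x * z₁ ^ 2 + y * z₂ ^ 2 +
    x * y * ((x + 1) ^ 2 * (y + 1) ^ 2 + x * y) * z₃ ^ 2

open PowerSeries

variable {L : Type} [Field L] [Algebra k⟦X⟧ L] [IsFractionRing k⟦X⟧ L]

theorem conicSplit_of_specialForm_integral (hi : IsSquare (-1 : k)) {x y : k⟦X⟧}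
    (hxy : constantCoeff x * constantCoeff y = 0) {z₀ z₁ z₂ z₃ : L}
    (h0 : z₀ ≠ 0 ∨ z₁ ≠ 0 ∨ z₂ ≠ 0 ∨ z₃ ≠ 0)
    (h : specialForm (algebraMap k⟦X⟧ L x) (algebraMap k⟦X⟧ L y) z₀ z₁ z₂ z₃ = 0) :
    ConicSplit (algebraMap k⟦X⟧ L x) (algebraMap k⟦X⟧ L y) := by
  have hiR : IsSquare (-1 : k⟦X⟧) := isSquare_of_constantCoeff _ (by simp) (by simpa using hi)
  have hiL : IsSquare (-1 : L) := by simpa using hiR.map (algebraMap k⟦X⟧ L)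
  have neg1 : ∀ a : k⟦X⟧, constantCoeff a = -1 → IsSquare (algebraMap k⟦X⟧ L a) := fun a ha =>
    (isSquare_of_constantCoeff a (by simp [ha]) (by rwa [ha])).map (algebraMap k⟦X⟧ L)
  by_cases hx : constantCoeff x = -1
  · exact ConicSplit.of_isSquare_left _ (neg1 x hx)
  by_cases hy : constantCoeff y = -1
  · exact ConicSplit.of_isSquare_right _ (neg1 y hy)
  have hF : constantCoeff ((x + 1) ^ 2 * (y + 1) ^ 2 + x * y) =
      ((constantCoeff x + 1) * (constantCoeff y + 1)) ^ 2 := by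
    simp only [map_add, map_mul, map_pow, map_one, hxy]; ring
  have hx' : constantCoeff x + 1 ≠ 0 := fun h => hx (eq_neg_of_add_eq_zero_left h)
  have hy' : constantCoeff y + 1 ≠ 0 := fun h => hy (eq_neg_of_add_eq_zero_left h)
  have hFs := isSquare_of_constantCoeff ((x + 1) ^ 2 * (y + 1) ^ 2 + x * y)
    (by rw [hF]; positivity) (by rw [hF]; exact ⟨_, sq _⟩)
  obtain ⟨s, hs⟩ := hFs
  have hs0 : algebraMap k⟦X⟧ L s ≠ 0 := by
    rw [Ne, IsFractionRing.to_map_eq_zero_iff]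
    rintro rfl
    rw [hs] at hF
    simp only [mul_zero, map_zero] at hF
    exact (pow_ne_zero 2 (mul_ne_zero hx' hy')) hF.symm
  refine ConicSplit.of_pfister hiL (z₀ := z₀) (z₁ := z₁) (z₂ := z₂)
    (z₃ := algebraMap k⟦X⟧ L s * z₃) (by simpa [hs0] using h0) ?_
  have hs' := congrArg (algebraMap k⟦X⟧ L) hs
  simp only [map_add, map_mul, map_pow, map_one] at hs'
  rw [← h, specialForm, hs']
  ring

/-- An element of the fraction field of `k⟦X⟧` that is a power series with nonzero constant
coefficient. -/
def IsPSUnit (k : Type) [Field k] {L : Type} [Field L] [Algebra k⟦X⟧ L] (x : L) : Prop :=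
  ∃ f : k⟦X⟧, constantCoeff f ≠ 0 ∧ algebraMap k⟦X⟧ L f = x

omit [CharZero k] [IsFractionRing k⟦X⟧ L] in
theorem IsPSUnit.inv {x : L} (h : IsPSUnit k x) : IsPSUnit k x⁻¹ := by
  obtain ⟨f, hf, rfl⟩ := h
  refine ⟨f⁻¹, by simpa using hf, ?_⟩
  apply eq_inv_of_mul_eq_one_left
  rw [← map_mul, PowerSeries.inv_mul_cancel _ hf, map_one]

omit [CharZero k] [IsFractionRing k⟦X⟧ L] in
theorem IsPSUnit.mul {x y : L} (h : IsPSUnit k x) (h' : IsPSUnit k y) : IsPSUnit k (x * y) := by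
  obtain ⟨f, hf, rfl⟩ := h
  obtain ⟨g, hg, rfl⟩ := h'
  exact ⟨f * g, by simp [hf, hg], map_mul _ _ _⟩

theorem specialForm_inv_left {L : Type} [Field L] {x : L} (hx : x ≠ 0) (y z₀ z₁ z₂ z₃ : L) :
    specialForm x⁻¹ y z₀ (x * z₁) z₂ (x ^ 2 * z₃) = specialForm x y z₀ z₁ z₂ z₃ := by
  unfold specialForm
  field_simp
  ring

theorem specialForm_swap {L : Type} [CommRing L] (x y z₀ z₁ z₂ z₃ : L) :
    specialForm x y z₀ z₁ z₂ z₃ = specialForm y x z₀ z₂ z₁ z₃ := by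
  unfold specialForm
  ring

/-- If `⟨1, x, y, xyF⟩` is isotropic over `k((t))` then either `x` and `y` are both units or the
conic of `x, y` is split. -/
theorem unit_or_conicSplit_of_specialForm (hi : IsSquare (-1 : k)) {x y : L}
    (hx : x ≠ 0) (hy : y ≠ 0) {z₀ z₁ z₂ z₃ : L}
    (h0 : z₀ ≠ 0 ∨ z₁ ≠ 0 ∨ z₂ ≠ 0 ∨ z₃ ≠ 0) (h : specialForm x y z₀ z₁ z₂ z₃ = 0) :
    (IsPSUnit k x ∧ IsPSUnit k y) ∨ ConicSplit x y := by
  wlog hxi : IsLocalization.IsInteger k⟦X⟧ x generalizing x z₁ z₃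
  · have hxi' := (ValuationRing.isInteger_or_isInteger k⟦X⟧ x).resolve_left hxi
    have := this (x := x⁻¹) (z₁ := x * z₁) (z₃ := x ^ 2 * z₃) (inv_ne_zero hx)
      (by simpa [hx] using h0) (by rw [specialForm_inv_left hx, h]) hxi'
    rw [ConicSplit.inv_left] at this
    refine this.imp_left fun h => ⟨?_, h.2⟩
    simpa using h.1.inv
  wlog hyi : IsLocalization.IsInteger k⟦X⟧ y generalizing y z₂ z₃
  · have hyi' := (ValuationRing.isInteger_or_isInteger k⟦X⟧ y).resolve_left hyi
    have := this (y := y⁻¹) (z₂ := y * z₂) (z₃ := y ^ 2 * z₃) (inv_ne_zero hy)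
      (by simpa [hy] using h0)
      (by rw [specialForm_swap, specialForm_inv_left hy, specialForm_swap, h]) hyi'
    rw [ConicSplit.inv_right] at this
    refine this.imp_left fun h => ⟨h.1, ?_⟩
    simpa using h.2.inv
  obtain ⟨f, rfl⟩ := hxi
  obtain ⟨g, rfl⟩ := hyi
  by_cases hfg : constantCoeff f * constantCoeff g = 0
  · exact Or.inr (conicSplit_of_specialForm_integral hi hfg h0 h)
  · rw [mul_eq_zero, not_or] at hfg
    exact Or.inl ⟨⟨f, hfg.1, rfl⟩, ⟨g, hfg.2, rfl⟩⟩

omit [CharZero k] in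
theorem ConicSplit.exists_primitive {f g : k⟦X⟧}
    (h : ConicSplit (algebraMap k⟦X⟧ L f) (algebraMap k⟦X⟧ L g)) :
    ∃ u v w : k⟦X⟧, (constantCoeff u ≠ 0 ∨ constantCoeff v ≠ 0 ∨ constantCoeff w ≠ 0) ∧
      f * u ^ 2 + g * v ^ 2 = w ^ 2 := by
  obtain ⟨u, v, w, h0, h⟩ := h
  have hne : ∃ i, ![u, v, w] i ≠ 0 := by
    rcases h0 with h | h | h
    exacts [⟨0, h⟩, ⟨1, h⟩, ⟨2, h⟩]
  obtain ⟨c, hc, z, hz, j, hj⟩ := ValuationRing.exists_primitive (R := k⟦X⟧) ![u, v, w] hne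
  have hu := hz 0
  have hv := hz 1
  have hw := hz 2
  simp only [Matrix.cons_val] at hu hv hw
  refine ⟨z 0, z 1, z 2, ?_, ?_⟩
  · fin_cases j <;> simp at hj <;> simp [hj]
  · apply IsFractionRing.injective k⟦X⟧ L
    simp only [map_add, map_mul, map_pow, ← hu, ← hv, ← hw]
    linear_combination c ^ 2 * h

omit [CharZero k] in
theorem ConicSplit.constantCoeff {f g : k⟦X⟧}
    (h : ConicSplit (algebraMap k⟦X⟧ L f) (algebraMap k⟦X⟧ L g)) :
    ConicSplit (PowerSeries.constantCoeff f) (PowerSeries.constantCoeff g) := by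
  obtain ⟨u, v, w, h0, h⟩ := h.exists_primitive
  exact ⟨_, _, _, h0, by simpa using congrArg PowerSeries.constantCoeff h⟩

omit [CharZero k] in
/-- Residue computation: if `f` has order one and `(f, g)` is split, the residue of `g` is a
square. -/
theorem ConicSplit.isSquare_constantCoeff {f g : k⟦X⟧}
    (hf : PowerSeries.constantCoeff f = 0) (hf1 : coeff 1 f ≠ 0)
    (h : ConicSplit (algebraMap k⟦X⟧ L f) (algebraMap k⟦X⟧ L g)) :
    IsSquare (PowerSeries.constantCoeff g) := by
  obtain ⟨u, v, w, h0, h⟩ := h.exists_primitive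
  have h1 := congrArg PowerSeries.constantCoeff h
  simp only [map_add, map_mul, map_pow, hf, zero_mul, zero_add] at h1
  by_cases hv : PowerSeries.constantCoeff v = 0
  · have hw : PowerSeries.constantCoeff w = 0 := by
      rw [hv] at h1; simpa using h1.symm
    exfalso
    have hu : PowerSeries.constantCoeff u ≠ 0 := by tauto
    obtain ⟨v', rfl⟩ := X_dvd_iff.2 hv
    obtain ⟨w', rfl⟩ := X_dvd_iff.2 hw
    obtain ⟨f', rfl⟩ := X_dvd_iff.2 hf
    have h2 : X * (f' * u ^ 2) = X * (X * (w' ^ 2 - g * v' ^ 2)) := by linear_combination h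
    have h3 := congrArg PowerSeries.constantCoeff (mul_left_cancel₀ X_ne_zero h2)
    have h4 : PowerSeries.constantCoeff f' ≠ 0 := by
      have e : coeff 1 (X * f') = coeff 0 f' := coeff_succ_X_mul 0 f'
      rw [e] at hf1
      simpa using hf1
    simp [hu, h4] at h3
  · refine ⟨PowerSeries.constantCoeff w / PowerSeries.constantCoeff v, ?_⟩
    field_simp
    linear_combination h1

end PowerSeriesConics

section QuadraticExtension

/-- Adjoining a square root of `a` to `K` only makes elements of `K` square that become square in
`K` after multiplication by `1` or `a`. -/
theorem exists_extension_isSquare (K : Type) [Field K] [CharZero K] (a : K) :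
    ∃ (K' : Type) (_ : Field K') (_ : CharZero K') (ι : K →+* K'), IsSquare (ι a) ∧
      ∀ g : K, IsSquare (ι g) → IsSquare g ∨ IsSquare (g * a) := by
  by_cases ha : IsSquare a
  · exact ⟨K, inferInstance, inferInstance, RingHom.id K, ha, fun g h => Or.inl h⟩
  have : Fact (∀ r : K, r ^ 2 ≠ a + 0 * r) := ⟨fun r h => ha ⟨r, by rw [← sq, h]; ring⟩⟩
  refine ⟨QuadraticAlgebra K a 0, inferInstance, ?_, algebraMap K _, ⟨⟨0, 1⟩, ?_⟩, ?_⟩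
  · exact charZero_of_injective_algebraMap (algebraMap K (QuadraticAlgebra K a 0)).injective
  · ext <;> simp [QuadraticAlgebra.algebraMap_eq]
  · rintro g ⟨⟨p, q⟩, h⟩
    rw [QuadraticAlgebra.algebraMap_eq, QuadraticAlgebra.ext_iff] at h
    simp only [QuadraticAlgebra.mk_mul_mk] at h
    obtain ⟨h1, h2⟩ := h
    have h3 : p * q = 0 := by
      have : 2 * (p * q) = 0 := by linear_combination -h2
      simpa using this
    rcases mul_eq_zero.1 h3 with rfl | rfl
    · exact Or.inr ⟨q * a, by rw [h1]; ring⟩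
    · exact Or.inl ⟨p, by rw [h1]; ring⟩

end QuadraticExtension

theorem PowerSeries.constantCoeff_map_apply {R S : Type} [CommRing R] [CommRing S] (ι : R →+* S)
    (f : PowerSeries R) :
    PowerSeries.constantCoeff (PowerSeries.map ι f) = ι (PowerSeries.constantCoeff f) := by
  rw [← PowerSeries.coeff_zero_eq_constantCoeff_apply, PowerSeries.coeff_map,
    PowerSeries.coeff_zero_eq_constantCoeff_apply]

section LegendreDescent

open Polynomial

variable {l : Type} [Field l] [CharZero l]

/-- The pairs `(f, g)` and `(f', g')` define simultaneously split conics over every field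
containing the polynomial ring. -/
def ConicEquiv (f g f' g' : l[X]) : Prop :=
  ∀ (L : Type) [Field L] (φ : l[X] →+* L), Function.Injective φ →
    (ConicSplit (φ f) (φ g) ↔ ConicSplit (φ f') (φ g'))

omit [CharZero l] in
theorem ConicEquiv.trans {f g f' g' f'' g'' : l[X]} (h : ConicEquiv f g f' g')
    (h' : ConicEquiv f' g' f'' g'') : ConicEquiv f g f'' g'' :=
  fun L _ φ hφ => (h L φ hφ).trans (h' L φ hφ)

/-- The Taylor expansion at the root of an irreducible polynomial `P`, as a ring homomorphism to
power series over the residue field. -/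
noncomputable def localExpansion (P : l[X]) : l[X] →+* PowerSeries (AdjoinRoot P) :=
  (Polynomial.coeToPowerSeries.ringHom).comp
    ((Polynomial.compRingHom (X + C (AdjoinRoot.root P))).comp
      (Polynomial.mapRingHom (AdjoinRoot.of P)))

omit [CharZero l] in
theorem localExpansion_apply (P f : l[X]) :
    localExpansion P f = ((f.map (AdjoinRoot.of P)).comp (X + C (AdjoinRoot.root P)) :
      (AdjoinRoot P)[X]) := rfl

omit [CharZero l] in
theorem localExpansion_injective (P : l[X]) [Fact (Irreducible P)] :
    Function.Injective (localExpansion P) := by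
  rw [injective_iff_map_eq_zero]
  intro f hf
  rw [localExpansion_apply, Polynomial.coe_eq_zero_iff, ← Polynomial.taylor_apply] at hf
  have := Polynomial.taylor_injective _ (hf.trans (map_zero _).symm)
  exact (Polynomial.map_eq_zero _).1 this

omit [CharZero l] in
theorem localExpansion_constantCoeff (P f : l[X]) :
    PowerSeries.constantCoeff (localExpansion P f) = AdjoinRoot.mk P f := by
  rw [localExpansion_apply, ← PowerSeries.coeff_zero_eq_constantCoeff_apply,
    Polynomial.coeff_coe, ← Polynomial.taylor_apply, Polynomial.taylor_coeff_zero,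
    Polynomial.eval_map, ← AdjoinRoot.aeval_eq]
  rfl

omit [CharZero l] in
theorem localExpansion_coeff_one (P f : l[X]) :
    PowerSeries.coeff 1 (localExpansion P f) = AdjoinRoot.mk P (derivative f) := by
  rw [localExpansion_apply, Polynomial.coeff_coe, ← Polynomial.taylor_apply,
    Polynomial.taylor_coeff_one, Polynomial.derivative_map,
    Polynomial.eval_map, ← AdjoinRoot.aeval_eq]
  rfl

/-- At the place of `P`, either the conic of `(f, g)` is split or `f` and `g` are units up to
squares. -/
def LocallyGood (P : l[X]) [Fact (Irreducible P)] (f g : l[X]) : Prop :=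
  let L := FractionRing (PowerSeries (AdjoinRoot P))
  ConicSplit (algebraMap _ L (localExpansion P f)) (algebraMap _ L (localExpansion P g)) ∨
    ∃ x y a b : L, IsPSUnit (AdjoinRoot P) x ∧ IsPSUnit (AdjoinRoot P) y ∧ a ≠ 0 ∧ b ≠ 0 ∧
      algebraMap _ L (localExpansion P f) = x * a ^ 2 ∧
      algebraMap _ L (localExpansion P g) = y * b ^ 2

theorem charZero_adjoinRoot (P : l[X]) [Fact (Irreducible P)] : CharZero (AdjoinRoot P) :=
  charZero_of_injective_ringHom (AdjoinRoot.of P).injective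

omit [CharZero l] in
theorem isSquare_neg_one_map {K : Type} [Field K] (φ : l →+* K) (h : IsSquare (-1 : l)) :
    IsSquare (-1 : K) := by simpa using h.map φ

theorem isSquare_mk_of_locallyGood (P : l[X]) [Fact (Irreducible P)] (hi : IsSquare (-1 : l))
    {f₀ g₀ f g : l[X]} (h : LocallyGood P f₀ g₀) (he : ConicEquiv f₀ g₀ f g)
    (hPf : P ∣ f) (hf : Squarefree f) : IsSquare (AdjoinRoot.mk P g) := by
  have := charZero_adjoinRoot P
  let K := AdjoinRoot P
  have hiK : IsSquare (-1 : K) := isSquare_neg_one_map (AdjoinRoot.of P) hi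
  have hc0 : AdjoinRoot.mk P f = 0 := AdjoinRoot.mk_eq_zero.2 hPf
  have hc1 : AdjoinRoot.mk P (derivative f) ≠ 0 := by
    intro h0
    have hs : IsCoprime f (derivative f) := PerfectField.separable_iff_squarefree.2 hf
    exact (Fact.out : Irreducible P).not_isUnit
      (hs.isUnit_of_dvd' hPf (AdjoinRoot.mk_eq_zero.1 h0))
  -- the general residue computation over an extension of the residue field
  have key : ∀ (K' : Type) [Field K'] [CharZero K'] (ι : K →+* K'),
      ConicSplit (algebraMap _ (FractionRing (PowerSeries K'))
          (PowerSeries.map ι (localExpansion P f₀)))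
        (algebraMap _ (FractionRing (PowerSeries K')) (PowerSeries.map ι (localExpansion P g₀))) →
      IsSquare (ι (AdjoinRoot.mk P g)) := by
    intro K' _ _ ι hs
    have hinj : Function.Injective ((algebraMap _ (FractionRing (PowerSeries K'))).comp
        ((PowerSeries.map ι).comp (localExpansion P))) :=
      (IsFractionRing.injective (PowerSeries K') (FractionRing (PowerSeries K'))).comp
        ((PowerSeries.map_injective ι ι.injective).comp (localExpansion_injective P))
    have h1 := (he _ _ hinj).1 hs
    have := ConicSplit.isSquare_constantCoeff (L := FractionRing (PowerSeries K'))
      (f := PowerSeries.map ι (localExpansion P f)) (g := PowerSeries.map ι (localExpansion P g))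
      (by rw [PowerSeries.constantCoeff_map_apply, localExpansion_constantCoeff, hc0, map_zero])
      (by rw [PowerSeries.coeff_map, localExpansion_coeff_one]; rwa [_root_.map_ne_zero]) h1
    rwa [PowerSeries.constantCoeff_map_apply, localExpansion_constantCoeff] at this
  have key' : ConicSplit (algebraMap _ (FractionRing (PowerSeries K)) (localExpansion P f₀))
        (algebraMap _ (FractionRing (PowerSeries K)) (localExpansion P g₀)) →
      IsSquare (AdjoinRoot.mk P g) := fun hs => by
    have := key K (RingHom.id K) (by simpa using hs)
    simpa using this
  rcases h with h | ⟨x, y, a, b, ⟨x', hx0, rfl⟩, ⟨y', hy0, rfl⟩, ha, hb, hf₀, hg₀⟩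
  · exact key' h
  by_contra hns
  have hext : ∀ c : K, (∀ (K' : Type) [Field K'] [CharZero K'] (ι : K →+* K'), IsSquare (ι c) →
      ConicSplit (algebraMap _ (FractionRing (PowerSeries K')) (PowerSeries.map ι x'))
        (algebraMap _ (FractionRing (PowerSeries K')) (PowerSeries.map ι y'))) →
      IsSquare (AdjoinRoot.mk P g * c) := by
    intro c hc
    obtain ⟨K', _, _, ι, hιc, hK'⟩ := exists_extension_isSquare K c
    refine (hK' (AdjoinRoot.mk P g) (key K' ι ?_)).resolve_left hns
    have hs := hc K' ι hιc
    let ψ : FractionRing (PowerSeries K) →+* FractionRing (PowerSeries K') :=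
      IsFractionRing.map (PowerSeries.map_injective ι ι.injective)
    have hψ : ∀ z, ψ (algebraMap _ _ z) = algebraMap _ _ (PowerSeries.map ι z) := fun z =>
      IsLocalization.map_eq _ z
    rw [← hψ, ← hψ, hf₀, hg₀, map_mul, map_mul, map_pow, map_pow,
      ConicSplit.mul_sq_left (by simpa using ha), ConicSplit.mul_sq_right (by simpa using hb),
      hψ, hψ]
    exact hs
  have hsq : ∀ (K' : Type) [Field K'] [CharZero K'] (ι : K →+* K') (z : PowerSeries K),
      PowerSeries.constantCoeff z ≠ 0 → IsSquare (ι (PowerSeries.constantCoeff z)) →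
      IsSquare (algebraMap _ (FractionRing (PowerSeries K')) (PowerSeries.map ι z)) := by
    intro K' _ _ ι z hz hs
    refine IsSquare.map _ (PowerSeries.isSquare_of_constantCoeff _ ?_ ?_)
    · rw [PowerSeries.constantCoeff_map_apply]; simpa using hz
    · rwa [PowerSeries.constantCoeff_map_apply]
  have h1 : IsSquare (AdjoinRoot.mk P g * PowerSeries.constantCoeff x') :=
    hext _ fun K' _ _ ι h => ConicSplit.of_isSquare_left _ (hsq K' ι x' hx0 h)
  have h2 : IsSquare (AdjoinRoot.mk P g * PowerSeries.constantCoeff y') :=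
    hext _ fun K' _ _ ι h => ConicSplit.of_isSquare_right _ (hsq K' ι y' hy0 h)
  have hg0 : AdjoinRoot.mk P g ≠ 0 := fun h => hns (by simp [h])
  have h3 : IsSquare (PowerSeries.constantCoeff (x' * y')) := by
    obtain ⟨s, hs⟩ := h1
    obtain ⟨t, ht⟩ := h2
    refine ⟨s * t / AdjoinRoot.mk P g, ?_⟩
    rw [map_mul]
    field_simp
    linear_combination (AdjoinRoot.mk P g * PowerSeries.constantCoeff y') * hs + s * s * ht
  have h4 := (PowerSeries.isSquare_of_constantCoeff (x' * y') (by simp [hx0, hy0]) h3).map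
    (algebraMap _ (FractionRing (PowerSeries K)))
  rw [map_mul] at h4
  have hiR : IsSquare (-1 : PowerSeries K) :=
    PowerSeries.isSquare_of_constantCoeff _ (by simp) (by simpa using hiK)
  have hiL : IsSquare (-1 : FractionRing (PowerSeries K)) := by
    simpa using hiR.map (algebraMap _ (FractionRing (PowerSeries K)))
  refine hns (key' ?_)
  rw [hf₀, hg₀, ConicSplit.mul_sq_left ha, ConicSplit.mul_sq_right hb]
  exact ConicSplit.of_isSquare_mul hiL h4

omit [CharZero l] in
/-- An element that is a square modulo every prime factor of a squarefree `f` is a square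
modulo `f`. -/
theorem exists_sq_sub_dvd {f g : l[X]} (hf : Squarefree f)
    (h : ∀ P : l[X], Irreducible P → P ∣ f → ∃ u, P ∣ u ^ 2 - g) : ∃ u, f ∣ u ^ 2 - g := by
  induction f using UniqueFactorizationMonoid.induction_on_prime with
  | h₁ => exact absurd hf (by simp)
  | h₂ x hx => exact ⟨0, hx.dvd⟩
  | h₃ a p ha hp ih =>
    obtain ⟨u, hu⟩ := ih (hf.squarefree_of_dvd (dvd_mul_left _ _))
      (fun P hP hPa => h P hP (hPa.mul_left _))
    obtain ⟨v, hv⟩ := h p hp.irreducible (dvd_mul_right _ _)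
    have hcop : IsCoprime p a := by
      rw [hp.irreducible.coprime_iff_not_dvd]
      exact fun hpa => hp.not_isUnit (hf p (mul_dvd_mul_left p hpa))
    have hcop' := hcop
    obtain ⟨s, t, hst⟩ := hcop'
    refine ⟨u * (s * p) + v * (t * a), hcop.mul_dvd ?_ ?_⟩
    · obtain ⟨w, hw⟩ := hv
      exact ⟨u ^ 2 * s ^ 2 * p + 2 * u * v * s * t * a - v ^ 2 * s * (1 + t * a) + w, by
        linear_combination hw + v ^ 2 * (1 + t * a) * hst⟩
    · obtain ⟨w, hw⟩ := hu
      exact ⟨v ^ 2 * t ^ 2 * a + 2 * u * v * s * t * p - u ^ 2 * t * (1 + s * p) + w, by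
        linear_combination hw + u ^ 2 * (1 + s * p) * hst⟩

omit [CharZero l] in
theorem ConicEquiv.refl (f g : l[X]) : ConicEquiv f g f g := fun _ _ _ _ => Iff.rfl

omit [CharZero l] in
/-- Legendre descent: a pair of polynomials for which Legendre's local conditions persist is
equivalent to a pair of constants. -/
theorem legendre_descent_of_isSquare {f₀ g₀ : l[X]}
    (hsq : ∀ (P : l[X]) [Fact (Irreducible P)] (f g : l[X]), ConicEquiv f₀ g₀ f g → P ∣ f →
      Squarefree f → IsSquare (AdjoinRoot.mk P g)) :
    ∀ (n : ℕ) (f g : l[X]), f ≠ 0 → g ≠ 0 → f.natDegree + g.natDegree = n →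
      ConicEquiv f₀ g₀ f g → ∃ a b : l, a ≠ 0 ∧ b ≠ 0 ∧ ConicEquiv f₀ g₀ (C a) (C b) := by
  intro n
  induction n using Nat.strong_induction_on with
  | _ n ih =>
  intro f g hf hg hn he
  wlog hd : g.natDegree ≤ f.natDegree generalizing f g
  · exact this g f hg hf (by omega)
      (he.trans fun _ _ _ _ => ConicSplit.comm) (by omega)
  rcases Nat.eq_zero_or_pos f.natDegree with hf0 | hf0
  · obtain ⟨a, rfl⟩ := natDegree_eq_zero.1 hf0
    obtain ⟨b, rfl⟩ := natDegree_eq_zero.1 (show g.natDegree = 0 by omega)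
    exact ⟨a, b, by simpa using hf, by simpa using hg, he⟩
  by_cases hsf : Squarefree f
  · obtain ⟨h, hh⟩ := exists_sq_sub_dvd (g := g) hsf (fun P hP hPf => by
      have : Fact (Irreducible P) := ⟨hP⟩
      obtain ⟨u, hu⟩ := hsq P f g he hPf hsf
      obtain ⟨u, rfl⟩ := AdjoinRoot.mk_surjective u
      refine ⟨u, ?_⟩
      rw [← AdjoinRoot.mk_eq_mk, hu, map_pow, sq])
    have hh' : f ∣ (h % f) ^ 2 - g := by
      have h1 : h % f = h - f * (h / f) := by
        rw [eq_sub_iff_add_eq]; exact EuclideanDomain.mod_add_div h f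
      obtain ⟨w, hw⟩ := hh
      exact ⟨w - 2 * h * (h / f) + f * (h / f) ^ 2, by rw [h1]; linear_combination hw⟩
    obtain ⟨f', hf'⟩ := hh'
    have hr : (h % f).natDegree < f.natDegree := natDegree_mod_lt h (by omega)
    by_cases hf'0 : f' = 0
    · have hgs : g = (h % f) ^ 2 := by rw [hf'0] at hf'; linear_combination -hf'
      refine ⟨1, 1, one_ne_zero, one_ne_zero, he.trans fun L _ φ _ => ?_⟩
      refine iff_of_true (ConicSplit.of_isSquare_right _ ?_)
        (ConicSplit.of_isSquare_right _ ?_)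
      · rw [hgs, map_pow]; exact ⟨_, sq _⟩
      · simp
    · have hdeg : f.natDegree + f'.natDegree ≤ max (2 * (h % f).natDegree) g.natDegree := by
        rw [← natDegree_mul hf hf'0, ← hf']
        refine (natDegree_sub_le _ _).trans ?_
        rw [natDegree_pow]
      refine ih (f'.natDegree + g.natDegree) (by omega) f' g hf'0 hg rfl
        (he.trans fun L _ φ hφ => ?_)
      refine ConicSplit.norm_iff (h := φ (h % f)) (r := 1) ?_ ?_ ?_
      · simpa [map_eq_zero_iff φ hφ] using hf
      · simpa [map_eq_zero_iff φ hφ] using hf'0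
      · rw [← map_mul, ← hf']; simp
  · rw [Squarefree] at hsf
    push Not at hsf
    obtain ⟨p, ⟨f', rfl⟩, hp⟩ := hsf
    have hp0 : p ≠ 0 := by rintro rfl; simp at hf
    have hf'0 : f' ≠ 0 := by rintro rfl; simp at hf
    have hpd : 0 < p.natDegree := by
      rw [Nat.pos_iff_ne_zero]
      intro h0
      obtain ⟨c, rfl⟩ := natDegree_eq_zero.1 h0
      exact hp (isUnit_C.2 (isUnit_iff_ne_zero.2 (by simpa using hp0)))
    have hdeg : (p * p * f').natDegree = p.natDegree + p.natDegree + f'.natDegree := by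
      rw [natDegree_mul (by simpa using hp0) hf'0, natDegree_mul hp0 hp0]
    refine ih (f'.natDegree + g.natDegree) (by omega) f' g hf'0 hg rfl
        (he.trans fun L _ φ hφ => ?_)
    rw [show p * p * f' = f' * p ^ 2 by ring, map_mul, map_pow, ConicSplit.mul_sq_left]
    simpa [map_eq_zero_iff φ hφ] using hp0

/-- A pair of polynomials that is locally good everywhere is equivalent to a pair of constants. -/
theorem legendre_descent (hi : IsSquare (-1 : l)) {f₀ g₀ : l[X]}
    (hloc : ∀ (P : l[X]) [Fact (Irreducible P)], LocallyGood P f₀ g₀) :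
    ∀ (n : ℕ) (f g : l[X]), f ≠ 0 → g ≠ 0 → f.natDegree + g.natDegree = n →
      ConicEquiv f₀ g₀ f g → ∃ a b : l, a ≠ 0 ∧ b ≠ 0 ∧ ConicEquiv f₀ g₀ (C a) (C b) :=
  legendre_descent_of_isSquare fun P _ _ _ he hPf hf =>
    isSquare_mk_of_locallyGood P hi (hloc P) he hPf hf

end LegendreDescent

section SpecialDiagonal

/-- The diagonal coefficients of the bihomogeneous quadratic form specialising to
`⟨1, x, y, xyF⟩` in the chart `x₀ = y₀ = 1`. -/
def specialDiag {R : Type} [CommRing R] (D E : Fin 4 → ℕ) (x₀ x₁ y₀ y₁ : R) : Fin 4 → R :=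
  ![x₀ ^ D 0 * y₀ ^ E 0,
    x₁ * x₀ ^ (D 1 - 1) * y₀ ^ E 1,
    x₀ ^ D 2 * (y₁ * y₀ ^ (E 2 - 1)),
    x₁ * y₁ * ((x₀ + x₁) ^ 2 * (y₀ + y₁) ^ 2 + x₀ * x₁ * (y₀ * y₁)) *
      x₀ ^ (D 3 - 3) * y₀ ^ (E 3 - 3)]

/-- The degrees for which `specialDiag` is bihomogeneous, of constant parity. -/
structure SpecialDegrees (D E : Fin 4 → ℕ) : Prop where
  one_le_D : 1 ≤ D 1
  one_le_E : 1 ≤ E 2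
  three_le_D : 3 ≤ D 3
  three_le_E : 3 ≤ E 3
  exists_D : ∃ (d : ℕ) (k : Fin 4 → ℕ), ∀ r, D r + 2 * k r = d
  exists_E : ∃ (d : ℕ) (k : Fin 4 → ℕ), ∀ r, E r + 2 * k r = d

theorem map_specialDiag {R S : Type} [CommRing R] [CommRing S] (φ : R →+* S) (D E : Fin 4 → ℕ)
    (x₀ x₁ y₀ y₁ : R) (r : Fin 4) :
    φ (specialDiag D E x₀ x₁ y₀ y₁ r) = specialDiag D E (φ x₀) (φ x₁) (φ y₀) (φ y₁) r := by
  fin_cases r <;> simp [specialDiag]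

theorem specialForm_of_specialDiag {L : Type} [Field L] {D E : Fin 4 → ℕ}
    (h : SpecialDegrees D E) {x₀ x₁ y₀ y₁ : L} (hx : x₀ ≠ 0) (hy : y₀ ≠ 0) {Z : Fin 4 → L}
    (h0 : ∃ r, Z r ≠ 0) (hZ : ∑ r, specialDiag D E x₀ x₁ y₀ y₁ r * Z r ^ 2 = 0) :
    ∃ z₀ z₁ z₂ z₃ : L, (z₀ ≠ 0 ∨ z₁ ≠ 0 ∨ z₂ ≠ 0 ∨ z₃ ≠ 0) ∧
      specialForm (x₁ / x₀) (y₁ / y₀) z₀ z₁ z₂ z₃ = 0 := by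
  obtain ⟨d, k, hk⟩ := h.exists_D
  obtain ⟨e, l, hl⟩ := h.exists_E
  obtain ⟨D1, hD1⟩ := Nat.exists_eq_add_of_le h.one_le_D
  obtain ⟨E2, hE2⟩ := Nat.exists_eq_add_of_le h.one_le_E
  obtain ⟨D3, hD3⟩ := Nat.exists_eq_add_of_le h.three_le_D
  obtain ⟨E3, hE3⟩ := Nat.exists_eq_add_of_le h.three_le_E
  let z : Fin 4 → L := fun r => Z r / (x₀ ^ k r * y₀ ^ l r)
  have hz : ∀ r, Z r = z r * (x₀ ^ k r * y₀ ^ l r) := fun r => by simp only [z]; field_simp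
  refine ⟨z 0, z 1, z 2, z 3, ?_, ?_⟩
  · obtain ⟨r, hr⟩ := h0
    have : z r ≠ 0 := by rintro h; rw [hz, h, zero_mul] at hr; exact hr rfl
    fin_cases r <;> simp at this <;> tauto
  · have h1 : x₀ ^ d * y₀ ^ e * specialForm (x₁ / x₀) (y₁ / y₀) (z 0) (z 1) (z 2) (z 3) = 0 := by
      rw [← hZ, Fin.sum_univ_four, hz 0, hz 1, hz 2, hz 3]
      simp only [specialDiag, specialForm, Matrix.cons_val, mul_add]
      congr 1
      congr 1
      congr 1
      · rw [← hk 0, ← hl 0]; ring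
      · rw [← hk 1, ← hl 1, hD1, Nat.add_sub_cancel_left]; field_simp; ring
      · rw [← hk 2, ← hl 2, hE2, Nat.add_sub_cancel_left]; field_simp; ring
      · rw [← hk 3, ← hl 3, hD3, hE3, Nat.add_sub_cancel_left, Nat.add_sub_cancel_left]
        field_simp; ring
    simpa [hx, hy] using h1

end SpecialDiagonal

section ComponentLemma

open Polynomial

variable {l : Type} [Field l] [CharZero l]

/-- A conic with unit coefficients over `l((t))` splits if its reduction does. -/
theorem ConicSplit.lift {L : Type} [Field L] [Algebra (PowerSeries l) L]
    [IsFractionRing (PowerSeries l) L] {f g : PowerSeries l}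
    (hf : PowerSeries.constantCoeff f ≠ 0) (hg : PowerSeries.constantCoeff g ≠ 0)
    (h : ConicSplit (PowerSeries.constantCoeff f) (PowerSeries.constantCoeff g)) :
    ConicSplit (algebraMap _ L f) (algebraMap _ L g) := by
  have key : ∀ f : PowerSeries l, PowerSeries.constantCoeff f ≠ 0 → ∃ s : L, s ≠ 0 ∧
      algebraMap _ L (PowerSeries.C (PowerSeries.constantCoeff f)) * s ^ 2 = algebraMap _ L f := by
    intro f hf
    obtain ⟨s, hs⟩ := PowerSeries.isSquare_of_constantCoeff
      (PowerSeries.C (PowerSeries.constantCoeff f)⁻¹ * f) (by simp [hf]) (by simp [hf])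
    have h2 : PowerSeries.C (PowerSeries.constantCoeff f) * s ^ 2 = f := by
      rw [sq, ← hs, ← mul_assoc, ← map_mul, mul_inv_cancel₀ hf, map_one, one_mul]
    refine ⟨algebraMap _ L s, ?_, ?_⟩
    · rw [Ne, IsFractionRing.to_map_eq_zero_iff]
      rintro rfl
      rw [← h2] at hf
      simp at hf
    · rw [← map_pow, ← map_mul, h2]
  obtain ⟨s, hs, hfs⟩ := key f hf
  obtain ⟨t, ht, hgt⟩ := key g hg
  rw [← hfs, ← hgt, ConicSplit.mul_sq_left hs, ConicSplit.mul_sq_right ht]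
  exact h.map ((algebraMap _ L).comp PowerSeries.C)

omit [CharZero l] in
theorem conicSplit_mul_iff {L : Type} [Field L] {a b c d : L} (ha : a ≠ 0) (hc : c ≠ 0) :
    ConicSplit (a * b) (c * d) ↔ ConicSplit (b / a) (d / c) := by
  rw [← ConicSplit.mul_sq_left (a := b / a) ha, ← ConicSplit.mul_sq_right (b := d / c) hc]
  have h1 : b / a * a ^ 2 = a * b := by field_simp
  have h2 : d / c * c ^ 2 = c * d := by field_simp
  rw [h1, h2]

/-- Transport of nonsplitness from `0` to `∞` along a rational curve on which the special
quadratic form is isotropic. -/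
theorem not_conicSplit_leading (hi : IsSquare (-1 : l)) {D E : Fin 4 → ℕ}
    (hDE : SpecialDegrees D E) {X₀ X₁ Y₀ Y₁ : l[X]} {Z : Fin 4 → l[X]} (hZ0 : ∃ r, Z r ≠ 0)
    (hZ : ∑ r, specialDiag D E X₀ X₁ Y₀ Y₁ r * Z r ^ 2 = 0)
    {n m : ℕ} (hX₀ : ∀ j < n, X₀.coeff j = 0) (hX₁ : ∀ j < n, X₁.coeff j = 0)
    (hY₀ : ∀ j < m, Y₀.coeff j = 0) (hY₁ : ∀ j < m, Y₁.coeff j = 0)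
    (hX₀n : X₀.coeff n ≠ 0) (hX₁n : X₁.coeff n ≠ 0)
    (hY₀m : Y₀.coeff m ≠ 0) (hY₁m : Y₁.coeff m ≠ 0)
    (hns : ¬ ConicSplit (X₀.coeff n * X₁.coeff n) (Y₀.coeff m * Y₁.coeff m))
    {N M : ℕ} (hX₀N : X₀.natDegree ≤ N) (hX₁N : X₁.natDegree ≤ N)
    (hY₀M : Y₀.natDegree ≤ M) (hY₁M : Y₁.natDegree ≤ M)
    (hXN : X₀.coeff N ≠ 0 ∨ X₁.coeff N ≠ 0) (hYM : Y₀.coeff M ≠ 0 ∨ Y₁.coeff M ≠ 0) :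
    X₀.coeff N ≠ 0 ∧ X₁.coeff N ≠ 0 ∧ Y₀.coeff M ≠ 0 ∧ Y₁.coeff M ≠ 0 ∧
      ¬ ConicSplit (X₀.coeff N * X₁.coeff N) (Y₀.coeff M * Y₁.coeff M) := by
  have hX₀0 : X₀ ≠ 0 := by rintro rfl; simp at hX₀n
  have hX₁0 : X₁ ≠ 0 := by rintro rfl; simp at hX₁n
  have hY₀0 : Y₀ ≠ 0 := by rintro rfl; simp at hY₀m
  have hY₁0 : Y₁ ≠ 0 := by rintro rfl; simp at hY₁m
  -- isotropy over any local field
  have hiso : ∀ (K : Type) [Field K] [CharZero K] (_ : IsSquare (-1 : K))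
      (φ : l[X] →+* FractionRing (PowerSeries K)), Function.Injective φ →
      (IsPSUnit K (φ X₁ / φ X₀) ∧ IsPSUnit K (φ Y₁ / φ Y₀)) ∨
        ConicSplit (φ X₁ / φ X₀) (φ Y₁ / φ Y₀) := by
    intro K _ _ hiK φ hφ
    have hne : ∀ {p : l[X]}, p ≠ 0 → φ p ≠ 0 := fun hp => by
      simpa [map_eq_zero_iff φ hφ] using hp
    obtain ⟨r, hr⟩ := hZ0
    obtain ⟨z₀, z₁, z₂, z₃, hz0, hz⟩ := specialForm_of_specialDiag hDE (hne hX₀0) (hne hY₀0)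
      (x₁ := φ X₁) (y₁ := φ Y₁) (Z := fun r => φ (Z r)) ⟨r, hne hr⟩ (by
        have := congrArg φ hZ
        simpa only [map_sum, map_mul, map_pow, map_specialDiag, map_zero] using this)
    exact unit_or_conicSplit_of_specialForm hiK (div_ne_zero (hne hX₁0) (hne hX₀0))
      (div_ne_zero (hne hY₁0) (hne hY₀0)) hz0 hz
  obtain ⟨a, b, ha, hb, hab⟩ := legendre_descent hi (f₀ := X₀ * X₁) (g₀ := Y₀ * Y₁) (by
    intro P _
    have := charZero_adjoinRoot P
    have hinj : Function.Injective ((algebraMap _ (FractionRing (PowerSeries (AdjoinRoot P)))).comp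
        (localExpansion P)) :=
      (IsFractionRing.injective _ (FractionRing (PowerSeries (AdjoinRoot P)))).comp
        (localExpansion_injective P)
    have hne : ∀ {p : l[X]}, p ≠ 0 → algebraMap _ (FractionRing (PowerSeries (AdjoinRoot P)))
        (localExpansion P p) ≠ 0 := fun {p} hp => by
      simpa using (map_ne_zero_iff _ hinj).2 hp
    simp only [LocallyGood, map_mul]
    rcases hiso _ (isSquare_neg_one_map (AdjoinRoot.of P) hi) _ hinj with h | h
    · refine Or.inr ⟨_, _, _, _, h.1, h.2, hne hX₀0, hne hY₀0, ?_, ?_⟩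
      · have := hne hX₀0
        simp only [RingHom.comp_apply]
        field_simp
      · have := hne hY₀0
        simp only [RingHom.comp_apply]
        field_simp
    · exact Or.inl ((conicSplit_mul_iff (hne hX₀0) (hne hY₀0)).2 h)) _ _ _
      (mul_ne_zero hX₀0 hX₁0) (mul_ne_zero hY₀0 hY₁0) rfl (ConicEquiv.refl _ _)
  let K := FractionRing (PowerSeries l)
  have hinjK : Function.Injective (algebraMap (PowerSeries l) K) := IsFractionRing.injective _ _
  have hXK : algebraMap (PowerSeries l) K PowerSeries.X ≠ 0 :=
    (map_ne_zero_iff _ hinjK).2 PowerSeries.X_ne_zero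
  -- nonsplitness of the constants, from the behaviour at zero
  have hnab : ¬ ConicSplit a b := by
    intro hs
    have hinj : Function.Injective ((algebraMap (PowerSeries l) K).comp
        (Polynomial.coeToPowerSeries.ringHom)) := by
      exact hinjK.comp (Polynomial.coe_injective l)
    have hs' : ConicSplit (((algebraMap (PowerSeries l) K).comp
        (Polynomial.coeToPowerSeries.ringHom)) (C a)) (((algebraMap (PowerSeries l) K).comp
        (Polynomial.coeToPowerSeries.ringHom)) (C b)) :=
      hs.map (((algebraMap (PowerSeries l) K).comp
        (Polynomial.coeToPowerSeries.ringHom)).comp C)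
    have h1 := (hab K _ hinj).2 hs'
    obtain ⟨X₀', hX₀'⟩ := X_pow_dvd_iff.2 hX₀
    obtain ⟨X₁', hX₁'⟩ := X_pow_dvd_iff.2 hX₁
    obtain ⟨Y₀', hY₀'⟩ := X_pow_dvd_iff.2 hY₀
    obtain ⟨Y₁', hY₁'⟩ := X_pow_dvd_iff.2 hY₁
    have e1 : X₀ * X₁ = (X₀' * X₁') * (X ^ n) ^ 2 := by rw [hX₀', hX₁']; ring
    have e2 : Y₀ * Y₁ = (Y₀' * Y₁') * (X ^ m) ^ 2 := by rw [hY₀', hY₁']; ring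
    have hpow : ∀ n : ℕ, ((algebraMap (PowerSeries l) K).comp
        (Polynomial.coeToPowerSeries.ringHom)) (X ^ n) ≠ 0 := fun n =>
      (map_ne_zero_iff _ hinj).2 (by simp)
    rw [e1, e2, map_mul _ _ ((X ^ n) ^ 2), map_mul _ _ ((X ^ m) ^ 2), map_pow _ (X ^ n) 2,
      map_pow _ (X ^ m) 2, ConicSplit.mul_sq_left (hpow n),
      ConicSplit.mul_sq_right (hpow m)] at h1
    apply hns
    have h2 := ConicSplit.constantCoeff (k := l) (L := K) h1
    simpa [hX₀', hX₁', hY₀', hY₁', coeff_X_pow_mul'] using h2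
  -- the behaviour at infinity
  set T : K := algebraMap (PowerSeries l) K PowerSeries.X with hT
  let ψ : l[X] →+* K := eval₂RingHom ((algebraMap (PowerSeries l) K).comp PowerSeries.C) T⁻¹
  have hψ : ∀ (p : l[X]) (N : ℕ), p.natDegree ≤ N →
      ψ p = algebraMap (PowerSeries l) K (reflect N p : l[X]) * (T⁻¹) ^ N := by
    intro p N hp
    let _ : Invertible T⁻¹ := invertibleOfNonzero (inv_ne_zero hXK)
    have h1 := eval₂_reflect_mul_pow ((algebraMap (PowerSeries l) K).comp PowerSeries.C)
      T⁻¹ N p hp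
    rw [invOf_eq_inv, inv_inv, hT, ← hom_eval₂, eval₂_C_X_eq_coe] at h1
    exact h1.symm
  have hψinj : Function.Injective ψ := by
    rw [injective_iff_map_eq_zero]
    intro p hp
    rw [hψ p _ le_rfl, mul_eq_zero, or_iff_left (by simpa using fun h => absurd h hXK),
      map_eq_zero_iff _ hinjK, Polynomial.coe_eq_zero_iff, reflect_eq_zero_iff] at hp
    exact hp
  have hquot : ∀ (p q : l[X]) (N : ℕ), p.natDegree ≤ N → q.natDegree ≤ N →
      ψ p / ψ q = algebraMap (PowerSeries l) K (reflect N p : l[X]) /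
        algebraMap (PowerSeries l) K (reflect N q : l[X]) := by
    intro p q N hp hq
    rw [hψ p N hp, hψ q N hq, mul_div_mul_right _ _ (pow_ne_zero _ (inv_ne_zero hXK))]
  have hcc : ∀ (p : l[X]) (N : ℕ),
      PowerSeries.constantCoeff ((reflect N p : l[X]) : PowerSeries l) = p.coeff N := by
    intro p N
    rw [← PowerSeries.coeff_zero_eq_constantCoeff_apply, Polynomial.coeff_coe, coeff_reflect,
      revAt_le (Nat.zero_le N), Nat.sub_zero]
  have hreflect : ∀ {p : l[X]} (N : ℕ), p ≠ 0 →
      algebraMap (PowerSeries l) K (reflect N p : l[X]) ≠ 0 := fun N hp =>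
    (map_ne_zero_iff _ hinjK).2 (by
      rwa [Ne, Polynomial.coe_eq_zero_iff, reflect_eq_zero_iff])
  have hnψ : ¬ ConicSplit (ψ X₁ / ψ X₀) (ψ Y₁ / ψ Y₀) := by
    rw [← conicSplit_mul_iff ((map_ne_zero_iff _ hψinj).2 hX₀0)
      ((map_ne_zero_iff _ hψinj).2 hY₀0), ← map_mul, ← map_mul]
    intro h
    have h1 := (hab K ψ hψinj).1 h
    have h2 : ∀ a : l, ψ (C a) = algebraMap (PowerSeries l) K (PowerSeries.C a) := fun a =>
      eval₂_C _ _
    rw [h2, h2] at h1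
    have h3 := ConicSplit.constantCoeff (k := l) (L := K) h1
    rw [PowerSeries.constantCoeff_C, PowerSeries.constantCoeff_C] at h3
    exact hnab h3
  have hunit : ∀ (p q : l[X]) (N : ℕ), p.natDegree ≤ N → q.natDegree ≤ N → q ≠ 0 →
      IsPSUnit l (ψ p / ψ q) → (q.coeff N ≠ 0 ∨ p.coeff N ≠ 0) →
        q.coeff N ≠ 0 ∧ p.coeff N ≠ 0 := by
    rintro p q N hp hq hq0 ⟨u, hu0, hu⟩ h
    rw [hquot p q N hp hq, eq_div_iff (hreflect N hq0), ← map_mul] at hu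
    have h1 := congrArg PowerSeries.constantCoeff (hinjK hu)
    rw [map_mul, hcc, hcc] at h1
    rw [← h1] at h ⊢
    simp only [ne_eq, mul_eq_zero, hu0, false_or] at h ⊢
    tauto
  obtain ⟨hux, huy⟩ := (hiso l hi ψ hψinj).resolve_right hnψ
  obtain ⟨a1, a2⟩ := hunit X₁ X₀ N hX₁N hX₀N hX₀0 hux hXN
  obtain ⟨b1, b2⟩ := hunit Y₁ Y₀ M hY₁M hY₀M hY₀0 huy hYM
  refine ⟨a1, a2, b1, b2, fun h => hnψ ?_⟩
  rw [hquot X₁ X₀ N hX₁N hX₀N, hquot Y₁ Y₀ M hY₁M hY₀M,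
    ← conicSplit_mul_iff (hreflect N hX₀0) (hreflect M hY₀0), ← map_mul, ← map_mul]
  refine ConicSplit.lift (l := l) ?_ ?_ ?_ <;> simp only [map_mul, hcc]
  · exact mul_ne_zero a1 a2
  · exact mul_ne_zero b1 b2
  · exact h

end ComponentLemma

section Scaling

open MvPolynomial

theorem eval₂_bihomogeneous_scale {R S : Type} [CommRing R] [CommRing S] (f : R →+* S)
    {φ : MvPolynomial (Fin 4) R} {a b : ℕ} (ha : IsWeightedHomogeneous p1p1Weight1 φ a)
    (hb : IsWeightedHomogeneous p1p1Weight2 φ b) (P : Fin 4 → S) (lam mu : S) :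
    eval₂ f (fun p => ![lam, lam, mu, mu] p * P p) φ = lam ^ a * mu ^ b * eval₂ f P φ := by
  rw [eval₂_eq', eval₂_eq', Finset.mul_sum]
  refine Finset.sum_congr rfl fun s hs => ?_
  have h1 := ha (mem_support_iff.1 hs)
  have h2 := hb (mem_support_iff.1 hs)
  simp only [Finsupp.weight_apply, Finsupp.sum_fintype, Fin.sum_univ_four, p1p1Weight1,
    p1p1Weight2, Matrix.cons_val, smul_eq_mul, zero_mul, mul_zero, mul_one, add_zero, zero_add,
    implies_true] at h1 h2
  rw [← h1, ← h2, Fin.prod_univ_four, Fin.prod_univ_four]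
  simp only [Matrix.cons_val]
  ring

end Scaling

section Newton

open Polynomial

variable {E : Type} [Field E]

/-- The residues of the ratios `a₁ / a₀` and `b₁ / b₀` are nonzero and define a nonsplit conic
over the residue field of `W`. -/
def NonsplitRatios (W : ValuationSubring E) (a₀ a₁ b₀ b₁ : E) : Prop :=
  a₀ ≠ 0 ∧ b₀ ≠ 0 ∧ ∃ x y : W, a₁ = x * a₀ ∧ b₁ = y * b₀ ∧
    IsLocalRing.residue W x ≠ 0 ∧ IsLocalRing.residue W y ≠ 0 ∧
    ¬ ConicSplit (IsLocalRing.residue W x) (IsLocalRing.residue W y)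

theorem exists_lift_of_valuation_le_one (W : ValuationSubring E) (p : E[X])
    (h : ∀ k, W.valuation (p.coeff k) ≤ 1) : ∃ q : W[X], q.map W.subtype = p := by
  have : p ∈ Polynomial.lifts W.subtype := by
    rw [Polynomial.lifts_iff_coeff_lifts]
    intro k
    exact ⟨⟨p.coeff k, (W.valuation_le_one_iff _).1 (h k)⟩, rfl⟩
  rwa [Polynomial.mem_lifts] at this

theorem residue_eq_zero_iff_valuation (W : ValuationSubring E) (x : W) :
    IsLocalRing.residue W x = 0 ↔ W.valuation (x : E) < 1 := by
  rw [IsLocalRing.residue_eq_zero_iff, ValuationSubring.valuation_lt_one_iff]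

/-- A quadratic form over the polynomial ring in the coordinates of `ℙ¹ × ℙ¹`, with coefficients
in a valuation ring `W`, reducing to the special diagonal form. -/
structure ReducesToSpecial {W : Type} [CommRing W] [IsLocalRing W] (D F : Fin 4 → ℕ)
    (A : Fin 4 → Fin 4 → MvPolynomial (Fin 4) W) : Prop where
  degrees : SpecialDegrees D F
  homogeneous₁ : ∀ i j, (A i j).IsWeightedHomogeneous p1p1Weight1 ((D i + D j) / 2)
  homogeneous₂ : ∀ i j, (A i j).IsWeightedHomogeneous p1p1Weight2 ((F i + F j) / 2)
  map_residue : ∀ i j, MvPolynomial.map (IsLocalRing.residue W) (A i j) =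
    if i = j then specialDiag D F (MvPolynomial.X 0) (MvPolynomial.X 1) (MvPolynomial.X 2)
      (MvPolynomial.X 3) i else 0

theorem ReducesToSpecial.scale {W S : Type} [CommRing W] [IsLocalRing W] [CommRing S]
    {D F : Fin 4 → ℕ} {A : Fin 4 → Fin 4 → MvPolynomial (Fin 4) W} (h : ReducesToSpecial D F A)
    (f : W →+* S) (P : Fin 4 → S) (lam mu : S) : ∃ k l : Fin 4 → ℕ, ∀ (nu : S) (Z : Fin 4 → S),
      ∑ i, ∑ j, (A i j).eval₂ f P * Z i * Z j = 0 →
      ∑ i, ∑ j, (A i j).eval₂ f (fun p => ![lam, lam, mu, mu] p * P p) *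
        (nu * (lam ^ k i * mu ^ l i) * Z i) * (nu * (lam ^ k j * mu ^ l j) * Z j) = 0 := by
  obtain ⟨d, k, hk⟩ := h.degrees.exists_D
  obtain ⟨e, l, hl⟩ := h.degrees.exists_E
  refine ⟨k, l, fun nu Z hZ => ?_⟩
  have : nu ^ 2 * lam ^ d * mu ^ e * ∑ i, ∑ j, (A i j).eval₂ f P * Z i * Z j = 0 := by
    rw [hZ, mul_zero]
  rw [← this, Finset.mul_sum]
  refine Finset.sum_congr rfl fun i _ => ?_
  rw [Finset.mul_sum]
  refine Finset.sum_congr rfl fun j _ => ?_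
  rw [eval₂_bihomogeneous_scale f (h.homogeneous₁ i j) (h.homogeneous₂ i j)]
  have h1 : d = (D i + D j) / 2 + k i + k j := by have := hk i; have := hk j; omega
  have h2 : e = (F i + F j) / 2 + l i + l j := by have := hl i; have := hl j; omega
  rw [h1, h2]
  ring

theorem ReducesToSpecial.residue {W S : Type} [CommRing W] [IsLocalRing W] [CommRing S]
    {D F : Fin 4 → ℕ} {A : Fin 4 → Fin 4 → MvPolynomial (Fin 4) W} (h : ReducesToSpecial D F A)
    (f : IsLocalRing.ResidueField W →+* S) (P Z : Fin 4 → S)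
    (hZ : ∑ i, ∑ j, (A i j).eval₂ (f.comp (IsLocalRing.residue W)) P * Z i * Z j = 0) :
    ∑ i, specialDiag D F (P 0) (P 1) (P 2) (P 3) i * Z i ^ 2 = 0 := by
  rw [← hZ]
  refine Finset.sum_congr rfl fun i _ => ?_
  have h1 : ∀ j, (A i j).eval₂ (f.comp (IsLocalRing.residue W)) P =
      if i = j then specialDiag D F (P 0) (P 1) (P 2) (P 3) i else 0 := by
    intro j
    rw [← MvPolynomial.eval₂_map, h.map_residue, ← MvPolynomial.coe_eval₂Hom]
    split_ifs
    · rw [map_specialDiag]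
      simp
    · simp
  simp only [h1]
  rw [Finset.sum_eq_single i (by intro j _ hj; simp [hj.symm]) (by simp)]
  simp only [if_true]
  ring

/-- Rescaling the curve parameter and the homogeneous coordinates, and reducing modulo the maximal
ideal of the valuation ring. -/
theorem ReducesToSpecial.exists_reduction {W : ValuationSubring E} {D F : Fin 4 → ℕ}
    {A : Fin 4 → Fin 4 → MvPolynomial (Fin 4) W} (h : ReducesToSpecial D F A)
    {P Z : Fin 4 → E[X]} (hZ0 : ∃ i, Z i ≠ 0)
    (hZ : ∑ i, ∑ j, (A i j).eval₂ (C.comp W.subtype) P * Z i * Z j = 0)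
    {c lam mu : E} (hc : c ≠ 0) (hlam : lam ≠ 0) (hmu : mu ≠ 0)
    (hv : ∀ p k, W.valuation (![lam, lam, mu, mu] p * (P p).coeff k * c ^ k) ≤ 1) :
    ∃ q : Fin 4 → W[X],
      (∀ p k, ((q p).coeff k : E) = ![lam, lam, mu, mu] p * (P p).coeff k * c ^ k) ∧
      ∃ Zb : Fin 4 → (IsLocalRing.ResidueField W)[X], (∃ i, Zb i ≠ 0) ∧
        ∑ i, specialDiag D F ((q 0).map (IsLocalRing.residue W))
          ((q 1).map (IsLocalRing.residue W)) ((q 2).map (IsLocalRing.residue W))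
          ((q 3).map (IsLocalRing.residue W)) i * Zb i ^ 2 = 0 := by
  let σ : E[X] →+* E[X] := Polynomial.compRingHom (C c * X)
  have hσ : ∀ (p : E[X]) k, (σ p).coeff k = p.coeff k * c ^ k := fun p k => by
    simp only [σ, Polynomial.coe_compRingHom_apply, Polynomial.comp_C_mul_X_coeff]
  have hσC : σ.comp (C.comp W.subtype) = C.comp W.subtype := by
    ext x : 1
    simp [σ]
  have hσ0 : ∀ p : E[X], p ≠ 0 → σ p ≠ 0 := by
    intro p hp h0
    apply hp
    ext k
    have := congrArg (fun q => coeff q k) h0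
    simp only [hσ, coeff_zero, mul_eq_zero, pow_eq_zero_iff', hc, false_and, or_false] at this
    simpa using this
  obtain ⟨k, l, hkl⟩ := h.scale (C.comp W.subtype) (fun p => σ (P p)) (C lam) (C mu)
  have hsum : ∑ i, ∑ j, (A i j).eval₂ (C.comp W.subtype) (fun p => σ (P p)) * σ (Z i) * σ (Z j)
      = 0 := by
    have := congrArg σ hZ
    simp only [map_sum, map_mul, map_zero, MvPolynomial.hom_eval₂, hσC] at this
    exact this
  let Y : Fin 4 → E[X] := fun i => C lam ^ k i * C mu ^ l i * σ (Z i)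
  have hY0 : ∃ i, Y i ≠ 0 := by
    obtain ⟨i, hi⟩ := hZ0
    exact ⟨i, mul_ne_zero (by simp [hlam, hmu]) (hσ0 _ hi)⟩
  -- normalise the point
  let B := Finset.univ.sup (fun i => (Y i).natDegree)
  obtain ⟨nu, hnu, y, hy, ⟨i₁, k₁⟩, hy1⟩ := ValuationRing.exists_primitive (R := W)
    (fun ik : Fin 4 × Fin (B + 1) => (Y ik.1).coeff ik.2) (by
      obtain ⟨i, hi⟩ := hY0
      refine ⟨(i, ⟨(Y i).natDegree, Nat.lt_succ_of_le
        (Finset.le_sup (f := fun i => (Y i).natDegree) (Finset.mem_univ i))⟩), ?_⟩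
      simpa using hi)
  have hlift : ∀ i, ∃ q : W[X], q.map W.subtype = C nu * Y i := by
    intro i
    apply exists_lift_of_valuation_le_one
    intro k
    rw [coeff_C_mul]
    by_cases hk : k < B + 1
    · have := hy (i, ⟨k, hk⟩)
      simp only at this
      rw [this]
      exact W.valuation_le_one _
    · rw [coeff_eq_zero_of_natDegree_lt, mul_zero, map_zero]
      · exact zero_le
      · have := Finset.le_sup (f := fun i => (Y i).natDegree) (Finset.mem_univ i)
        exact lt_of_le_of_lt this (by omega)
  choose z hz using hlift
  have hliftP : ∀ p, ∃ q : W[X], q.map W.subtype =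
      ![C lam, C lam, C mu, C mu] p * σ (P p) := by
    intro p
    apply exists_lift_of_valuation_le_one
    intro k
    have h1 : ![C lam, C lam, C mu, C mu] p = C (![lam, lam, mu, mu] p) := by
      fin_cases p <;> rfl
    rw [h1, coeff_C_mul, hσ, ← mul_assoc]
    exact hv p k
  choose q hq using hliftP
  have hinj : Function.Injective (Polynomial.mapRingHom W.subtype) :=
    Polynomial.map_injective _ Subtype.val_injective
  have hC : (Polynomial.mapRingHom W.subtype).comp C = C.comp W.subtype := by
    ext x : 1; simp
  have hW : ∑ i, ∑ j, (A i j).eval₂ C q * z i * z j = 0 := by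
    apply hinj
    have h2 := hkl (C nu) (fun i => σ (Z i)) hsum
    simp only [map_sum, map_mul, map_zero, MvPolynomial.hom_eval₂, hC]
    rw [← h2]
    refine Finset.sum_congr rfl fun i _ => Finset.sum_congr rfl fun j _ => ?_
    have h3 : ∀ i, mapRingHom W.subtype (z i) =
        C nu * (C lam ^ k i * C mu ^ l i) * σ (Z i) := fun i => by
      rw [coe_mapRingHom, hz]; simp only [Y]; ring
    rw [h3, h3]
    have h4 : (⇑(mapRingHom W.subtype) ∘ q) =
        fun p => ![C lam, C lam, C mu, C mu] p * σ (P p) := funext fun p => hq p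
    rw [← h4]
    rfl
  refine ⟨q, ?_, fun i => (z i).map (IsLocalRing.residue W), ⟨i₁, ?_⟩, ?_⟩
  · intro p k
    have h1 := congrArg (fun r => coeff r k) (hq p)
    have h2 : ![C lam, C lam, C mu, C mu] p = C (![lam, lam, mu, mu] p) := by
      fin_cases p <;> rfl
    simp only [coeff_map, h2, coeff_C_mul, hσ, ← mul_assoc] at h1
    exact h1
  · intro h0
    have h1 := congrArg (fun r => coeff r k₁) h0
    simp only [coeff_map, coeff_zero] at h1
    have h2 : (z i₁).coeff k₁ = 1 := by
      apply Subtype.val_injective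
      have h3 := congrArg (fun r => coeff r k₁) (hz i₁)
      simp only [coeff_map, coeff_C_mul] at h3
      have h4 := hy (i₁, k₁)
      rw [hy1, map_one] at h4
      exact h3.trans h4
    rw [h2, map_one] at h1
    exact one_ne_zero h1
  · refine h.residue C (fun p => (q p).map (IsLocalRing.residue W)) _ ?_
    have := congrArg (Polynomial.mapRingHom (IsLocalRing.residue W)) hW
    simp only [map_sum, map_mul, map_zero, MvPolynomial.hom_eval₂] at this
    have hC' : (Polynomial.mapRingHom (IsLocalRing.residue W)).comp C =
        C.comp (IsLocalRing.residue W) := by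
      ext x : 1; simp
    rw [hC'] at this
    exact this

end Newton

section Traversal

open Polynomial

variable {E : Type} [Field E]

/-- The pair of columns `N` and `M` lies on the Newton polygon of the coordinates `P` at slope
at least `γ`, and carries a nonsplit pair of ratios. -/
structure NewtonVertex (W : ValuationSubring E) (P : Fin 4 → E[X]) (N M : ℕ)
    (γ : W.ValueGroup) : Prop where
  nonsplit : NonsplitRatios W ((P 0).coeff N) ((P 1).coeff N) ((P 2).coeff M) ((P 3).coeff M)
  below : ∀ p, ∀ k < ![N, N, M, M] p, W.valuation ((P p).coeff k) ≤
    W.valuation (![(P 0).coeff N, (P 0).coeff N, (P 2).coeff M, (P 2).coeff M] p) *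
      γ ^ (![N, N, M, M] p - k)
  above : ∀ p, ∀ k > ![N, N, M, M] p, W.valuation ((P p).coeff k) * γ ^ (k - ![N, N, M, M] p) <
    W.valuation (![(P 0).coeff N, (P 0).coeff N, (P 2).coeff M, (P 2).coeff M] p)

theorem NewtonVertex.exists_slope {W : ValuationSubring E} {P : Fin 4 → E[X]} {N M : ℕ}
    {γ : W.ValueGroup} (h : NewtonVertex W P N M γ)
    (hroot : ∀ e : E, e ≠ 0 → ∀ n > 0, ∃ c : E, W.valuation c ^ n = W.valuation e)
    (hne : ∃ p, ∃ k > ![N, N, M, M] p, (P p).coeff k ≠ 0) :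
    ∃ c : E, c ≠ 0 ∧
      let s := ![(P 0).coeff N, (P 0).coeff N, (P 2).coeff M, (P 2).coeff M]
      let B := ![N, N, M, M]
      (∀ p k, W.valuation ((P p).coeff k * c ^ k) ≤ W.valuation (s p * c ^ B p)) ∧
      (∀ p, ∀ k < B p, W.valuation ((P p).coeff k * c ^ k) < W.valuation (s p * c ^ B p)) ∧
      ∃ p, ∃ k > B p, W.valuation ((P p).coeff k * c ^ k) = W.valuation (s p * c ^ B p) := by
  classical
  set s := ![(P 0).coeff N, (P 0).coeff N, (P 2).coeff M, (P 2).coeff M] with hs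
  set B := ![N, N, M, M] with hB
  have hs0 : ∀ p, s p ≠ 0 := by
    have := h.nonsplit.1
    have := h.nonsplit.2.1
    intro p; fin_cases p <;> assumption
  let L := Finset.univ.sup (fun p => (P p).natDegree)
  have hL : ∀ p k, (P p).coeff k ≠ 0 → k < L + 1 := fun p k hk => Nat.lt_succ_of_le
    ((le_natDegree_of_ne_zero hk).trans
      (Finset.le_sup (f := fun p => (P p).natDegree) (Finset.mem_univ p)))
  let S : Finset (Fin 4 × ℕ) := (Finset.univ ×ˢ Finset.range (L + 1)).filter
    fun x => B x.1 < x.2 ∧ (P x.1).coeff x.2 ≠ 0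
  have hS : ∀ p k, (p, k) ∈ S ↔ B p < k ∧ (P p).coeff k ≠ 0 := fun p k => by
    simp only [S, Finset.mem_filter, Finset.mem_product, Finset.mem_univ, true_and,
      Finset.mem_range]
    exact ⟨fun h => h.2, fun h => ⟨hL p k h.2, h⟩⟩
  have hc : ∀ x : Fin 4 × ℕ, ∃ c : E, x ∈ S → W.valuation c ^ (x.2 - B x.1) =
      W.valuation (s x.1 / (P x.1).coeff x.2) := by
    rintro ⟨p, k⟩
    by_cases hx : (p, k) ∈ S
    · have h1 := (hS p k).1 hx
      obtain ⟨c, hc⟩ := hroot (s p / (P p).coeff k) (div_ne_zero (hs0 p) h1.2) (k - B p)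
        (Nat.sub_pos_of_lt h1.1)
      exact ⟨c, fun _ => hc⟩
    · exact ⟨0, fun h => absurd h hx⟩
  choose c hc using hc
  obtain ⟨p₀, k₀, hk₀, hpk₀⟩ := hne
  obtain ⟨⟨p₁, k₁⟩, hx₁, hmin⟩ := S.exists_min_image (fun x => W.valuation (c x))
    ⟨(p₀, k₀), (hS _ _).2 ⟨hk₀, hpk₀⟩⟩
  have hcS : ∀ p k, (p, k) ∈ S → W.valuation ((P p).coeff k) * W.valuation (c (p, k)) ^ (k - B p) =
      W.valuation (s p) := by
    intro p k hx
    have h1 := (hS p k).1 hx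
    rw [hc _ hx, ← map_mul, mul_div_cancel₀ _ h1.2]
  have h1 := (hS _ _).1 hx₁
  have hc0 : W.valuation (c (p₁, k₁)) ≠ 0 := by
    intro h0
    have h2 := hcS _ _ hx₁
    rw [h0, zero_pow (Nat.sub_ne_zero_of_lt h1.1), mul_zero] at h2
    exact hs0 p₁ (by simpa using h2.symm)
  have hγ : γ < W.valuation (c (p₁, k₁)) := by
    have h2 := h.above p₁ k₁ h1.1
    rw [← hs, ← hB, ← hcS _ _ hx₁] at h2
    exact lt_of_pow_lt_pow_left₀ _ zero_le (lt_of_mul_lt_mul_left' h2)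
  have hsv : ∀ p, W.valuation (s p) ≠ 0 := fun p => by simpa using hs0 p
  have hlt : ∀ p, ∀ k < B p, W.valuation ((P p).coeff k * c (p₁, k₁) ^ k) <
      W.valuation (s p * c (p₁, k₁) ^ B p) := by
    intro p k hk
    have h2 := h.below p k hk
    rw [← hs, ← hB] at h2
    have h3 : γ ^ (B p - k) < W.valuation (c (p₁, k₁)) ^ (B p - k) :=
      pow_lt_pow_left₀ hγ zero_le (Nat.sub_ne_zero_of_lt hk)
    have h4 : W.valuation (c (p₁, k₁)) ^ B p =
        W.valuation (c (p₁, k₁)) ^ (B p - k) * W.valuation (c (p₁, k₁)) ^ k := by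
      rw [← pow_add, Nat.sub_add_cancel hk.le]
    rw [map_mul, map_mul, map_pow, map_pow, h4, ← mul_assoc]
    exact mul_lt_mul_of_pos_right (h2.trans_lt
      (mul_lt_mul_of_pos_left h3 (zero_lt_iff.2 (hsv p)))) (zero_lt_iff.2 (pow_ne_zero _ hc0))
  have hpow : ∀ p k, B p < k → W.valuation ((P p).coeff k * c (p₁, k₁) ^ k) =
      W.valuation ((P p).coeff k) * W.valuation (c (p₁, k₁)) ^ (k - B p) *
        W.valuation (c (p₁, k₁)) ^ B p := by
    intro p k hk
    rw [map_mul, map_pow, mul_assoc, ← pow_add, Nat.sub_add_cancel hk.le]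
  refine ⟨c (p₁, k₁), by simpa using hc0, ?_, hlt, p₁, k₁, h1.1, ?_⟩
  · intro p k
    rcases lt_trichotomy k (B p) with hk | hk | hk
    · exact (hlt p k hk).le
    · subst hk
      rw [map_mul, map_mul]
      gcongr
      obtain ⟨_, _, x, y, hx, hy, -, -, -⟩ := h.nonsplit
      have hxW := W.valuation_le_one x
      have hyW := W.valuation_le_one y
      fin_cases p
      · exact le_rfl
      · change W.valuation ((P 1).coeff N) ≤ W.valuation ((P 0).coeff N)
        rw [hx, map_mul]; exact mul_le_of_le_one_left' hxW
      · exact le_rfl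
      · change W.valuation ((P 3).coeff M) ≤ W.valuation ((P 2).coeff M)
        rw [hy, map_mul]; exact mul_le_of_le_one_left' hyW
    · rw [hpow p k hk, map_mul, map_pow]
      gcongr
      by_cases h0 : (P p).coeff k = 0
      · simp [h0]
      · have hx := (hS p k).2 ⟨hk, h0⟩
        rw [← hcS p k hx]
        gcongr
        exact hmin _ hx
  · rw [hpow _ _ h1.1, hcS _ _ hx₁, map_mul, map_pow]

theorem NewtonVertex.next {W : ValuationSubring E} [CharZero (IsLocalRing.ResidueField W)]
    (hi : IsSquare (-1 : IsLocalRing.ResidueField W)) {D F : Fin 4 → ℕ}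
    {A : Fin 4 → Fin 4 → MvPolynomial (Fin 4) W} (hA : ReducesToSpecial D F A)
    (hroot : ∀ e : E, e ≠ 0 → ∀ n > 0, ∃ c : E, W.valuation c ^ n = W.valuation e)
    {P Z : Fin 4 → E[X]} (hZ0 : ∃ i, Z i ≠ 0)
    (hZ : ∑ i, ∑ j, (A i j).eval₂ (C.comp W.subtype) P * Z i * Z j = 0) {N M : ℕ}
    {γ : W.ValueGroup} (h : NewtonVertex W P N M γ)
    (hne : ∃ p, ∃ k > ![N, N, M, M] p, (P p).coeff k ≠ 0) :
    ∃ N' M' γ', N + M < N' + M' ∧ NewtonVertex W P N' M' γ' := by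
  obtain ⟨c, hc, hle, hlt, p₁, k₁, hk₁, heq⟩ := h.exists_slope hroot hne
  set s := ![(P 0).coeff N, (P 0).coeff N, (P 2).coeff M, (P 2).coeff M] with hs
  set B := ![N, N, M, M] with hB
  obtain ⟨ha0, hb0, x, y, hx, hy, hx0, hy0, hns⟩ := h.nonsplit
  have hs0 : ∀ p, s p ≠ 0 := by
    intro p; fin_cases p <;> assumption
  have hsc : ∀ p, s p * c ^ B p ≠ 0 := fun p => mul_ne_zero (hs0 p) (pow_ne_zero _ hc)
  have hlam : ∀ p, ![((P 0).coeff N * c ^ N)⁻¹, ((P 0).coeff N * c ^ N)⁻¹,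
      ((P 2).coeff M * c ^ M)⁻¹, ((P 2).coeff M * c ^ M)⁻¹] p = (s p * c ^ B p)⁻¹ := by
    intro p; fin_cases p <;> rfl
  have hval : ∀ p k, W.valuation ((s p * c ^ B p)⁻¹ * (P p).coeff k * c ^ k) =
      W.valuation ((P p).coeff k * c ^ k) / W.valuation (s p * c ^ B p) := by
    intro p k
    rw [mul_assoc, map_mul, map_inv₀, div_eq_inv_mul]
  have hpos : ∀ p, 0 < W.valuation (s p * c ^ B p) := fun p =>
    zero_lt_iff.2 (by simpa using hsc p)
  obtain ⟨q, hq, Zb, hZb0, hZb⟩ := hA.exists_reduction hZ0 hZ hc (hsc 0 |> inv_ne_zero)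
    (hsc 2 |> inv_ne_zero) (by
      intro p k
      rw [show ![(s 0 * c ^ B 0)⁻¹, (s 0 * c ^ B 0)⁻¹, (s 2 * c ^ B 2)⁻¹, (s 2 * c ^ B 2)⁻¹] p
        = (s p * c ^ B p)⁻¹ from hlam p, hval]
      exact div_le_one_of_le₀ (hle p k) zero_le)
  replace hq : ∀ p k, ((q p).coeff k : E) = (s p * c ^ B p)⁻¹ * (P p).coeff k * c ^ k := by
    intro p k
    rw [hq, show ![(s 0 * c ^ B 0)⁻¹, (s 0 * c ^ B 0)⁻¹, (s 2 * c ^ B 2)⁻¹, (s 2 * c ^ B 2)⁻¹] p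
        = (s p * c ^ B p)⁻¹ from hlam p]
  let Q : Fin 4 → (IsLocalRing.ResidueField W)[X] := fun p => (q p).map (IsLocalRing.residue W)
  have hQ : ∀ p k, (Q p).coeff k = IsLocalRing.residue W ((q p).coeff k) := fun p k => by
    simp [Q]
  have hQ0 : ∀ p k, (Q p).coeff k = 0 ↔
      W.valuation ((P p).coeff k * c ^ k) < W.valuation (s p * c ^ B p) := by
    intro p k
    rw [hQ, residue_eq_zero_iff_valuation, hq, hval, div_lt_one₀ (hpos p)]
  have hlow : ∀ p, ∀ k < B p, (Q p).coeff k = 0 := fun p k hk => (hQ0 p k).2 (hlt p k hk)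
  have hQ1 : ∀ p k (z : W), (P p).coeff k * c ^ k = z * (s p * c ^ B p) →
      (Q p).coeff k = IsLocalRing.residue W z := by
    intro p k z hz
    rw [hQ]
    congr 1
    apply Subtype.val_injective
    rw [hq, mul_assoc, hz, mul_comm, mul_assoc, mul_inv_cancel₀ (hsc p), mul_one]
  have e0 : (Q 0).coeff N = 1 := by
    rw [hQ1 0 N 1 (by simp [hs, hB]), map_one]
  have e2 : (Q 2).coeff M = 1 := by
    rw [hQ1 2 M 1 (by simp [hs, hB]), map_one]
  have e1 : (Q 1).coeff N = IsLocalRing.residue W x := by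
    rw [hQ1 1 N x (by rw [hx]; simp [hs, hB, mul_assoc])]
  have e3 : (Q 3).coeff M = IsLocalRing.residue W y := by
    rw [hQ1 3 M y (by rw [hy]; simp [hs, hB, mul_assoc])]
  let N' := max (Q 0).natDegree (Q 1).natDegree
  let M' := max (Q 2).natDegree (Q 3).natDegree
  have hmax : ∀ f g : (IsLocalRing.ResidueField W)[X], f ≠ 0 → g ≠ 0 →
      f.coeff (max f.natDegree g.natDegree) ≠ 0 ∨ g.coeff (max f.natDegree g.natDegree) ≠ 0 := by
    intro f g hf hg
    rcases le_total f.natDegree g.natDegree with h | h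
    · right; rw [max_eq_right h]; simpa using hg
    · left; rw [max_eq_left h]; simpa using hf
  have hQne : ∀ p, Q p ≠ 0 := by
    have h1 : ∀ p k, (Q p).coeff k ≠ 0 → Q p ≠ 0 := by
      intro p k hk h0; rw [h0] at hk; exact hk rfl
    intro p
    fin_cases p
    · exact h1 0 N (by rw [e0]; exact one_ne_zero)
    · exact h1 1 N (by rwa [e1])
    · exact h1 2 M (by rw [e2]; exact one_ne_zero)
    · exact h1 3 M (by rwa [e3])
  have hNN' : N ≤ N' := (le_natDegree_of_ne_zero (by rw [e0]; exact one_ne_zero)).trans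
    (le_max_left _ _)
  have hMM' : M ≤ M' := (le_natDegree_of_ne_zero (by rw [e2]; exact one_ne_zero)).trans
    (le_max_left _ _)
  obtain ⟨f0, f1, f2, f3, hns'⟩ := not_conicSplit_leading hi hA.degrees hZb0 hZb
    (n := N) (m := M) (hlow 0) (hlow 1) (hlow 2) (hlow 3)
    (by change (Q 0).coeff N ≠ 0; rw [e0]; exact one_ne_zero)
    (by change (Q 1).coeff N ≠ 0; rwa [e1])
    (by change (Q 2).coeff M ≠ 0; rw [e2]; exact one_ne_zero)
    (by change (Q 3).coeff M ≠ 0; rwa [e3])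
    (by
      change ¬ ConicSplit ((Q 0).coeff N * (Q 1).coeff N) ((Q 2).coeff M * (Q 3).coeff M)
      rw [e0, e1, e2, e3, one_mul, one_mul]; exact hns)
    (N := N') (M := M') (le_max_left _ _) (le_max_right _ _) (le_max_left _ _) (le_max_right _ _)
    (hmax _ _ (hQne 0) (hQne 1)) (hmax _ _ (hQne 2) (hQne 3))
  change (Q 0).coeff N' ≠ 0 at f0
  change (Q 1).coeff N' ≠ 0 at f1
  change (Q 2).coeff M' ≠ 0 at f2
  change (Q 3).coeff M' ≠ 0 at f3
  change ¬ ConicSplit ((Q 0).coeff N' * (Q 1).coeff N') ((Q 2).coeff M' * (Q 3).coeff M') at hns'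
  rw [conicSplit_mul_iff f0 f2] at hns'
  -- the valuation of the new pivots
  let s' : Fin 4 → E := ![(P 0).coeff N', (P 0).coeff N', (P 2).coeff M', (P 2).coeff M']
  let B' := ![N', N', M', M']
  have hpiv : ∀ p, W.valuation (s' p * c ^ B' p) = W.valuation (s p * c ^ B p) := by
    have h1 := le_antisymm (hle 0 N') (not_lt.1 (mt (hQ0 0 N').2 f0))
    have h2 := le_antisymm (hle 2 M') (not_lt.1 (mt (hQ0 2 M').2 f2))
    intro p
    fin_cases p
    · exact h1
    · exact h1
    · exact h2
    · exact h2
  have hcv : 0 < W.valuation c := zero_lt_iff.2 (by simpa using hc)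
  have hratio : ∀ p p' k, s p = s p' → B p = B p' → (Q p).coeff k ≠ 0 → ∃ z : W,
      (P p').coeff k = z * (P p).coeff k ∧
      IsLocalRing.residue W z = (Q p').coeff k / (Q p).coeff k := by
    intro p p' k h1 h2 hk
    obtain ⟨u, hu⟩ := (IsLocalRing.residue_ne_zero_iff_isUnit _).1 (by rwa [hQ] at hk)
    have hP : ((q p).coeff k : E) ≠ 0 := by
      intro h0
      apply hk
      rw [hQ, show (q p).coeff k = 0 from Subtype.val_injective h0, map_zero]
    refine ⟨(q p').coeff k * (u⁻¹ : Wˣ), ?_, ?_⟩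
    · have hu' : ((u⁻¹ : Wˣ) : W) * (q p).coeff k = 1 := by rw [← hu]; simp
      have h3 : (((u⁻¹ : Wˣ) : W) : E) * ((q p).coeff k : E) = 1 := by
        simpa using congrArg Subtype.val hu'
      have h4 : (((u⁻¹ : Wˣ) : W) : E) = ((q p).coeff k : E)⁻¹ := eq_inv_of_mul_eq_one_left h3
      rw [hq] at hP
      have h5 := hs0 p
      have h7 : (P p).coeff k ≠ 0 := by
        rintro h0; rw [h0] at hP; simp at hP
      change (P p').coeff k = ((q p').coeff k : E) * (((u⁻¹ : Wˣ) : W) : E) * (P p).coeff k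
      rw [h4, hq, hq, ← h1, ← h2]
      field_simp
    · rw [map_mul, hQ, hQ, div_eq_mul_inv]
      congr 1
      rw [← hu]
      exact eq_inv_of_mul_eq_one_left (by rw [← map_mul]; simp)
  obtain ⟨x', hx', hx'r⟩ := hratio 0 1 N' rfl rfl f0
  obtain ⟨y', hy', hy'r⟩ := hratio 2 3 M' rfl rfl f2
  have hPne : ∀ p k, (Q p).coeff k ≠ 0 → (P p).coeff k ≠ 0 := by
    intro p k hk h0
    apply hk
    rw [hQ0, h0, zero_mul, map_zero]
    exact hpos p
  refine ⟨N', M', W.valuation c, ?_, ⟨hPne 0 _ f0, hPne 2 _ f2, x', y', hx', hy', ?_, ?_, ?_⟩,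
    ?_, ?_⟩
  · have h1 : (Q p₁).coeff k₁ ≠ 0 := by
      rw [Ne, hQ0, heq]; exact lt_irrefl _
    have h2 := le_natDegree_of_ne_zero h1
    have h0 : (Q p₁).natDegree ≤ B' p₁ := by
      fin_cases p₁
      · exact le_max_left _ _
      · exact le_max_right _ _
      · exact le_max_left _ _
      · exact le_max_right _ _
    have h3 : B p₁ < B' p₁ := lt_of_lt_of_le hk₁ (h2.trans h0)
    fin_cases p₁ <;> simp [B, B'] at h3 <;> omega
  · rw [hx'r]; exact div_ne_zero f1 f0
  · rw [hy'r]; exact div_ne_zero f3 f2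
  · rw [hx'r, hy'r]; exact hns'
  · intro p k hk
    change k < B' p at hk
    change _ ≤ W.valuation (s' p) * W.valuation c ^ (B' p - k)
    have h1 := hle p k
    rw [← hpiv p, map_mul, map_mul, map_pow, map_pow, ← Nat.sub_add_cancel hk.le, pow_add,
      ← mul_assoc] at h1
    exact le_of_mul_le_mul_right h1 (pow_pos hcv k)
  · intro p k hk
    change B' p < k at hk
    change _ * W.valuation c ^ (k - B' p) < W.valuation (s' p)
    have h0 : (Q p).coeff k = 0 := by
      apply coeff_eq_zero_of_natDegree_lt
      refine lt_of_le_of_lt ?_ hk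
      fin_cases p
      · exact le_max_left _ _
      · exact le_max_right _ _
      · exact le_max_left _ _
      · exact le_max_right _ _
    have h1 := (hQ0 p k).1 h0
    rw [← hpiv p, map_mul, map_mul, map_pow, map_pow, ← Nat.sub_add_cancel hk.le, pow_add,
      ← mul_assoc] at h1
    rw [Nat.sub_add_cancel hk.le] at h1
    exact lt_of_mul_lt_mul_right h1 zero_le

/-- Along a rational curve in the quadric bundle, nonsplit ratios at the origin propagate to
nonsplit ratios at infinity. -/
theorem NonsplitRatios.exists_leading {W : ValuationSubring E}
    [CharZero (IsLocalRing.ResidueField W)]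
    (hi : IsSquare (-1 : IsLocalRing.ResidueField W)) {D F : Fin 4 → ℕ}
    {A : Fin 4 → Fin 4 → MvPolynomial (Fin 4) W} (hA : ReducesToSpecial D F A)
    (hroot : ∀ e : E, e ≠ 0 → ∀ n > 0, ∃ c : E, W.valuation c ^ n = W.valuation e)
    {P Z : Fin 4 → E[X]} (hZ0 : ∃ i, Z i ≠ 0)
    (hZ : ∑ i, ∑ j, (A i j).eval₂ (C.comp W.subtype) P * Z i * Z j = 0)
    (h : NonsplitRatios W ((P 0).coeff 0) ((P 1).coeff 0) ((P 2).coeff 0) ((P 3).coeff 0)) :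
    ∃ N M, (P 0).natDegree ≤ N ∧ (P 1).natDegree ≤ N ∧ (P 2).natDegree ≤ M ∧
      (P 3).natDegree ≤ M ∧
      NonsplitRatios W ((P 0).coeff N) ((P 1).coeff N) ((P 2).coeff M) ((P 3).coeff M) := by
  have key : ∀ (n N M : ℕ) (γ : W.ValueGroup), NewtonVertex W P N M γ →
      (P 0).natDegree + (P 2).natDegree ≤ N + M + n →
      ∃ N M γ, NewtonVertex W P N M γ ∧ ¬ ∃ p, ∃ k > ![N, N, M, M] p, (P p).coeff k ≠ 0 := by
    intro n
    induction n using Nat.strong_induction_on with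
    | _ n ih =>
      intro N M γ hv hn
      by_cases hne : ∃ p, ∃ k > ![N, N, M, M] p, (P p).coeff k ≠ 0
      · obtain ⟨N', M', γ', hlt, hv'⟩ := hv.next hi hA hroot hZ0 hZ hne
        have h1 := le_natDegree_of_ne_zero hv'.nonsplit.1
        have h2 := le_natDegree_of_ne_zero hv'.nonsplit.2.1
        exact ih (n - (N' + M' - (N + M))) (by omega) N' M' γ' hv' (by omega)
      · exact ⟨N, M, γ, hv, hne⟩
  obtain ⟨N, M, γ, hv, hne⟩ := key ((P 0).natDegree + (P 2).natDegree) 0 0 0 ⟨h, by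
    intro p k hk; fin_cases p <;> simp at hk, by
    intro p k hk
    have hB : ![0, 0, 0, 0] p = 0 := by fin_cases p <;> rfl
    rw [hB] at hk ⊢
    rw [Nat.sub_zero, zero_pow (Nat.pos_iff_ne_zero.1 hk), mul_zero]
    have h1 := h.1
    have h2 := h.2.1
    rw [zero_lt_iff]
    fin_cases p <;> simpa using by assumption⟩ (by omega)
  have hdeg : ∀ p, (P p).natDegree ≤ ![N, N, M, M] p := by
    intro p
    rw [natDegree_le_iff_coeff_eq_zero]
    intro k hk
    by_contra h0
    exact hne ⟨p, k, hk, h0⟩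
  exact ⟨N, M, hdeg 0, hdeg 1, hdeg 2, hdeg 3, hv.nonsplit⟩

end Traversal

section CasselsPfister

open Polynomial

variable {M : Type} [Field M]

/-- The diagonal quadratic form with coefficients `b` has no nontrivial zero. -/
def AnisotropicDiag {n : ℕ} (b : Fin n → M) : Prop :=
  ∀ c : Fin n → M, ∑ i, b i * c i ^ 2 = 0 → c = 0

theorem coeff_sum_mul_sq {n : ℕ} (b : Fin n → M) {p : Fin n → M[X]} {N : ℕ}
    (hp : ∀ i, (p i).natDegree ≤ N) :
    (∑ i, C (b i) * p i ^ 2).coeff (2 * N) = ∑ i, b i * (p i).coeff N ^ 2 := by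
  rw [finsetSum_coeff]
  refine Finset.sum_congr rfl fun i _ => ?_
  rw [coeff_C_mul, coeff_pow_of_natDegree_le (hp i)]

theorem AnisotropicDiag.natDegree_le {n : ℕ} {b : Fin n → M} (hb : AnisotropicDiag b)
    {p : Fin n → M[X]} {N : ℕ} (h : (∑ i, C (b i) * p i ^ 2).natDegree ≤ 2 * N) (i : Fin n) :
    (p i).natDegree ≤ N := by
  by_contra! hi
  have hle : ∀ i, (p i).natDegree ≤ Finset.univ.sup (fun i => (p i).natDegree) := fun i =>
    Finset.le_sup (f := fun i => (p i).natDegree) (Finset.mem_univ i)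
  have h1 := coeff_sum_mul_sq b hle
  rw [coeff_eq_zero_of_natDegree_lt (lt_of_le_of_lt h (by have := hle i; omega))] at h1
  have h2 := hb _ h1.symm
  obtain ⟨j, -, hj⟩ := Finset.exists_mem_eq_sup Finset.univ ⟨i, Finset.mem_univ i⟩
    (fun i => (p i).natDegree)
  have h3 := congrFun h2 j
  simp only [hj, coeff_natDegree, Pi.zero_apply, leadingCoeff_eq_zero] at h3
  have h4 := hle i
  rw [hj, h3, natDegree_zero] at h4
  omega

theorem AnisotropicDiag.polynomial {n : ℕ} {b : Fin n → M} (hb : AnisotropicDiag b)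
    {p : Fin n → M[X]} (h : ∑ i, C (b i) * p i ^ 2 = 0) : p = 0 := by
  have h0 := fun i => hb.natDegree_le (N := 0) (by rw [h]; simp) i
  have h1 := coeff_sum_mul_sq b h0
  rw [h, coeff_zero] at h1
  have h2 := hb _ h1.symm
  funext i
  rw [eq_C_of_natDegree_le_zero (h0 i), congrFun h2 i]
  simp

variable {L : Type} [Field L] [Algebra M[X] L] [IsFractionRing M[X] L]

theorem exists_common_denominator {n : ℕ} (v : Fin n → L) :
    ∃ (d : M[X]) (p : Fin n → M[X]), d ≠ 0 ∧ ∀ i, v i * algebraMap M[X] L d =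
      algebraMap M[X] L (p i) := by
  obtain ⟨d, hd⟩ := IsLocalization.exist_integer_multiples_of_finite (nonZeroDivisors M[X]) v
  choose p hp using hd
  refine ⟨d, p, nonZeroDivisors.coe_ne_zero d, fun i => ?_⟩
  rw [hp i, Algebra.smul_def, mul_comm]

theorem AnisotropicDiag.fractionRing {n : ℕ} {b : Fin n → M} (hb : AnisotropicDiag b) :
    AnisotropicDiag fun i => algebraMap M[X] L (C (b i)) := by
  intro v hv
  obtain ⟨d, p, hd, hp⟩ := exists_common_denominator (M := M) v
  have hinj := IsFractionRing.injective M[X] L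
  have hd' : algebraMap M[X] L d ≠ 0 := by simpa using hd
  have h1 : p = 0 := hb.polynomial (by
    apply hinj
    rw [map_sum, map_zero]
    have : ∑ i, algebraMap M[X] L (C (b i)) * v i ^ 2 * (algebraMap M[X] L d) ^ 2 = 0 := by
      rw [← Finset.sum_mul, hv, zero_mul]
    rw [← this]
    refine Finset.sum_congr rfl fun i _ => ?_
    rw [map_mul, map_pow, ← hp i]
    ring)
  funext i
  have h2 := hp i
  rw [h1, Pi.zero_apply, map_zero] at h2
  simpa [hd'] using h2

/-- The Cassels–Pfister theorem for diagonal forms. -/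
theorem AnisotropicDiag.cassels_pfister {n : ℕ} {b : Fin n → M} (hb : AnisotropicDiag b)
    {g : M[X]} {v : Fin n → L}
    (h : ∑ i, algebraMap M[X] L (C (b i)) * v i ^ 2 = algebraMap M[X] L g) :
    ∃ w : Fin n → M[X], ∑ i, C (b i) * w i ^ 2 = g := by
  have key : ∀ (k : ℕ) (d : M[X]) (v : Fin n → M[X]), d ≠ 0 → d.natDegree ≤ k →
      ∑ i, C (b i) * v i ^ 2 = g * d ^ 2 → ∃ w : Fin n → M[X], ∑ i, C (b i) * w i ^ 2 = g := by
    intro k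
    induction k with
    | zero =>
      intro d v hd hk hv
      rw [eq_C_of_natDegree_le_zero hk] at hv hd
      set a := d.coeff 0
      have ha : a ≠ 0 := by rintro h; simp [h] at hd
      refine ⟨fun i => C a⁻¹ * v i, ?_⟩
      have h1 : ∑ i, C (b i) * (C a⁻¹ * v i) ^ 2 = C a⁻¹ ^ 2 * ∑ i, C (b i) * v i ^ 2 := by
        rw [Finset.mul_sum]
        exact Finset.sum_congr rfl fun i _ => by ring
      have h2 : C a⁻¹ * C a = 1 := by rw [← C_mul, inv_mul_cancel₀ ha, C_1]
      rw [h1, hv]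
      linear_combination g * (C a⁻¹ * C a + 1) * h2
    | succ k ih =>
      intro d v hd hk hv
      by_cases hk' : d.natDegree ≤ k
      · exact ih d v hd hk' hv
      let u : Fin n → M[X] := fun i => v i / d
      let r : Fin n → M[X] := fun i => v i % d
      have hr : ∀ i, v i = d * u i + r i := fun i => (EuclideanDomain.div_add_mod (v i) d).symm
      have hrd : ∀ i, (r i).natDegree ≤ k := fun i => by
        have := natDegree_mod_lt (v i) (q := d) (by omega)
        simp only [r]; omega
      let Q : (Fin n → M[X]) → M[X] := fun p => ∑ i, C (b i) * p i ^ 2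
      let B : M[X] := ∑ i, C (b i) * (v i * u i)
      have hQv : Q v = g * d ^ 2 := hv
      have hQr : Q r = Q v - 2 * d * B + d ^ 2 * Q u := by
        simp only [Q, B, Finset.mul_sum]
        rw [← Finset.sum_sub_distrib, ← Finset.sum_add_distrib]
        refine Finset.sum_congr rfl fun i _ => ?_
        have : r i = v i - d * u i := by rw [hr i]; ring
        rw [this]; ring
      by_cases hr0 : r = 0
      · refine ⟨u, ?_⟩
        have h1 : v = fun i => d * u i := funext fun i => by rw [hr i, hr0]; simp
        have h2 : Q v = d ^ 2 * Q u := by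
          simp only [Q, Finset.mul_sum]
          exact Finset.sum_congr rfl fun i _ => by rw [h1]; ring
        have h3 : d ^ 2 * (Q u - g) = 0 := by rw [mul_sub, ← h2, hQv]; ring
        exact sub_eq_zero.1 (by simpa [hd] using h3)
      · let a := Q u - g
        let b' := 2 * (g * d - B)
        let v' : Fin n → M[X] := fun i => a * v i + b' * u i
        let d' := a * d + b'
        have h1 : Q v' = a ^ 2 * Q v + 2 * a * b' * B + b' ^ 2 * Q u := by
          simp only [Q, v', B, Finset.mul_sum]
          rw [← Finset.sum_add_distrib, ← Finset.sum_add_distrib]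
          exact Finset.sum_congr rfl fun i _ => by ring
        have h2 : Q v' = g * d' ^ 2 := by
          rw [h1, hQv]; simp only [d', b', a]; ring
        have h3 : d * d' = Q r := by
          rw [hQr, hQv]; simp only [d', b', a]; ring
        have h4 : Q r ≠ 0 := fun h0 => hr0 (hb.polynomial h0)
        have hd' : d' ≠ 0 := by rintro h0; rw [h0, mul_zero] at h3; exact h4 h3.symm
        have h5 : (Q r).natDegree ≤ 2 * k := by
          refine natDegree_sum_le_of_forall_le _ _ fun i _ => ?_
          refine (natDegree_C_mul_le _ _).trans ((natDegree_pow_le).trans ?_)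
          have := hrd i
          omega
        rw [← h3, natDegree_mul hd hd'] at h5
        exact ih d' v' hd' (by omega) h2
  obtain ⟨d, p, hd, hp⟩ := exists_common_denominator (M := M) v
  refine key _ d p hd le_rfl (IsFractionRing.injective M[X] L ?_)
  rw [map_sum, map_mul, ← h, Finset.sum_mul]
  refine Finset.sum_congr rfl fun i _ => ?_
  rw [map_mul, map_pow, ← hp i, map_pow]
  ring

/-- A representation of a constant over `M(X)` descends to `M`. -/
theorem AnisotropicDiag.exists_of_fractionRing {n : ℕ} {b : Fin n → M} (hb : AnisotropicDiag b)
    {a : M} {v : Fin n → L}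
    (h : ∑ i, algebraMap M[X] L (C (b i)) * v i ^ 2 = algebraMap M[X] L (C a)) :
    ∃ w : Fin n → M, ∑ i, b i * w i ^ 2 = a := by
  obtain ⟨w, hw⟩ := hb.cassels_pfister h
  refine ⟨fun i => (w i).eval 0, ?_⟩
  simpa [eval_finsetSum] using congrArg (eval 0) hw

/-- A generic value of `⟨b 0⟩ ⊥ ⟨a⟩` represented by `⟨b 0, b 1, …⟩` forces `a` to be represented
by `⟨b 1, …⟩`. -/
theorem AnisotropicDiag.cancel [CharZero M] {n : ℕ} {b : Fin (n + 1) → M}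
    (hb : AnisotropicDiag b) {a : M} {v : Fin (n + 1) → L}
    (h : ∑ i, algebraMap M[X] L (C (b i)) * v i ^ 2 =
      algebraMap M[X] L (C (b 0) * X ^ 2 + C a)) :
    ∃ w : Fin n → M, ∑ i, b i.succ * w i ^ 2 = a := by
  obtain ⟨w, hw⟩ := hb.cassels_pfister h
  have h0 : (w 0).natDegree ≤ 1 := hb.natDegree_le (by
    rw [hw]; compute_degree) 0
  obtain ⟨α, β, hαβ⟩ := exists_eq_X_add_C_of_natDegree_le_one h0
  have h1 : ∃ ξ : M, (w 0).eval ξ ^ 2 = ξ ^ 2 := by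
    rw [hαβ]
    by_cases hα : α = 1
    · refine ⟨-β / 2, ?_⟩
      subst hα
      simp only [C_1, one_mul, eval_add, eval_X, eval_C]
      field_simp; ring
    · have : 1 - α ≠ 0 := sub_ne_zero.2 (Ne.symm hα)
      refine ⟨β / (1 - α), ?_⟩
      simp only [eval_add, eval_mul, eval_X, eval_C]
      field_simp; ring
  obtain ⟨ξ, hξ⟩ := h1
  refine ⟨fun i => (w i.succ).eval ξ, ?_⟩
  have h2 := congrArg (eval ξ) hw
  simp only [eval_finsetSum, eval_mul, eval_C, eval_pow, eval_add, eval_X, Fin.sum_univ_succ,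
    hξ] at h2
  exact add_left_cancel h2

end CasselsPfister

section GenericQuadric

open Polynomial

variable {M L : Type} [Field M] [Field L] [Algebra M[X] L] [IsFractionRing M[X] L]

variable (M L) in
/-- The inclusion of constants into the rational function field. -/
noncomputable def constHom : M →+* L := (algebraMap M[X] L).comp C

theorem AnisotropicDiag.not_represents_X {n : ℕ} {b : Fin n → M} (hb : AnisotropicDiag b)
    (v : Fin n → L) : ∑ i, constHom M L (b i) * v i ^ 2 ≠ algebraMap M[X] L X := by
  intro h
  obtain ⟨w, hw⟩ := hb.cassels_pfister h
  have h1 : ∀ i, (w i).natDegree ≤ 1 := hb.natDegree_le (by rw [hw]; simp)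
  have h2 := coeff_sum_mul_sq b h1
  rw [hw, coeff_X_of_ne_one (by norm_num)] at h2
  have h3 := hb _ h2.symm
  have h4 : ∀ i, w i = C ((w i).coeff 0) := fun i => by
    refine eq_C_of_natDegree_le_zero (natDegree_le_iff_coeff_eq_zero.2 fun k hk => ?_)
    rcases (Nat.succ_le_of_lt hk).eq_or_lt with rfl | hk
    · exact congrFun h3 i
    · exact coeff_eq_zero_of_natDegree_lt (lt_of_le_of_lt (h1 i) hk)
  have h5 := congrArg (fun p => coeff p 1) hw
  rw [coeff_X_one] at h5
  simp only [finsetSum_coeff, coeff_C_mul] at h5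
  rw [Finset.sum_eq_zero] at h5
  · exact zero_ne_one h5
  · intro i _
    rw [h4 i, ← C_pow, coeff_C_of_ne_zero one_ne_zero, mul_zero]

theorem anisotropicDiag_one : AnisotropicDiag (![1] : Fin 1 → M) := by
  intro c hc
  funext i
  fin_cases i
  simpa using hc

theorem not_isSquare_X : ¬ IsSquare (algebraMap M[X] L X) := by
  rintro ⟨s, hs⟩
  refine (anisotropicDiag_one (M := M)).not_represents_X (L := L) ![s] ?_
  simp [hs, sq]

theorem anisotropicDiag_pair {x : M} (hx : ¬ IsSquare x) : AnisotropicDiag ![-x, 1] := by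
  intro c hc
  simp only [Fin.sum_univ_two, Matrix.cons_val_zero, Matrix.cons_val_one, one_mul] at hc
  have h0 : c 0 = 0 := by
    by_contra h0
    exact hx ⟨c 1 / c 0, by field_simp; linear_combination -hc⟩
  have h1 : c 1 = 0 := by simpa [h0] using hc
  funext i
  fin_cases i
  · exact h0
  · exact h1

theorem not_conicSplit_X {x : M} (hx : ¬ IsSquare x) :
    ¬ ConicSplit (constHom M L x) (algebraMap M[X] L X) := by
  rintro ⟨u, v, w, h0, h⟩
  by_cases hv : v = 0
  · have h1 := (anisotropicDiag_pair hx).fractionRing (L := L) ![u, w] (by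
      subst hv
      simp only [Fin.sum_univ_two, Matrix.cons_val_zero, Matrix.cons_val_one, map_one, one_mul,
        map_neg]
      rw [← h]
      simp only [constHom, RingHom.comp_apply]
      ring)
    have h2 := congrFun h1 0
    have h3 := congrFun h1 1
    simp at h2 h3
    tauto
  · refine (anisotropicDiag_pair hx).not_represents_X (L := L) ![u / v, w / v] ?_
    simp only [Fin.sum_univ_two, Matrix.cons_val_zero, Matrix.cons_val_one, map_one, one_mul,
      map_neg]
    field_simp
    linear_combination -h

theorem anisotropicDiag_of_not_conicSplit {x y : M} (h : ¬ ConicSplit x y) :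
    AnisotropicDiag ![x, y, -1] := by
  intro c hc
  by_contra h0
  refine h ⟨c 0, c 1, c 2, ?_, ?_⟩
  · by_contra! h1
    exact h0 (funext fun i => by fin_cases i <;> simp [h1])
  · simp only [Fin.sum_univ_three, Matrix.cons_val] at hc
    linear_combination hc

theorem anisotropicDiag_pure {x y : M} (hi : IsSquare (-1 : M)) (h : ¬ ConicSplit x y) :
    AnisotropicDiag ![x, y, x * y] := by
  obtain ⟨i, hi⟩ := hi
  have hx : x ≠ 0 := by
    rintro rfl
    exact h (ConicSplit.of_isSquare_left _ (by simp))
  have hy : y ≠ 0 := by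
    rintro rfl
    exact h (ConicSplit.of_isSquare_right _ (by simp))
  intro c hc
  simp only [Fin.sum_univ_three, Matrix.cons_val] at hc
  have := anisotropicDiag_of_not_conicSplit h ![y * c 1, x * c 0, i * x * y * c 2] (by
    simp only [Fin.sum_univ_three, Matrix.cons_val]
    linear_combination x * y * hc + x ^ 2 * y ^ 2 * c 2 ^ 2 * hi)
  have h0 := congrFun this 0
  have h1 := congrFun this 1
  have h2 := congrFun this 2
  have hi0 : i ≠ 0 := by rintro rfl; simp at hi
  simp [hx, hy, hi0] at h0 h1 h2
  funext j
  fin_cases j <;> simp [h0, h1, h2]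

theorem not_conicSplit_constHom {x y : M} (h : ¬ ConicSplit x y) :
    ¬ ConicSplit (constHom M L x) (constHom M L y) := by
  rintro ⟨u, v, w, h0, h1⟩
  have := (anisotropicDiag_of_not_conicSplit h).fractionRing (L := L) ![u, v, w] (by
    simp only [Fin.sum_univ_three, Matrix.cons_val, map_neg, map_one]
    simp only [constHom, RingHom.comp_apply] at h1
    linear_combination h1)
  have e0 := congrFun this 0
  have e1 := congrFun this 1
  have e2 := congrFun this 2
  simp at e0 e1 e2
  tauto

/-- The discriminant-type polynomial `(x + 1)² (y + 1)² + x y` is not a square. -/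
theorem not_isSquare_special [CharZero M] {x : M} (hx : x * (4 * (x + 1) ^ 2 + x) ≠ 0) :
    ¬ IsSquare (((constHom M L x) + 1) ^ 2 * (algebraMap M[X] L X + 1) ^ 2 +
      constHom M L x * algebraMap M[X] L X) := by
  rintro ⟨s, hs⟩
  have h1 : ∑ i, algebraMap M[X] L (C ((![1] : Fin 1 → M) i)) * (![s] : Fin 1 → L) i ^ 2 =
      algebraMap M[X] L (C (x + 1) ^ 2 * (X + 1) ^ 2 + C x * X) := by
    simp [← sq] at hs ⊢
    rw [← hs]
    simp [constHom]
  obtain ⟨w, hw⟩ := (anisotropicDiag_one (M := M)).cassels_pfister h1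
  have h0 : (w 0).natDegree ≤ 1 := (anisotropicDiag_one (M := M)).natDegree_le (by
    rw [hw]
    have : C (x + 1) ^ 2 * (X + 1) ^ 2 + C x * X =
      C ((x + 1) ^ 2) * X ^ 2 + C (2 * (x + 1) ^ 2 + x) * X + C ((x + 1) ^ 2) := by
      simp only [C_add, C_mul, C_pow, C_1, map_ofNat]; ring
    rw [this]
    compute_degree) 0
  obtain ⟨α, β, hαβ⟩ := exists_eq_X_add_C_of_natDegree_le_one h0
  simp only [Fin.sum_univ_one, Matrix.cons_val_zero, C_1, one_mul, hαβ] at hw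
  have e0 := congrArg (eval 0) hw
  have e1 := congrArg (eval 1) hw
  have e2 := congrArg (eval (-1)) hw
  simp at e0 e1 e2
  have f1 : α ^ 2 = (x + 1) ^ 2 := by
    linear_combination (e1 + e2) / 2 - e0
  have f2 : 2 * (α * β) = 2 * (x + 1) ^ 2 + x := by
    linear_combination (e1 - e2) / 2
  apply hx
  linear_combination (-(2 * (α * β)) - (2 * (x + 1) ^ 2 + x)) * f2 + 4 * β ^ 2 * f1 +
    4 * (x + 1) ^ 2 * e0

variable {L' : Type} [Field L'] [Algebra L[X] L'] [IsFractionRing L[X] L']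

variable (M L L') in
/-- A generic value of the ternary form `⟨x, y, xyF⟩`. -/
noncomputable def genericValue (x y F : M) : L' :=
  constHom L L' (constHom M L x) * algebraMap L[X] L' X ^ 2 +
    (constHom L L' (constHom M L y) * constHom L L' (algebraMap M[X] L X) ^ 2 +
      constHom L L' (constHom M L (x * y * F)))

theorem genericValue_not_represented [CharZero M] [CharZero L] (hi : IsSquare (-1 : M)) {x y F : M}
    (h : ¬ ConicSplit x y) (hF : ¬ IsSquare F) (c₀ c₁ c₂ : L') :
    constHom L L' (constHom M L x) * c₀ ^ 2 + constHom L L' (constHom M L y) * c₁ ^ 2 +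
      constHom L L' (constHom M L (x * y)) * c₂ ^ 2 ≠ genericValue M L L' x y F := by
  intro hc
  have hx : x ≠ 0 := by
    rintro rfl
    exact h (ConicSplit.of_isSquare_left _ (by simp))
  have hy : y ≠ 0 := by
    rintro rfl
    exact h (ConicSplit.of_isSquare_right _ (by simp))
  have ha : AnisotropicDiag ![y, x * y] := by
    intro c hc
    have := anisotropicDiag_pure hi h ![0, c 0, c 1] (by
      simpa [Fin.sum_univ_three, Fin.sum_univ_two] using hc)
    have e0 := congrFun this 1
    have e1 := congrFun this 2
    simp at e0 e1
    funext j
    fin_cases j <;> simp [e0, e1]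
  have hiL : IsSquare (-1 : L) := by
    simpa using hi.map (constHom M L)
  have hL := anisotropicDiag_pure hiL (not_conicSplit_constHom (L := L) h)
  obtain ⟨w, hw⟩ := hL.cancel (L := L') (v := ![c₀, c₁, c₂])
    (a := constHom M L y * (algebraMap M[X] L X) ^ 2 + constHom M L (x * y * F)) (by
      rw [Fin.sum_univ_three]
      simp only [Matrix.cons_val, genericValue] at hc ⊢
      simp only [constHom, RingHom.comp_apply, map_mul, map_add, map_pow] at hc ⊢
      linear_combination hc)
  obtain ⟨z, hz⟩ := ha.cancel (L := L) (v := w) (a := x * y * F) (by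
      rw [Fin.sum_univ_two] at hw ⊢
      simp only [Matrix.cons_val, Fin.succ_zero_eq_one, Fin.succ_one_eq_two] at hw ⊢
      simp only [constHom, RingHom.comp_apply, map_mul, map_add, map_pow] at hw ⊢
      linear_combination hw)
  simp at hz
  rcases hz with hz | hz | hz
  · exact hF ⟨z 0, by rw [← hz, sq]⟩
  · exact hx hz
  · exact hy hz

theorem neg_genericValue_not_isSquare (hi : IsSquare (-1 : M)) {x y F : M}
    (h : ¬ ConicSplit x y) (r : L') : r ^ 2 ≠ -genericValue M L L' x y F := by
  intro hr
  obtain ⟨i, hi⟩ := hi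
  have hi' := congrArg (fun z => constHom L L' (constHom M L z)) hi
  simp only [map_neg, map_one, map_mul] at hi'
  obtain ⟨w, hw⟩ := (anisotropicDiag_one (M := L)).cassels_pfister (L := L')
    (v := ![constHom L L' (constHom M L i) * r])
    (g := C (constHom M L x) * X ^ 2 + C (constHom M L y * (algebraMap M[X] L X) ^ 2 +
      constHom M L (x * y * F))) (by
      simp only [Fin.sum_univ_one, Matrix.cons_val, genericValue, map_one, one_mul] at hr ⊢
      simp only [constHom, RingHom.comp_apply, map_mul, map_add, map_pow] at hr hi' ⊢
      linear_combination -hr - r ^ 2 * hi')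
  have h0 : ∀ i, (w i).natDegree ≤ 1 := (anisotropicDiag_one (M := L)).natDegree_le (by
    rw [hw]; compute_degree)
  have h1 := coeff_sum_mul_sq ![(1 : L)] h0
  rw [hw] at h1
  simp only [coeff_add, coeff_C_mul, coeff_X_pow, Fin.sum_univ_one, Matrix.cons_val, mul_one,
    if_true, one_mul] at h1
  rw [coeff_C_of_ne_zero (by norm_num), add_zero] at h1
  exact not_conicSplit_constHom (L := L) h (ConicSplit.of_isSquare_left _ ⟨_, by rw [h1, sq]⟩)

instance neg_genericValue_fact {x y F : M} [hi : Fact (IsSquare (-1 : M))]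
    [h : Fact (¬ ConicSplit x y)] :
    Fact (∀ r : L', r ^ 2 ≠ -genericValue M L L' x y F + 0 * r) :=
  ⟨fun r => by rw [zero_mul, add_zero]; exact neg_genericValue_not_isSquare hi.1 h.1 r⟩

/-- The conic `(x, y)` remains nonsplit over the function field of the special quadric. -/
theorem not_conicSplit_quadric [CharZero M] [CharZero L] [CharZero L']
    [hi : Fact (IsSquare (-1 : M))] {x y F : M}
    [h : Fact (¬ ConicSplit x y)] (hF : ¬ IsSquare F) :
    ¬ ConicSplit (algebraMap L' (QuadraticAlgebra L' (-genericValue M L L' x y F) 0)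
        (constHom L L' (constHom M L x)))
      (algebraMap L' (QuadraticAlgebra L' (-genericValue M L L' x y F) 0)
        (constHom L L' (constHom M L y))) := by
  rintro ⟨u, v, w, h0, heq⟩
  have hnot := genericValue_not_represented (M := M) (L := L) (L' := L') hi.1 h.1 hF
  obtain ⟨i, hii⟩ := hi.1
  have hi' := congrArg (fun z => constHom L L' (constHom M L z)) hii
  simp only [map_neg, map_one, map_mul] at hi'
  have hns := not_conicSplit_constHom (L := L') (not_conicSplit_constHom (L := L) h.1)
  simp only [map_mul] at hnot
  set j := constHom L L' (constHom M L i)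
  set X := constHom L L' (constHom M L x)
  set Y := constHom L L' (constHom M L y)
  have hre := congrArg QuadraticAlgebra.re heq
  have him := congrArg QuadraticAlgebra.im heq
  simp [sq] at hre him
  have key : ∀ a b c : L', X * a ^ 2 + Y * b ^ 2 = c ^ 2 → a = 0 ∧ b = 0 ∧ c = 0 := by
    intro a b c habc
    by_contra hne
    exact hns ⟨a, b, c, by tauto, habc⟩
  have hRp : X * u.re ^ 2 + Y * v.re ^ 2 - w.re ^ 2 =
      genericValue M L L' x y F * (X * u.im ^ 2 + Y * v.im ^ 2 - w.im ^ 2) := by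
    linear_combination hre
  by_cases hR : X * u.im ^ 2 + Y * v.im ^ 2 - w.im ^ 2 = 0
  · obtain ⟨h1, h2, h3⟩ := key _ _ _ (sub_eq_zero.1 hR)
    rw [hR, mul_zero] at hRp
    obtain ⟨h4, h5, h6⟩ := key _ _ _ (sub_eq_zero.1 hRp)
    rcases h0 with h0 | h0 | h0
    · exact h0 (QuadraticAlgebra.ext h4 h1)
    · exact h0 (QuadraticAlgebra.ext h5 h2)
    · exact h0 (QuadraticAlgebra.ext h6 h3)
  · set R := X * u.im ^ 2 + Y * v.im ^ 2 - w.im ^ 2 with hRdef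
    have hB : X * u.re * u.im + Y * v.re * v.im - w.re * w.im = 0 := by
      have h2 : (2 : L') ≠ 0 := two_ne_zero
      apply mul_left_cancel₀ h2
      linear_combination him
    refine hnot (j * (u.re * w.im - w.re * u.im) / R) (j * (v.re * w.im - w.re * v.im) / R)
      ((u.re * v.im - v.re * u.im) / R) ?_
    field_simp
    linear_combination R * hRp - (X * u.re * u.im + Y * v.re * v.im - w.re * w.im) * hB
      - (X * (u.re * w.im - w.re * u.im) ^ 2 + Y * (v.re * w.im - w.re * v.im) ^ 2) * hi'

end GenericQuadric

section SpecialModel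

open Polynomial

/-- Adjoining one more indeterminate to an embedding of a polynomial ring in a field. -/
noncomputable def adjoinHom {κ σ M : Type} [Field κ] [Field M] (f : MvPolynomial σ κ →+* M)
    (L : Type) [Field L] [Algebra M[X] L] : MvPolynomial (Option σ) κ →+* L :=
  (algebraMap M[X] L).comp
    ((Polynomial.mapRingHom f).comp (MvPolynomial.optionEquivLeft κ σ).toRingEquiv.toRingHom)

section

variable {κ σ M L : Type} [Field κ] [Field M] [Field L] [Algebra M[X] L] [IsFractionRing M[X] L]
  {f : MvPolynomial σ κ →+* M}

theorem adjoinHom_injective (hf : Function.Injective f) :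
    Function.Injective (adjoinHom f L) :=
  (IsFractionRing.injective M[X] L).comp
    ((Polynomial.map_injective f hf).comp (MvPolynomial.optionEquivLeft κ σ).injective)

omit [IsFractionRing M[X] L] in
theorem adjoinHom_X_none : adjoinHom f L (MvPolynomial.X none) = algebraMap M[X] L X := by
  simp [adjoinHom]

omit [IsFractionRing M[X] L] in
theorem adjoinHom_X_some (i : σ) :
    adjoinHom f L (MvPolynomial.X (some i)) = constHom M L (f (MvPolynomial.X i)) := by
  simp [adjoinHom, constHom]

end

/-- The inclusion of variables in the iterated extension used by the special model. -/
def specialVariable (m : ℕ) : Fin m ⊕ Fin 4 → Option (Option (Option (Option (Fin m)))) :=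
  Sum.elim (fun i => some (some (some (some i))))
    ![some (some (some none)), some (some none), none, some none]

theorem specialVariable_injective (m : ℕ) : Function.Injective (specialVariable m) := by
  rintro (i | i) (j | j) h
  · simpa [specialVariable] using h
  · fin_cases j <;> simp [specialVariable] at h
  · fin_cases i <;> simp [specialVariable] at h
  · fin_cases i <;> fin_cases j <;> simp [specialVariable] at h ⊢

/-- The function field of a special quadric surface bundle, with `m` extra indeterminates:
the conic `(x, y)` is nonsplit over it. -/
theorem exists_specialModel_of_tower {κ k M₁ M₂ M₃ M₄ : Type} [Field κ] [CharZero κ] [Field k]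
    [Field M₁] [Field M₂] [Field M₃] [Field M₄] [Algebra k[X] M₁] [Algebra M₁[X] M₂]
    [Algebra M₂[X] M₃] [Algebra M₃[X] M₄] [IsFractionRing k[X] M₁] [IsFractionRing M₁[X] M₂]
    [IsFractionRing M₂[X] M₃] [IsFractionRing M₃[X] M₄] (hi : IsSquare (-1 : κ)) {m : ℕ}
    (f₀ : MvPolynomial (Fin m) κ →+* k) (hf₀ : Function.Injective f₀) :
    ∃ (ℓ : Type) (_ : Field ℓ) (ρ : MvPolynomial (Fin m ⊕ Fin 4) κ →+* ℓ) (θ : ℓ),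
      θ ^ 2 = -ρ (MvPolynomial.X (.inr 0) * MvPolynomial.X (.inr 2) ^ 2 +
        MvPolynomial.X (.inr 1) * MvPolynomial.X (.inr 3) ^ 2 +
        MvPolynomial.X (.inr 0) * MvPolynomial.X (.inr 1) *
          ((MvPolynomial.X (.inr 0) + 1) ^ 2 * (MvPolynomial.X (.inr 1) + 1) ^ 2 +
            MvPolynomial.X (.inr 0) * MvPolynomial.X (.inr 1))) ∧
      (∀ a b, ρ a + ρ b * θ = 0 → a = 0 ∧ b = 0) ∧
      ¬ ConicSplit (ρ (MvPolynomial.X (.inr 0))) (ρ (MvPolynomial.X (.inr 1))) := by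
  have hf₁ := adjoinHom_injective (L := M₁) hf₀
  have hf₂ := adjoinHom_injective (L := M₂) hf₁
  have hf₃ := adjoinHom_injective (L := M₃) hf₂
  have hf₄ := adjoinHom_injective (L := M₄) hf₃
  have c₀ : CharZero k :=
    charZero_of_injective_ringHom ((f₀.comp MvPolynomial.C).injective)
  have c₁ : CharZero M₁ := charZero_of_injective_ringHom (constHom k M₁).injective
  have c₂ : CharZero M₂ := charZero_of_injective_ringHom (constHom M₁ M₂).injective
  have c₃ : CharZero M₃ := charZero_of_injective_ringHom (constHom M₂ M₃).injective
  have c₄ : CharZero M₄ := charZero_of_injective_ringHom (constHom M₃ M₄).injective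
  obtain ⟨x, hx⟩ : ∃ x : M₁, x = algebraMap k[X] M₁ X := ⟨_, rfl⟩
  obtain ⟨y, hy⟩ : ∃ y : M₂, y = algebraMap M₁[X] M₂ X := ⟨_, rfl⟩
  obtain ⟨x', hx'⟩ : ∃ x' : M₂, x' = constHom M₁ M₂ x := ⟨_, rfl⟩
  obtain ⟨F, hFdef⟩ : ∃ F : M₂, F = (x' + 1) ^ 2 * (y + 1) ^ 2 + x' * y := ⟨_, rfl⟩
  have hF : ¬ IsSquare F := by
    rw [hFdef, hx', hy]
    apply not_isSquare_special
    have h0 : (X * (4 * (X + 1) ^ 2 + X) : k[X]) ≠ 0 := by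
      intro h
      have := congrArg (eval 1) h
      norm_num at this
    have h1 := (map_ne_zero_iff _ (IsFractionRing.injective k[X] M₁)).2 h0
    rwa [map_mul, map_add, map_mul, map_pow, map_add, map_one, ← hx, map_ofNat] at h1
  have i1 : Fact (IsSquare (-1 : M₂)) := ⟨by
    simpa using hi.map ((constHom M₁ M₂).comp ((constHom k M₁).comp (f₀.comp MvPolynomial.C)))⟩
  have i2 : Fact (¬ ConicSplit x' y) :=
    ⟨by rw [hx', hy]; exact not_conicSplit_X (by rw [hx]; exact not_isSquare_X)⟩
  obtain ⟨ρ, hρdef⟩ : ∃ ρ : MvPolynomial (Fin m ⊕ Fin 4) κ →+* M₄,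
    ρ = (adjoinHom (adjoinHom (adjoinHom (adjoinHom f₀ M₁) M₂) M₃) M₄).comp
      (MvPolynomial.rename (specialVariable m)).toRingHom := ⟨_, rfl⟩
  have hρ : Function.Injective ρ := by
    rw [hρdef]
    exact hf₄.comp (MvPolynomial.rename_injective _ (specialVariable_injective m))
  have e0 : ρ (MvPolynomial.X (.inr 0)) = constHom M₃ M₄ (constHom M₂ M₃ x') := by
    simp [hρdef, specialVariable, adjoinHom_X_some, adjoinHom_X_none, hx, hx']
  have e1 : ρ (MvPolynomial.X (.inr 1)) = constHom M₃ M₄ (constHom M₂ M₃ y) := by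
    simp [hρdef, specialVariable, adjoinHom_X_some, adjoinHom_X_none, hy]
  have e2 : ρ (MvPolynomial.X (.inr 2)) = algebraMap M₃[X] M₄ X := by
    simp [hρdef, specialVariable, adjoinHom_X_none]
  have e3 : ρ (MvPolynomial.X (.inr 3)) = constHom M₃ M₄ (algebraMap M₂[X] M₃ X) := by
    simp [hρdef, specialVariable, adjoinHom_X_some, adjoinHom_X_none]
  have hval : ρ (MvPolynomial.X (.inr 0) * MvPolynomial.X (.inr 2) ^ 2 +
        MvPolynomial.X (.inr 1) * MvPolynomial.X (.inr 3) ^ 2 +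
        MvPolynomial.X (.inr 0) * MvPolynomial.X (.inr 1) *
          ((MvPolynomial.X (.inr 0) + 1) ^ 2 * (MvPolynomial.X (.inr 1) + 1) ^ 2 +
            MvPolynomial.X (.inr 0) * MvPolynomial.X (.inr 1))) =
      genericValue M₂ M₃ M₄ x' y F := by
    simp only [map_add, map_mul, map_pow, map_one, e0, e1, e2, e3, genericValue, hFdef]
    ring
  refine ⟨QuadraticAlgebra M₄ (-genericValue M₂ M₃ M₄ x' y F) 0, inferInstance,
    (algebraMap M₄ _).comp ρ, ⟨0, 1⟩, ?_, ?_, ?_⟩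
  · have h := sq (⟨0, 1⟩ : QuadraticAlgebra M₄ (-genericValue M₂ M₃ M₄ x' y F) 0)
    rw [h, RingHom.comp_apply, ← map_neg, hval]
    apply QuadraticAlgebra.ext <;> simp
  · intro a b h
    have h1 := congrArg QuadraticAlgebra.re h
    have h2 := congrArg QuadraticAlgebra.im h
    simp at h1 h2
    exact ⟨(map_eq_zero_iff _ hρ).1 h1, (map_eq_zero_iff _ hρ).1 h2⟩
  · rw [RingHom.comp_apply, RingHom.comp_apply, e0, e1]
    exact not_conicSplit_quadric hF

theorem exists_specialModel (κ : Type) [Field κ] [CharZero κ] (hi : IsSquare (-1 : κ)) (m : ℕ) :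
    ∃ (ℓ : Type) (_ : Field ℓ) (ρ : MvPolynomial (Fin m ⊕ Fin 4) κ →+* ℓ) (θ : ℓ),
      θ ^ 2 = -ρ (MvPolynomial.X (.inr 0) * MvPolynomial.X (.inr 2) ^ 2 +
        MvPolynomial.X (.inr 1) * MvPolynomial.X (.inr 3) ^ 2 +
        MvPolynomial.X (.inr 0) * MvPolynomial.X (.inr 1) *
          ((MvPolynomial.X (.inr 0) + 1) ^ 2 * (MvPolynomial.X (.inr 1) + 1) ^ 2 +
            MvPolynomial.X (.inr 0) * MvPolynomial.X (.inr 1))) ∧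
      (∀ a b, ρ a + ρ b * θ = 0 → a = 0 ∧ b = 0) ∧
      ¬ ConicSplit (ρ (MvPolynomial.X (.inr 0))) (ρ (MvPolynomial.X (.inr 1))) :=
  let k := FractionRing (MvPolynomial (Fin m) κ)
  let M₁ := FractionRing k[X]
  let M₂ := FractionRing M₁[X]
  let M₃ := FractionRing M₂[X]
  let M₄ := FractionRing M₃[X]
  exists_specialModel_of_tower (k := k) (M₁ := M₁) (M₂ := M₂) (M₃ := M₃) (M₄ := M₄) hi
    (algebraMap _ _) (IsFractionRing.injective _ _)

end SpecialModel

section Specialization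

open IsLocalRing

section

variable {Q E ℓ : Type} [CommRing Q] [Field E] [Field ℓ] {φ : Q →+* E} {ψ : Q →+* ℓ}

theorem map_mul_eq_of_fractions (hker : ∀ q, φ q = 0 → ψ q = 0) {e : E} {p p' q q' : Q}
    (hp : e * φ p' = φ p) (hq : e * φ q' = φ q) : ψ p * ψ q' = ψ q * ψ p' := by
  have := hker (p * q' - q * p') (by
    rw [map_sub, map_mul, map_mul, ← hp, ← hq]; ring)
  rw [map_sub, map_mul, map_mul] at this
  linear_combination this

theorem map_ne_zero_of_map_ne_zero (hker : ∀ q, φ q = 0 → ψ q = 0) {q : Q} (hq : ψ q ≠ 0) :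
    φ q ≠ 0 := fun h => hq (hker q h)

/-- A specialization of a subring extends to a valuation ring whose residue field embeds in the
target, as soon as every element is a fraction of nonvanishing elements up to a given set of
scaling factors. -/
theorem exists_valuationSubring_of_specialization (hker : ∀ q, φ q = 0 → ψ q = 0) (T : Set E)
    (hT : ∀ t ∈ T, t ∈ Set.range φ ∨ t⁻¹ ∈ Set.range φ)
    (hgen : ∀ e ≠ 0, ∃ t ∈ T, t ≠ 0 ∧ ∃ q q', ψ q ≠ 0 ∧ ψ q' ≠ 0 ∧ e * φ q = t * φ q') :
    ∃ (W : ValuationSubring E) (r : ResidueField W →+* ℓ),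
      (∀ q, ∃ h : φ q ∈ W, r (residue W ⟨φ q, h⟩) = ψ q) ∧
      ∀ e ≠ 0, ∃ t ∈ T, t ≠ 0 ∧ W.valuation t = W.valuation e := by
  have h1 : (ψ 1 : ℓ) ≠ 0 := by simp
  let S : Subring E :=
    { carrier := {e | ∃ q q', ψ q' ≠ 0 ∧ e * φ q' = φ q}
      mul_mem' := by
        rintro a b ⟨p, p', hp, h⟩ ⟨q, q', hq, h'⟩
        exact ⟨p * q, p' * q', by simp [hp, hq], by simp only [map_mul, ← h, ← h']; ring⟩
      one_mem' := ⟨1, 1, h1, by simp⟩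
      add_mem' := by
        rintro a b ⟨p, p', hp, h⟩ ⟨q, q', hq, h'⟩
        exact ⟨p * q' + q * p', p' * q', by simp [hp, hq], by
          simp only [map_mul, map_add, ← h, ← h']; ring⟩
      zero_mem' := ⟨0, 1, h1, by simp⟩
      neg_mem' := by
        rintro a ⟨p, p', hp, h⟩
        exact ⟨-p, p', hp, by simp [← h]⟩ }
  let W : ValuationSubring E := ⟨S, by
    intro e
    by_cases he : e = 0
    · exact Or.inl ⟨0, 1, h1, by simp [he]⟩
    obtain ⟨t, ht, ht0, q, q', hq, hq', h⟩ := hgen e he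
    rcases hT t ht with ⟨s, hs⟩ | ⟨s, hs⟩
    · exact Or.inl ⟨s * q', q, hq, by rw [h, map_mul, hs]⟩
    · refine Or.inr ⟨s * q, q', hq', ?_⟩
      rw [map_mul, hs]
      field_simp
      linear_combination -h⟩
  have hW : ∀ e : W, ∃ q q', ψ q' ≠ 0 ∧ (e : E) * φ q' = φ q := fun e => e.2
  choose n d hd hnd using hW
  have hval : ∀ (e : W) (q q' : Q), ψ q' ≠ 0 → (e : E) * φ q' = φ q →
      ψ (n e) / ψ (d e) = ψ q / ψ q' := by
    intro e q q' hq' h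
    rw [div_eq_div_iff (hd e) hq']
    exact map_mul_eq_of_fractions hker (hnd e) h
  let f : W →+* ℓ :=
    { toFun := fun e => ψ (n e) / ψ (d e)
      map_one' := by rw [hval 1 1 1 h1 (by simp)]; simp
      map_zero' := by rw [hval 0 0 1 h1 (by simp)]; simp
      map_mul' := by
        intro a b
        rw [hval (a * b) (n a * n b) (d a * d b) (by simp [hd]) (by
          push_cast
          simp only [map_mul, ← hnd]; ring)]
        simp only [map_mul, mul_div_mul_comm]
      map_add' := by
        intro a b
        rw [hval (a + b) (n a * d b + n b * d a) (d a * d b) (by simp [hd]) (by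
          push_cast
          simp only [map_mul, map_add, ← hnd]; ring)]
        have h1 := hd a
        have h2 := hd b
        simp only [map_mul, map_add]
        field_simp }
  have hf : IsLocalHom f := ⟨by
    intro e he
    have he' : ψ (n e) ≠ 0 := fun h => he.ne_zero (by simp [f, h])
    have hφ := map_ne_zero_of_map_ne_zero hker he'
    have hφ' := map_ne_zero_of_map_ne_zero hker (hd e)
    have he0 : (e : E) ≠ 0 := fun h => hφ (by rw [← hnd, h, zero_mul])
    refine IsUnit.of_mul_eq_one (⟨(e : E)⁻¹, ⟨d e, n e, he', ?_⟩⟩ : W) ?_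
    · rw [← hnd]; field_simp
    · exact Subtype.ext (by push_cast; field_simp)⟩
  have hmem : ∀ q, φ q ∈ W := fun q => ⟨q, 1, h1, by simp⟩
  have hfq : ∀ q, f ⟨φ q, hmem q⟩ = ψ q := by
    intro q
    change ψ (n _) / ψ (d _) = ψ q
    rw [hval _ q 1 h1 (by simp)]
    simp
  refine ⟨W, ResidueField.lift f, fun q => ⟨hmem q, ?_⟩, ?_⟩
  · rw [ResidueField.lift_residue_apply, hfq]
  · intro e he
    obtain ⟨t, ht, ht0, q, q', hq, hq', h⟩ := hgen e he
    have hu : ∀ q, ψ q ≠ 0 → W.valuation (φ q) = 1 := by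
      intro q hq
      have : IsUnit (⟨φ q, hmem q⟩ : W) := by
        apply isUnit_of_map_unit f
        rw [hfq]
        exact hq.isUnit
      exact (W.valuation_eq_one_iff _).1 this
    refine ⟨t, ht, ht0, ?_⟩
    have := congrArg W.valuation h
    simpa [hu q hq, hu q' hq'] using this.symm

end

theorem MvPolynomial.exists_primitive {K σ ι : Type} [Field K] (V : ValuationSubring K)
    [Finite ι] (p : ι → MvPolynomial σ K) (hp : ∃ i, p i ≠ 0) :
    ∃ c : K, c ≠ 0 ∧ ∃ p' : ι → MvPolynomial σ V,
      (∀ i, MvPolynomial.C c * p i = (p' i).map V.subtype) ∧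
      ∃ i, (p' i).map (residue V) ≠ 0 := by
  classical
  obtain ⟨i₀, hi₀⟩ := hp
  obtain ⟨s₀, hs₀⟩ := MvPolynomial.ne_zero_iff.1 hi₀
  obtain ⟨c, hc, u, hu, ⟨i₁, s₁⟩, h1⟩ := ValuationRing.exists_primitive (R := V) (L := K)
    (fun k : (i : ι) × ↥(p i).support => (p k.1).coeff k.2)
    ⟨⟨i₀, s₀, MvPolynomial.mem_support_iff.2 hs₀⟩, hs₀⟩
  refine ⟨c, hc, fun i => ∑ s ∈ (p i).support.attach, MvPolynomial.monomial s.1 (u ⟨i, s⟩), ?_,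
    i₁, ?_⟩
  · intro i
    rw [map_sum]
    conv_lhs => rw [(p i).as_sum, ← Finset.sum_attach, Finset.mul_sum]
    refine Finset.sum_congr rfl fun s _ => ?_
    rw [MvPolynomial.C_mul_monomial, MvPolynomial.map_monomial, hu ⟨i, s⟩]
    rfl
  · intro h
    have := congrArg (MvPolynomial.coeff s₁.1) h
    rw [MvPolynomial.coeff_map, MvPolynomial.coeff_sum, Finset.sum_eq_single s₁,
      MvPolynomial.coeff_monomial,
      if_pos rfl, h1, map_one, MvPolynomial.coeff_zero] at this
    · exact one_ne_zero this
    · intro s _ hs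
      rw [MvPolynomial.coeff_monomial, if_neg (fun h => hs (Subtype.ext h))]
    · intro h
      exact absurd (Finset.mem_attach _ _) h

/-- The evaluation of a quadratic algebra at a square root. -/
def quadraticAlgebraHom {R S : Type} [CommRing R] [CommRing S] {a : R} (j : R →+* S) (t : S)
    (h : t ^ 2 = j a) : QuadraticAlgebra R a 0 →+* S where
  toFun q := j q.re + j q.im * t
  map_one' := by
    rw [QuadraticAlgebra.re_one, QuadraticAlgebra.im_one]
    simp
  map_zero' := by simp
  map_mul' p q := by
    simp
    linear_combination -j p.im * j q.im * h
  map_add' p q := by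
    simp
    ring

theorem exists_valuationSubring_of_double_cover {K E ℓ σ : Type} [Field K] [Field E] [Field ℓ]
    (V : ValuationSubring K) {J : MvPolynomial σ K →+* E} (hJ : Function.Injective J)
    {Δ : MvPolynomial σ V} {Θ : E} (hΘ : Θ ^ 2 = J (Δ.map V.subtype))
    (hgen : ∀ e : E, ∃ a b c d, J a + J b * Θ ≠ 0 ∧ e * (J a + J b * Θ) = J c + J d * Θ)
    {ρ : MvPolynomial σ (ResidueField V) →+* ℓ} {θ : ℓ} (hθ : θ ^ 2 = ρ (Δ.map (residue V)))
    (hρ : ∀ a b, ρ a + ρ b * θ = 0 → a = 0 ∧ b = 0) :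
    ∃ (W : ValuationSubring E) (r : ResidueField W →+* ℓ),
      (∀ p : MvPolynomial σ V, ∃ h : J (p.map V.subtype) ∈ W,
        r (residue W ⟨J (p.map V.subtype), h⟩) = ρ (p.map (residue V))) ∧
      ∀ e ≠ 0, ∃ c : K, c ≠ 0 ∧ W.valuation (J (MvPolynomial.C c)) = W.valuation e := by
  let φ : QuadraticAlgebra (MvPolynomial σ V) Δ 0 →+* E :=
    quadraticAlgebraHom (J.comp (MvPolynomial.map V.subtype)) Θ hΘ
  let ψ : QuadraticAlgebra (MvPolynomial σ V) Δ 0 →+* ℓ :=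
    quadraticAlgebraHom (ρ.comp (MvPolynomial.map (residue V))) θ hθ
  have hφ : ∀ q, φ q = J (q.re.map V.subtype) + J (q.im.map V.subtype) * Θ := fun q => rfl
  have hψ : ∀ q, ψ q = ρ (q.re.map (residue V)) + ρ (q.im.map (residue V)) * θ := fun q => rfl
  have hmap : Function.Injective (MvPolynomial.map (σ := σ) V.subtype) :=
    MvPolynomial.map_injective _ Subtype.coe_injective
  have hscale : ∀ a b : MvPolynomial σ K, a ≠ 0 ∨ b ≠ 0 → ∃ c : K, c ≠ 0 ∧ ∃ q,
      J (MvPolynomial.C c) * (J a + J b * Θ) = φ q ∧ (q.re.map (residue V) ≠ 0 ∨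
        q.im.map (residue V) ≠ 0) := by
    intro a b hab
    obtain ⟨c, hc, p, hp, i, hi⟩ := MvPolynomial.exists_primitive V ![a, b] (by
      rcases hab with h | h
      exacts [⟨0, h⟩, ⟨1, h⟩])
    refine ⟨c, hc, ⟨p 0, p 1⟩, ?_, ?_⟩
    · rw [hφ, ← hp, ← hp]
      simp
      ring
    · revert hi
      fin_cases i
      exacts [Or.inl, Or.inr]
  have hψ0 : ∀ q, (q.re.map (residue V) ≠ 0 ∨ q.im.map (residue V) ≠ 0) → ψ q ≠ 0 := by
    intro q hq h
    have := hρ _ _ h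
    tauto
  have hinj : ∀ q, φ q = 0 → q = 0 := by
    intro q hq
    by_contra hne
    have hne' : q.re.map V.subtype ≠ 0 ∨ q.im.map V.subtype ≠ 0 := by
      by_contra! h
      rw [← map_zero (MvPolynomial.map V.subtype)] at h
      exact hne (QuadraticAlgebra.ext (hmap h.1) (hmap h.2))
    obtain ⟨c, hc, q', hq', hqq⟩ := hscale _ _ hne'
    rw [← hφ, hq, mul_zero, hφ] at hq'
    have h1 : q'.re ^ 2 = q'.im ^ 2 * Δ := by
      apply hmap
      apply hJ
      rw [map_mul, map_mul, ← hΘ, map_pow, map_pow, map_pow, map_pow]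
      linear_combination (J (q'.im.map V.subtype) * Θ - J (q'.re.map V.subtype)) * hq'
    have h2 := congrArg (fun p => ρ (p.map (residue V))) h1
    simp only [map_mul, map_pow, ← hθ] at h2
    have h3 : (ρ (q'.re.map (residue V)) + ρ (q'.im.map (residue V)) * θ) *
        (ρ (q'.re.map (residue V)) + ρ (-(q'.im.map (residue V))) * θ) = 0 := by
      rw [map_neg]
      linear_combination h2
    rcases mul_eq_zero.1 h3 with h3 | h3
    · have := hρ _ _ h3
      tauto
    · have := hρ _ _ h3
      rw [neg_eq_zero] at this
      tauto
  obtain ⟨W, r, hr, hv⟩ := exists_valuationSubring_of_specialization (φ := φ) (ψ := ψ)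
    (fun q hq => by rw [hinj q hq, map_zero]) (Set.range (J.comp MvPolynomial.C)) (by
      rintro _ ⟨c, rfl⟩
      rcases V.mem_or_inv_mem c with h | h
      · exact Or.inl ⟨⟨MvPolynomial.C ⟨c, h⟩, 0⟩, by rw [hφ]; simp⟩
      · exact Or.inr ⟨⟨MvPolynomial.C ⟨c⁻¹, h⟩, 0⟩, by
          rw [hφ, ← map_inv₀]
          simp only [MvPolynomial.map_C, map_zero, zero_mul, add_zero]
          rfl⟩) (by
      intro e he
      obtain ⟨a, b, c, d, h0, h⟩ := hgen e
      have hab : a ≠ 0 ∨ b ≠ 0 := by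
        by_contra! h
        simp [h] at h0
      have hcd : c ≠ 0 ∨ d ≠ 0 := by
        by_contra! h'
        simp [h', he, h0] at h
      obtain ⟨s, hs, q, hq, hq0⟩ := hscale a b hab
      obtain ⟨s', hs', q', hq', hq0'⟩ := hscale c d hcd
      have hCne : ∀ s : K, s ≠ 0 → (J.comp MvPolynomial.C) s ≠ 0 := fun s hs =>
        (map_ne_zero _).2 hs
      have h1 := hCne s hs
      have h2 := hCne s' hs'
      refine ⟨_, ⟨s / s', rfl⟩, hCne _ (div_ne_zero hs hs'), q, q', hψ0 q hq0, hψ0 q' hq0', ?_⟩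
      rw [← hq, ← hq', ← h, map_div₀]
      rw [RingHom.comp_apply] at h1 h2
      simp only [RingHom.comp_apply]
      field_simp)
  refine ⟨W, r, fun p => ?_, fun e he => ?_⟩
  · have h1 : φ ⟨p, 0⟩ = J (p.map V.subtype) := by rw [hφ]; simp
    have h2 : ψ ⟨p, 0⟩ = ρ (p.map (residue V)) := by rw [hψ]; simp
    obtain ⟨h, hh⟩ := hr ⟨p, 0⟩
    refine ⟨h1 ▸ h, ?_⟩
    rw [← h2, ← hh]
    simp only [h1]
  · obtain ⟨_, ⟨c, rfl⟩, hc, h⟩ := hv e he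
    exact ⟨c, fun h0 => hc (by rw [h0, map_zero]), h⟩

end Specialization

section QuadricPoint

open IsLocalRing

theorem ReducesToSpecial.eval₂_map_residue {V S : Type} [CommRing V] [IsLocalRing V] [CommRing S]
    {D F : Fin 4 → ℕ} {A : Fin 4 → Fin 4 → MvPolynomial (Fin 4) V} (h : ReducesToSpecial D F A)
    (f : ResidueField V →+* S) (P : Fin 4 → S) (i j : Fin 4) :
    (A i j).eval₂ (f.comp (IsLocalRing.residue V)) P =
      if i = j then specialDiag D F (P 0) (P 1) (P 2) (P 3) i else 0 := by
  rw [← MvPolynomial.eval₂_map, h.map_residue, ← MvPolynomial.coe_eval₂Hom]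
  split_ifs
  · rw [map_specialDiag]
    simp
  · rw [map_zero]

theorem ReducesToSpecial.map {V W : Type} [CommRing V] [IsLocalRing V] [CommRing W]
    [IsLocalRing W] {D F : Fin 4 → ℕ} {A : Fin 4 → Fin 4 → MvPolynomial (Fin 4) V}
    (h : ReducesToSpecial D F A) (a : V →+* W) [IsLocalHom a] :
    ReducesToSpecial D F fun i j => (A i j).map a where
  degrees := h.degrees
  homogeneous₁ i j := fun c hc => h.homogeneous₁ i j fun h0 =>
    hc (by rw [MvPolynomial.coeff_map, h0, map_zero])
  homogeneous₂ i j := fun c hc => h.homogeneous₂ i j fun h0 =>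
    hc (by rw [MvPolynomial.coeff_map, h0, map_zero])
  map_residue i j := by
    rw [MvPolynomial.map_map, ← ResidueField.map_comp_residue, ← MvPolynomial.map_map,
      h.map_residue]
    split_ifs
    · rw [map_specialDiag]
      simp
    · rw [map_zero]

/-- A chart of the quadric over a valuation ring, as a double cover of affine space. -/
theorem ReducesToSpecial.exists_discriminant {V : Type} [CommRing V] [IsLocalRing V] {m : ℕ}
    {D F : Fin 4 → ℕ} {A : Fin 4 → Fin 4 → MvPolynomial (Fin 4) V} (h : ReducesToSpecial D F A) :
    ∃ α β Δ : MvPolynomial (Fin m ⊕ Fin 4) V,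
      α.map (IsLocalRing.residue V) ≠ 0 ∧
      Δ.map (IsLocalRing.residue V) = -4 * (MvPolynomial.X (.inr 0) * MvPolynomial.X (.inr 2) ^ 2 +
        MvPolynomial.X (.inr 1) * MvPolynomial.X (.inr 3) ^ 2 +
        MvPolynomial.X (.inr 0) * MvPolynomial.X (.inr 1) *
          ((MvPolynomial.X (.inr 0) + 1) ^ 2 * (MvPolynomial.X (.inr 1) + 1) ^ 2 +
            MvPolynomial.X (.inr 0) * MvPolynomial.X (.inr 1))) ∧
      ∀ {E : Type} [Field E] (J : MvPolynomial (Fin m ⊕ Fin 4) V →+* E) (r : Fin 4 → E),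
        J (MvPolynomial.X (.inr 2)) = r 1 → J (MvPolynomial.X (.inr 3)) = r 2 → r 3 = 1 →
        ∑ i, ∑ j, (A i j).eval₂ (J.comp MvPolynomial.C) ![1, J (MvPolynomial.X (.inr 0)), 1,
          J (MvPolynomial.X (.inr 1))] * r i * r j = 0 →
        (2 * J α * r 0 + J β) ^ 2 = J Δ := by
  let P : Fin 4 → MvPolynomial (Fin m ⊕ Fin 4) V :=
    ![1, MvPolynomial.X (.inr 0), 1, MvPolynomial.X (.inr 1)]
  let B : Fin 4 → Fin 4 → MvPolynomial (Fin m ⊕ Fin 4) V := fun i j =>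
    (A i j).eval₂ MvPolynomial.C P
  let w : Fin 3 → MvPolynomial (Fin m ⊕ Fin 4) V :=
    ![MvPolynomial.X (.inr 2), MvPolynomial.X (.inr 3), 1]
  have hB : ∀ i j, (B i j).map (IsLocalRing.residue V) =
      if i = j then specialDiag D F 1 (MvPolynomial.X (.inr 0)) 1 (MvPolynomial.X (.inr 1)) i
        else 0 := by
    intro i j
    have h1 : (B i j).map (IsLocalRing.residue V) =
        (A i j).eval₂ (MvPolynomial.C.comp (IsLocalRing.residue V))
        ![1, MvPolynomial.X (.inr 0), 1, MvPolynomial.X (.inr 1)] := by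
      rw [MvPolynomial.hom_eval₂]
      congr 1
      · ext; simp
      · funext k
        fin_cases k <;> simp [P]
    rw [h1, h.eval₂_map_residue]
    rfl
  refine ⟨B 0 0, ∑ j : Fin 3, (B 0 j.succ + B j.succ 0) * w j,
    (∑ j : Fin 3, (B 0 j.succ + B j.succ 0) * w j) ^ 2 -
      4 * B 0 0 * ∑ i : Fin 3, ∑ j : Fin 3, B i.succ j.succ * w i * w j, ?_, ?_, ?_⟩
  · rw [hB]
    simp [specialDiag]
  · have h0 : ∀ i : Fin 3, (0 : Fin 4) ≠ i.succ := fun i => (Fin.succ_ne_zero i).symm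
    simp only [map_sub, map_pow, map_sum, map_mul, map_add, hB, map_ofNat, Fin.succ_inj, h0,
      (h0 _).symm, if_false, add_zero, zero_mul, Finset.sum_const_zero, if_true, ite_mul,
      Finset.sum_ite_eq, Finset.mem_univ]
    rw [Fin.sum_univ_three]
    simp only [specialDiag, w, Fin.isValue, Matrix.cons_val, Fin.succ_zero_eq_one,
      Fin.succ_one_eq_two, map_one, one_pow, MvPolynomial.map_X]
    have h3 : (Fin.succ 2 : Fin 4) = 3 := rfl
    rw [h3]
    simp only [Matrix.cons_val]
    ring
  · intro E _ J r h1 h2 h3 hsum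
    have hJB : ∀ i j, (A i j).eval₂ (J.comp MvPolynomial.C) ![1, J (MvPolynomial.X (.inr 0)), 1,
          J (MvPolynomial.X (.inr 1))] = J (B i j) := by
      intro i j
      rw [MvPolynomial.hom_eval₂]
      congr 1
      funext k
      fin_cases k <;> simp [P]
    have hJw : ∀ i, J (w i) = r i.succ := by
      intro i
      fin_cases i
      · exact h1
      · exact h2
      · simpa [w] using h3.symm
    simp only [hJB, Fin.sum_univ_succ (n := 3)] at hsum
    simp only [map_sub, map_pow, map_sum, map_mul, map_add, map_ofNat, hJw]
    simp only [Finset.sum_add_distrib] at hsum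
    have e1 : ∑ j : Fin 3, (J (B 0 j.succ) + J (B j.succ 0)) * r j.succ * r 0 =
        ∑ j : Fin 3, J (B 0 j.succ) * r 0 * r j.succ +
          ∑ j : Fin 3, J (B j.succ 0) * r j.succ * r 0 := by
      rw [← Finset.sum_add_distrib]
      exact Finset.sum_congr rfl fun j _ => by ring
    rw [← Finset.sum_mul] at e1
    linear_combination 4 * J (B 0 0) * (hsum + e1)

end QuadricPoint

section QuadricCurve

open IsLocalRing

/-- Fractions with respect to a subring of elements `J a + J b Θ` fill up a field generated by the
image of `J` and `Θ`. -/
theorem exists_fraction_of_closure_eq_top {K E σ : Type} [Field K] [Field E]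
    (J : MvPolynomial σ K →+* E) {Θ : E} {Δ : MvPolynomial σ K} (hΘ : Θ ^ 2 = J Δ)
    (htop : Subfield.closure (Set.range J ∪ {Θ}) = ⊤) (e : E) :
    ∃ a b c d, J a + J b * Θ ≠ 0 ∧ e * (J a + J b * Θ) = J c + J d * Θ := by
  have he : e ∈ Subfield.closure (Set.range J ∪ {Θ}) := htop ▸ Subfield.mem_top e
  have hle : Subring.closure (Set.range J ∪ {Θ}) ≤ (quadraticAlgebraHom J Θ hΘ).range := by
    rw [Subring.closure_le, Set.union_subset_iff, Set.singleton_subset_iff]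
    refine ⟨?_, ⟨⟨0, 1⟩, ?_⟩⟩
    · rintro _ ⟨p, rfl⟩
      exact ⟨⟨p, 0⟩, by simp [quadraticAlgebraHom]⟩
    · simp [quadraticAlgebraHom]
  rw [Subfield.mem_closure_iff] at he
  obtain ⟨y, hy, z, hz, rfl⟩ := he
  by_cases hz0 : z = 0
  · exact ⟨1, 0, 0, 0, by simp, by simp [hz0]⟩
  obtain ⟨p, rfl⟩ := hle hy
  obtain ⟨q, rfl⟩ := hle hz
  exact ⟨q.re, q.im, p.re, p.im, hz0, div_mul_cancel₀ _ hz0⟩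

variable {K E : Type} [Field K] [Field E] [IsAlgClosed K]

/-- The valuation of the function field of a quadric degenerating to the special quadric. -/
theorem ReducesToSpecial.exists_valuationSubring {V : ValuationSubring K}
    [CharZero (ResidueField V)] {D F : Fin 4 → ℕ} {A : Fin 4 → Fin 4 → MvPolynomial (Fin 4) V}
    (h : ReducesToSpecial D F A) {m : ℕ} {J : MvPolynomial (Fin m ⊕ Fin 4) K →+* E}
    (hJ : Function.Injective J) {r : Fin 4 → E} (hr1 : J (MvPolynomial.X (.inr 2)) = r 1)
    (hr2 : J (MvPolynomial.X (.inr 3)) = r 2) (hr3 : r 3 = 1)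
    (hsum : ∑ i, ∑ j, (A i j).eval₂ (J.comp (MvPolynomial.C.comp V.subtype))
      ![1, J (MvPolynomial.X (.inr 0)), 1, J (MvPolynomial.X (.inr 1))] * r i * r j = 0)
    (htop : Subfield.closure (Set.range J ∪ {r 0}) = ⊤) :
    ∃ W : ValuationSubring E, CharZero (ResidueField W) ∧
      (∀ a b, a ≠ 0 → b ≠ 0 → NonsplitRatios W a (J (MvPolynomial.X (.inr 0)) * a) b
        (J (MvPolynomial.X (.inr 1)) * b)) ∧
      (∃ a : V →+* W, IsLocalHom a ∧
        W.subtype.comp a = J.comp (MvPolynomial.C.comp V.subtype)) ∧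
      ∀ e ≠ 0, ∃ c : K, c ≠ 0 ∧ W.valuation (J (MvPolynomial.C c)) = W.valuation e := by
  have hi : IsSquare (-1 : ResidueField V) := by
    obtain ⟨i, hi⟩ := IsAlgClosed.exists_pow_nat_eq (-1 : K) (n := 2) two_pos
    have hiV : i ∈ V := by
      rw [← V.valuation_le_one_iff]
      have := congrArg V.valuation hi
      rw [map_pow, Valuation.map_neg, map_one] at this
      exact (pow_le_one_iff two_ne_zero).1 this.le
    refine ⟨IsLocalRing.residue V ⟨i, hiV⟩, ?_⟩
    rw [← map_mul, ← map_one (IsLocalRing.residue V), ← map_neg]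
    congr 1
    exact Subtype.ext (by simp [← hi, sq])
  obtain ⟨ℓ, _, ρ, θ, hθ, hρ, hns⟩ := exists_specialModel (ResidueField V) hi m
  obtain ⟨α, β, Δ, hα, hΔ, hkey⟩ := h.exists_discriminant (m := m)
  let J' : MvPolynomial (Fin m ⊕ Fin 4) V →+* E := J.comp (MvPolynomial.map V.subtype)
  have hJ' : ∀ p, J' p = J (p.map V.subtype) := fun _ => rfl
  have hΘ := hkey J' r (by simpa [hJ'] using hr1) (by simpa [hJ'] using hr2) hr3 (by
    rw [← hsum]
    simp only [hJ', MvPolynomial.map_X]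
    congr! 6
    ext
    simp [J'])
  have hα0 : J' α ≠ 0 := by
    intro h0
    rw [hJ', map_eq_zero_iff _ hJ,
      map_eq_zero_iff _ (MvPolynomial.map_injective _ Subtype.coe_injective)] at h0
    exact hα (by rw [h0, map_zero])
  have h2 : (2 : E) ≠ 0 := by
    have : (2 : K) ≠ 0 := by
      intro h
      have h2 : (2 : V) = 0 := Subtype.ext (by push_cast; exact h)
      have := congrArg (IsLocalRing.residue V) h2
      rw [map_ofNat, map_zero] at this
      exact two_ne_zero this
    have := (map_ne_zero (J.comp MvPolynomial.C)).2 this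
    rwa [map_ofNat] at this
  have htop' : Subfield.closure (Set.range J ∪ {2 * J' α * r 0 + J' β}) = ⊤ := by
    rw [eq_top_iff, ← htop, Subfield.closure_le, Set.union_subset_iff, Set.singleton_subset_iff]
    have hJm : ∀ p, J p ∈ Subfield.closure (Set.range J ∪ {2 * J' α * r 0 + J' β}) := fun p =>
      Subfield.subset_closure (Or.inl ⟨p, rfl⟩)
    refine ⟨?_, ?_⟩
    · rintro _ ⟨p, rfl⟩
      exact hJm p
    · have h3 : r 0 = ((2 * J' α * r 0 + J' β) - J' β) / (2 * J' α) := by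
        field_simp
        ring
      have h4 : 2 * J' α * r 0 + J' β ∈
          Subfield.closure (Set.range J ∪ {2 * J' α * r 0 + J' β}) :=
        Subfield.subset_closure (Or.inr rfl)
      rw [SetLike.mem_coe]
      nth_rewrite 2 [h3]
      refine div_mem (sub_mem h4 (hJm _)) (mul_mem ?_ (hJm _))
      exact ofNat_mem _ 2
  obtain ⟨W, f, hf, hv⟩ := exists_valuationSubring_of_double_cover V hJ hΘ
    (exists_fraction_of_closure_eq_top J hΘ htop') (ρ := ρ) (θ := 2 * θ) (by
      rw [hΔ, mul_pow, hθ, map_mul, map_neg, map_ofNat]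
      ring) (by
      intro a b hab
      have := hρ a (2 * b) (by rw [map_mul, map_ofNat, ← hab]; ring)
      have h2 : (2 : MvPolynomial (Fin m ⊕ Fin 4) (ResidueField V)) ≠ 0 := two_ne_zero
      exact ⟨this.1, (mul_eq_zero.1 this.2).resolve_left h2⟩)
  have hρinj : Function.Injective ρ := by
    rw [injective_iff_map_eq_zero]
    intro a ha
    exact (hρ a 0 (by simp [ha])).1
  have hm : ∀ c : V, J (MvPolynomial.C (c : K)) ∈ W := fun c => by
    obtain ⟨h, -⟩ := hf (MvPolynomial.C c)
    simpa using h
  let a : V →+* W := (J.comp (MvPolynomial.C.comp V.subtype)).codRestrict W.toSubring hm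
  have ha : ∀ c, f (IsLocalRing.residue W (a c)) =
      ρ (MvPolynomial.C (IsLocalRing.residue V c)) := fun c => by
    obtain ⟨h, hh⟩ := hf (MvPolynomial.C c)
    have hac : a c = ⟨_, h⟩ := Subtype.ext (by
      exact congrArg J (MvPolynomial.map_C _ c).symm)
    rw [hac, hh, MvPolynomial.map_C]
  have hloc : IsLocalHom a := ⟨by
    intro c hc
    rw [← residue_ne_zero_iff_isUnit] at hc ⊢
    intro h0
    have := ha c
    rw [h0, map_zero, map_zero, map_eq_zero] at this
    exact hc this⟩
  have hchar : CharZero (ResidueField W) :=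
    charZero_of_injective_ringHom (ResidueField.map a).injective
  have hX : ∀ i, ∃ x : W, (x : E) = J (MvPolynomial.X i) ∧
      f (IsLocalRing.residue W x) = ρ (MvPolynomial.X i) := fun i => by
    obtain ⟨h, hh⟩ := hf (MvPolynomial.X i)
    exact ⟨⟨_, h⟩, by simp, hh.trans (by rw [MvPolynomial.map_X])⟩
  refine ⟨W, hchar, ?_, ⟨a, hloc, rfl⟩, hv⟩
  intro s t hs ht
  obtain ⟨x, hx, hx'⟩ := hX (.inr 0)
  obtain ⟨y, hy, hy'⟩ := hX (.inr 1)
  have hne : ∀ (x : W) i, f (IsLocalRing.residue W x) = ρ (MvPolynomial.X i) →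
      IsLocalRing.residue W x ≠ 0 := by
    intro x i h h0
    rw [h0, map_zero] at h
    exact MvPolynomial.X_ne_zero i (hρinj (by rw [← h, map_zero]))
  refine ⟨hs, ht, x, y, by rw [hx], by rw [hy], hne x _ hx', hne y _ hy', fun hc => hns ?_⟩
  rw [← hx', ← hy']
  exact hc.map f

/-- A rational curve on the generic quadric bundle through the generic point whose base
coordinates have constant leading coefficients cannot exist. -/
theorem ReducesToSpecial.false_of_curve {V : ValuationSubring K}
    [CharZero (ResidueField V)] {D F : Fin 4 → ℕ} {A : Fin 4 → Fin 4 → MvPolynomial (Fin 4) V}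
    (h : ReducesToSpecial D F A) {m : ℕ} {J : MvPolynomial (Fin m ⊕ Fin 4) K →+* E}
    (hJ : Function.Injective J) {r : Fin 4 → E} (hr1 : J (MvPolynomial.X (.inr 2)) = r 1)
    (hr2 : J (MvPolynomial.X (.inr 3)) = r 2) (hr3 : r 3 = 1)
    (hsum : ∑ i, ∑ j, (A i j).eval₂ (J.comp (MvPolynomial.C.comp V.subtype))
      ![1, J (MvPolynomial.X (.inr 0)), 1, J (MvPolynomial.X (.inr 1))] * r i * r j = 0)
    (htop : Subfield.closure (Set.range J ∪ {r 0}) = ⊤) {P Z : Fin 4 → Polynomial E}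
    (hZ0 : ∃ i, Z i ≠ 0)
    (hZ : ∑ i, ∑ j, (A i j).eval₂ (Polynomial.C.comp (J.comp (MvPolynomial.C.comp V.subtype))) P *
      Z i * Z j = 0)
    (hP0 : (P 0).coeff 0 ≠ 0) (hP2 : (P 2).coeff 0 ≠ 0)
    (hP1 : (P 1).coeff 0 = J (MvPolynomial.X (.inr 0)) * (P 0).coeff 0)
    (hP3 : (P 3).coeff 0 = J (MvPolynomial.X (.inr 1)) * (P 2).coeff 0)
    (hlead : ∀ p, ∃ c : K, (P p).leadingCoeff = J (MvPolynomial.C c)) : False := by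
  obtain ⟨W, _, hns, ⟨a, _, ha⟩, hv⟩ := h.exists_valuationSubring hJ hr1 hr2 hr3 hsum htop
  have hsq : ∀ c : K, ∀ w : W, (w : E) = J (MvPolynomial.C c) → IsSquare w := by
    intro c w hw
    obtain ⟨s, hs⟩ := IsAlgClosed.exists_pow_nat_eq c (n := 2) two_pos
    have h1 : J (MvPolynomial.C s) ^ 2 = w := by rw [hw, ← hs, ← map_pow, ← map_pow]
    have hsW : J (MvPolynomial.C s) ∈ W := by
      rw [← W.valuation_le_one_iff]
      have h2 := (W.valuation_le_one_iff _).2 w.2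
      rw [← h1, map_pow] at h2
      exact (pow_le_one_iff two_ne_zero).1 h2
    exact ⟨⟨_, hsW⟩, Subtype.ext (by simp [← h1, sq])⟩
  obtain ⟨N, M, hN0, hN1, hM0, hM1, h0, h2, x, y, h1, h3, hx, hy, hc⟩ :=
    NonsplitRatios.exists_leading (W := W) (by
      have := (hsq (-1) (-1) (by simp)).map (IsLocalRing.residue W)
      simpa using this) (h.map a) (by
      intro e he n hn
      obtain ⟨c, hc, hce⟩ := hv e he
      obtain ⟨s, hs⟩ := IsAlgClosed.exists_pow_nat_eq c hn
      exact ⟨J (MvPolynomial.C s), by rw [← map_pow, ← map_pow, ← map_pow, hs, hce]⟩) hZ0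
      (P := P) (by
      rw [← hZ]
      simp only [MvPolynomial.eval₂_map, RingHom.comp_assoc, ha]) (by
      rw [hP1, hP3]
      exact hns _ _ hP0 hP2)
  have hdeg : ∀ (p : Polynomial E) k, p.natDegree ≤ k → p.coeff k ≠ 0 →
      p.coeff k = p.leadingCoeff := by
    intro p k h1 h2
    rw [← Polynomial.coeff_natDegree, le_antisymm h1 (Polynomial.le_natDegree_of_ne_zero h2)]
  have hx0 : (x : E) ≠ 0 := by
    intro h; apply hx; rw [show x = 0 from Subtype.ext h, map_zero]
  obtain ⟨c0, hc0⟩ := hlead 0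
  obtain ⟨c1, hc1⟩ := hlead 1
  rw [hdeg _ _ hN1 (by rw [h1]; exact mul_ne_zero hx0 h0), hdeg _ _ hN0 h0, hc1, hc0] at h1
  rw [hdeg _ _ hN0 h0, hc0] at h0
  refine hc (ConicSplit.of_isSquare_left _ ((hsq (c1 / c0) x ?_).map (IsLocalRing.residue W)))
  rw [eq_comm]
  have := map_div₀ (J.comp MvPolynomial.C) c1 c0
  simp only [RingHom.comp_apply] at this
  rw [this, h1, mul_div_cancel_right₀ _ h0]

end QuadricCurve

section TranscendenceDegree

/-- If `E` has transcendence degree at least `#σ` and is generated by `#σ` elements together with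
an element quadratic over them, these `#σ` elements are algebraically independent. -/
theorem MvPolynomial.injective_of_closure_eq_top {K E σ : Type} [Field K] [Field E] [Finite σ]
    {I J : MvPolynomial σ K →+* E} (hI : Function.Injective I)
    (hIJ : I.comp MvPolynomial.C = J.comp MvPolynomial.C) {r : E} {a b c : MvPolynomial σ K}
    (ha : J a ≠ 0) (hr : J a * r ^ 2 + J b * r + J c = 0)
    (htop : Subfield.closure (Set.range J ∪ {r}) = ⊤) : Function.Injective J := by
  let : Algebra K E := (I.comp MvPolynomial.C).toAlgebra
  have key : ∀ G : MvPolynomial σ K →+* E, G.comp C = algebraMap K E →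
      ∀ p, G p = aeval (fun s => G (X s)) p := fun G hG p => by
    refine congrArg (fun f : MvPolynomial σ K →+* E => f p)
      (MvPolynomial.ringHom_ext (f := G) (g := (aeval fun s => G (X s)).toRingHom) ?_ ?_)
    · intro c
      simpa using RingHom.congr_fun hG c
    · simp
  have hv : AlgebraicIndependent K (fun s => I (X s)) := by
    rw [algebraicIndependent_iff_injective_aeval]
    intro p q hpq
    exact hI (by rwa [key I rfl, key I rfl q])
  have hJ := key J hIJ.symm
  have hmem : ∀ p, J p ∈ Algebra.adjoin K (Set.range fun s => J (X s)) := fun p => by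
    rw [Algebra.adjoin_range_eq_range_aeval]
    exact ⟨p, (hJ p).symm⟩
  have halg : Algebra.IsAlgebraic (Algebra.adjoin K (Set.range fun s => J (X s))) E := by
    have hJalg : ∀ p, IsAlgebraic (Algebra.adjoin K (Set.range fun s => J (X s))) (J p) :=
      fun p => isAlgebraic_algebraMap (⟨J p, hmem p⟩ :
        Algebra.adjoin K (Set.range fun s => J (X s)))
    refine ⟨fun e => ?_⟩
    have he : e ∈ Subfield.closure (Set.range J ∪ {r}) := htop ▸ Subfield.mem_top e
    induction he using Subfield.closure_induction with
    | mem x hx =>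
      obtain ⟨p, rfl⟩ | rfl := hx
      · exact hJalg p
      · refine ⟨.C ⟨J a, hmem a⟩ * .X ^ 2 + .C ⟨J b, hmem b⟩ * .X + .C ⟨J c, hmem c⟩, ?_, ?_⟩
        · intro h0
          have := congrArg (fun p => p.coeff 2) h0
          simp only [Polynomial.coeff_add, Polynomial.coeff_C_mul, Polynomial.coeff_X_pow,
            Polynomial.coeff_X, Polynomial.coeff_C, Polynomial.coeff_zero] at this
          exact ha (by simpa using congrArg Subtype.val this)
        · simpa [Subalgebra.algebraMap_eq] using hr
    | one => exact isAlgebraic_one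
    | add x y _ _ hx hy => exact hx.add hy
    | neg x _ hx => exact hx.neg
    | inv x _ hx => exact hx.inv
    | mul x y _ _ hx hy => exact hx.mul hy
  have := Algebra.IsAlgebraic.isTranscendenceBasis_of_lift_le_trdeg_of_finite K
    (fun s => J (X s)) hv.lift_cardinalMk_le_trdeg
  have hinj := algebraicIndependent_iff_injective_aeval.1 this.1
  intro p q hpq
  exact hinj (by rwa [hJ, hJ q] at hpq)

end TranscendenceDegree

section ChartRing

open MvPolynomial

/-- View a polynomial on the chart as a polynomial in the last fibre coordinate. -/
noncomputable def chartToPolynomial :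
    MvPolynomial (Fin 5) ℂ →+* Polynomial (MvPolynomial (Fin 4) ℂ) :=
  (aeval ![Polynomial.C (X 0), Polynomial.C (X 1), Polynomial.C (X 2), Polynomial.C (X 3),
    Polynomial.X]).toRingHom

theorem chartToPolynomial_rename (p : MvPolynomial (Fin 4) ℂ) :
    chartToPolynomial (rename Fin.castSucc p) = Polynomial.C p := by
  have : chartToPolynomial.comp (rename Fin.castSucc).toRingHom = Polynomial.C := by
    refine MvPolynomial.ringHom_ext (fun c => ?_) fun i => ?_
    · simp [chartToPolynomial]
    · fin_cases i <;> simp [chartToPolynomial]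
  exact RingHom.congr_fun this p

/-- The coefficients on the chart `x₀ = y₀ = 1`. -/
noncomputable def dehomBase : MvPolynomial (Fin 4) ℂ →+* MvPolynomial (Fin 4) ℂ :=
  (aeval ![1, X 0, 1, X 1]).toRingHom

theorem chartToPolynomial_dehomP1P1 (p : MvPolynomial (Fin 4) ℂ) :
    chartToPolynomial (dehomP1P1 p) = Polynomial.C (dehomBase p) := by
  have : chartToPolynomial.comp dehomP1P1 = Polynomial.C.comp dehomBase := by
    refine MvPolynomial.ringHom_ext (fun c => ?_) fun i => ?_
    · simp [chartToPolynomial, dehomP1P1, dehomBase]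
    · fin_cases i <;> simp [chartToPolynomial, dehomP1P1, dehomBase]
  exact RingHom.congr_fun this p

theorem dehomBase_ne_zero {p : MvPolynomial (Fin 4) ℂ} (hp : eval ![1, 0, 1, 0] p ≠ 0) :
    dehomBase p ≠ 0 := by
  intro h0
  apply hp
  have : (eval 0).comp dehomBase = eval ![1, 0, 1, 0] := by
    refine MvPolynomial.ringHom_ext (fun c => ?_) fun i => ?_
    · simp [dehomBase]
    · fin_cases i <;> simp [dehomBase]
  rw [← this, RingHom.comp_apply, h0, map_zero]

/-- The linear coefficient of the chart polynomial in the last fibre coordinate. -/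
noncomputable def chartLinear (A : Fin 4 → Fin 4 → MvPolynomial (Fin 4) ℂ) :
    MvPolynomial (Fin 4) ℂ :=
  ∑ i, (dehomBase (A i 3) + dehomBase (A 3 i)) * ![1, X 2, X 3, 0] i

/-- The constant coefficient of the chart polynomial in the last fibre coordinate. -/
noncomputable def chartConst (A : Fin 4 → Fin 4 → MvPolynomial (Fin 4) ℂ) :
    MvPolynomial (Fin 4) ℂ :=
  ∑ i, ∑ j, dehomBase (A i j) * ![1, X 2, X 3, 0] i * ![1, X 2, X 3, 0] j

theorem chartToPolynomial_chartPoly (A : Fin 4 → Fin 4 → MvPolynomial (Fin 4) ℂ) :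
    chartToPolynomial (p1p1BundleChartPoly A) =
      Polynomial.C (dehomBase (A 3 3)) * Polynomial.X ^ 2 +
        Polynomial.C (chartLinear A) * Polynomial.X + Polynomial.C (chartConst A) := by
  simp only [p1p1BundleChartPoly, map_mul, chartToPolynomial_dehomP1P1, chartLinear, chartConst,
    Fin.sum_univ_four, map_add]
  simp [chartToPolynomial]
  ring

theorem natDegree_chartToPolynomial_chartPoly {A : Fin 4 → Fin 4 → MvPolynomial (Fin 4) ℂ}
    (hA : dehomBase (A 3 3) ≠ 0) :
    (chartToPolynomial (p1p1BundleChartPoly A)).natDegree = 2 := by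
  rw [chartToPolynomial_chartPoly]
  exact Polynomial.natDegree_quadratic hA

/-- The quotient map to the chart ring. -/
noncomputable def chartMk (A : Fin 4 → Fin 4 → MvPolynomial (Fin 4) ℂ) :
    MvPolynomial (Fin 5) ℂ →+* p1p1BundleChartRing A :=
  Ideal.Quotient.mk _

theorem chartMk_eq_zero_iff (A : Fin 4 → Fin 4 → MvPolynomial (Fin 4) ℂ)
    {p : MvPolynomial (Fin 5) ℂ} : chartMk A p = 0 ↔ p1p1BundleChartPoly A ∣ p :=
  Ideal.Quotient.eq_zero_iff_mem.trans Ideal.mem_span_singleton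

theorem chartMk_surjective (A : Fin 4 → Fin 4 → MvPolynomial (Fin 4) ℂ) :
    Function.Surjective (chartMk A) :=
  Ideal.Quotient.mk_surjective

/-- A chart polynomial of degree at most one in the last fibre coordinate does not vanish in the
chart ring. -/
theorem chartMk_ne_zero {A : Fin 4 → Fin 4 → MvPolynomial (Fin 4) ℂ}
    (hA : dehomBase (A 3 3) ≠ 0) {p : MvPolynomial (Fin 5) ℂ} (hp : chartToPolynomial p ≠ 0)
    (hdeg : (chartToPolynomial p).natDegree < 2) :
    chartMk A p ≠ 0 := by
  intro h
  rw [chartMk_eq_zero_iff] at h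
  obtain ⟨g, rfl⟩ := h
  rw [map_mul] at hp hdeg
  rw [Polynomial.natDegree_mul (left_ne_zero_of_mul hp) (right_ne_zero_of_mul hp),
    natDegree_chartToPolynomial_chartPoly hA] at hdeg
  omega

/-- The base coordinates and the first two fibre coordinates are independent in the chart ring. -/
noncomputable def chartRingHom (A : Fin 4 → Fin 4 → MvPolynomial (Fin 4) ℂ) :
    MvPolynomial (Fin 4) ℂ →+* p1p1BundleChartRing A :=
  (chartMk A).comp (rename Fin.castSucc).toRingHom

theorem chartRingHom_injective {A : Fin 4 → Fin 4 → MvPolynomial (Fin 4) ℂ}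
    (hA : dehomBase (A 3 3) ≠ 0) : Function.Injective (chartRingHom A) := by
  rw [injective_iff_map_eq_zero]
  intro p hp
  by_contra h0
  refine chartMk_ne_zero hA (p := rename Fin.castSucc p) ?_ ?_ hp
  · rwa [chartToPolynomial_rename, Polynomial.C_ne_zero]
  · rw [chartToPolynomial_rename, Polynomial.natDegree_C]
    norm_num

/-- The homogeneous fibre coordinates in the chart ring. -/
noncomputable def chartCoord (A : Fin 4 → Fin 4 → MvPolynomial (Fin 4) ℂ) (i : Fin 4) :
    p1p1BundleChartRing A :=
  chartMk A (![1, X 2, X 3, X 4] i)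

theorem chartCoord_ne_zero {A : Fin 4 → Fin 4 → MvPolynomial (Fin 4) ℂ}
    (hA : dehomBase (A 3 3) ≠ 0) : chartCoord A 3 ≠ 0 :=
  chartMk_ne_zero hA (p := X 4) (by simp [chartToPolynomial])
    (by simp [chartToPolynomial])

theorem sum_chartCoord (A : Fin 4 → Fin 4 → MvPolynomial (Fin 4) ℂ) :
    ∑ i, ∑ j, chartRingHom A (dehomBase (A i j)) * chartCoord A i * chartCoord A j = 0 := by
  have h2 : (rename Fin.castSucc).toRingHom.comp dehomBase = dehomP1P1 := by
    refine MvPolynomial.ringHom_ext (fun c => ?_) fun i => ?_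
    · simp [dehomBase, dehomP1P1]
    · fin_cases i <;> simp [dehomBase, dehomP1P1]
  have h := (chartMk_eq_zero_iff A).2 dvd_rfl
  rw [← h]
  simp only [p1p1BundleChartPoly, ← h2, map_sum, map_mul]
  rfl

theorem chartRing_closure_eq_top {A : Fin 4 → Fin 4 → MvPolynomial (Fin 4) ℂ} {E : Type} [Field E]
    {m : ℕ} (ψ : MvPolynomial (Fin m) (p1p1BundleChartRing A) →+* E) {S : Subfield E}
    (hC : ∀ c, ψ (C (chartRingHom A (C c))) ∈ S) (hx : ψ (C (chartRingHom A (X 0))) ∈ S)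
    (hy : ψ (C (chartRingHom A (X 1))) ∈ S) (hz : ∀ i, ψ (C (chartCoord A i)) ∈ S)
    (hs : ∀ i, ψ (X i) ∈ S) (p) : ψ p ∈ S := by
  have hR : ∀ a : p1p1BundleChartRing A, ψ (C a) ∈ S := by
    intro a
    obtain ⟨p, rfl⟩ := chartMk_surjective A a
    induction p using MvPolynomial.induction_on with
    | C c => simpa [chartRingHom] using hC c
    | add p q hp hq => simpa only [map_add] using add_mem hp hq
    | mul_X p i hp =>
      rw [map_mul, map_mul, map_mul]
      refine mul_mem hp ?_
      fin_cases i
      · simpa [chartRingHom] using hx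
      · simpa [chartRingHom] using hy
      · exact hz 1
      · exact hz 2
      · exact hz 3
  induction p using MvPolynomial.induction_on with
  | C a => exact hR a
  | add p q hp hq => rw [map_add]; exact add_mem hp hq
  | mul_X p i hp => rw [map_mul]; exact mul_mem hp (hs i)

end ChartRing

section StableCoordinates

open MvPolynomial

/-- A stably rational chart ring embeds in a rational function field. -/
theorem exists_embedding_of_isStablyRational {A : Fin 4 → Fin 4 → MvPolynomial (Fin 4) ℂ}
    (h : IsStablyRationalFunctionField (p1p1BundleFFMap A)) :
    ∃ (m n : ℕ) (ψ : MvPolynomial (Fin m) (p1p1BundleChartRing A) →+* ratFuncField ℂ n),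
      Function.Injective ψ ∧ (∀ c, ψ (C (chartRingHom A (C c))) = ratFuncFieldMap ℂ n c) ∧
      Subfield.closure (Set.range ψ) = ⊤ := by
  obtain ⟨m, n, e, he⟩ := h
  let F := FractionRing (p1p1BundleChartRing A)
  let ι : MvPolynomial (Fin m) F →+* ratFuncField ℂ n :=
    (e : FractionRing (MvPolynomial (Fin m) F) →+* ratFuncField ℂ n).comp (algebraMap _ _)
  have hι : Function.Injective ι := e.injective.comp (IsFractionRing.injective _ _)
  let ψ := ι.comp (map (algebraMap (p1p1BundleChartRing A) F))
  have hψ : Function.Injective ψ :=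
    hι.comp (map_injective _ (IsFractionRing.injective _ _))
  have : Nontrivial (p1p1BundleChartRing A) :=
    ((ψ.comp C).domain_nontrivial)
  have : Nontrivial (MvPolynomial (Fin m) F) := ι.domain_nontrivial
  refine ⟨m, n, ψ, hψ, ?_, ?_⟩
  · intro c
    have h1 : chartRingHom A (C c) = chartMk A (C c) := congrArg (chartMk A) (rename_C _ c)
    rw [← he, h1]
    exact congrArg ι (map_C _ _)
  · rw [eq_top_iff]
    intro a _
    have hF : ∀ a : F, ι (C a) ∈ Subfield.closure (Set.range ψ) := by
      intro a
      obtain ⟨⟨x, s⟩, hx⟩ := IsLocalization.surj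
        (nonZeroDivisors (p1p1BundleChartRing A)) a
      have h1 : ι (C a) * ψ (C s) = ψ (C x) := by
        simp only [ψ, RingHom.comp_apply, map_C, ← map_mul]
        rw [hx]
      have h2 : ψ (C (s : p1p1BundleChartRing A)) ≠ 0 :=
        fun h0 => nonZeroDivisors.coe_ne_zero s
          (C_injective _ _ (hψ (by rw [h0, C_0, map_zero])))
      rw [← eq_div_iff h2] at h1
      rw [h1]
      exact div_mem (Subfield.subset_closure ⟨_, rfl⟩) (Subfield.subset_closure ⟨_, rfl⟩)
    have hmv : ∀ p, ι p ∈ Subfield.closure (Set.range ψ) := by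
      intro p
      induction p using MvPolynomial.induction_on with
      | C a => exact hF a
      | add p q hp hq => rw [map_add]; exact add_mem hp hq
      | mul_X p i hp =>
        rw [map_mul]
        exact mul_mem hp (Subfield.subset_closure ⟨X i, by simp [ψ]⟩)
    obtain ⟨⟨x, s⟩, hx⟩ := IsLocalization.surj
      (nonZeroDivisors (MvPolynomial (Fin m) F)) (e.symm a)
    have h1 : a * ι s = ι x := by
      simpa [ι] using congrArg e hx
    have h2 : ι s ≠ 0 :=
      fun h0 => nonZeroDivisors.coe_ne_zero s (hι (by rw [h0, map_zero]))
    rw [← eq_div_iff h2] at h1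
    rw [h1]
    exact div_mem (hmv _) (hmv _)

/-- Coordinates on a stably rational quadric bundle, dehomogenised at the last fibre coordinate and
with the other three fibre coordinates permuted. -/
theorem exists_stable_coordinates {A : Fin 4 → Fin 4 → MvPolynomial (Fin 4) ℂ}
    (hA : ∀ i, eval ![1, 0, 1, 0] (A i i) ≠ 0) {E : Type} [Field E] {m : ℕ}
    {ψ : MvPolynomial (Fin m) (p1p1BundleChartRing A) →+* E} (hψ : Function.Injective ψ)
    (htop : Subfield.closure (Set.range ψ) = ⊤) {ι : ℂ →+* E}
    (hι : ∀ c, ψ (C (chartRingHom A (C c))) = ι c) (τ : Equiv.Perm (Fin 4)) (hτ : τ 3 = 3) :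
    ∃ (J : MvPolynomial (Fin m ⊕ Fin 4) ℂ →+* E) (r : Fin 4 → E), Function.Injective J ∧
      (∀ c, J (C c) = ι c) ∧ J (X (.inr 2)) = r 1 ∧ J (X (.inr 3)) = r 2 ∧ r 3 = 1 ∧
      ∑ i, ∑ j, (A (τ i) (τ j)).eval₂ ι ![1, J (X (.inr 0)), 1, J (X (.inr 1))] * r i * r j = 0 ∧
      Subfield.closure (Set.range J ∪ {r 0}) = ⊤ := by
  have h33 : dehomBase (A 3 3) ≠ 0 := dehomBase_ne_zero (hA 3)
  let φ : p1p1BundleChartRing A →+* E := ψ.comp C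
  have hφ : Function.Injective φ := hψ.comp (C_injective _ _)
  let z : Fin 4 → E := fun i => φ (chartCoord A i)
  have hz3 : z 3 ≠ 0 := fun h => chartCoord_ne_zero h33 (hφ (by rw [map_zero]; exact h))
  let r : Fin 4 → E := fun i => z (τ i) / z 3
  let x : E := φ (chartRingHom A (X 0))
  let y : E := φ (chartRingHom A (X 1))
  let J : MvPolynomial (Fin m ⊕ Fin 4) ℂ →+* E :=
    eval₂Hom ι (Sum.elim (fun i => ψ (X i)) ![x, y, r 1, r 2])
  let I : MvPolynomial (Fin m ⊕ Fin 4) ℂ →+* E :=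
    (ψ.comp (map (chartRingHom A))).comp (sumAlgEquiv ℂ (Fin m) (Fin 4)).toRingHom
  have hI : Function.Injective I :=
    (hψ.comp (map_injective _ (chartRingHom_injective h33))).comp (AlgEquiv.injective _)
  have hIC : ∀ c, I (C c) = ι c := fun c => by
    rw [← hι]
    simp [I]
  have hJx : J (X (.inr 0)) = x := by simp [J]
  have hJy : J (X (.inr 1)) = y := by simp [J]
  have hJC : ∀ c, J (C c) = ι c := fun c => by simp [J]
  have hev : ∀ p, φ (chartRingHom A (dehomBase p)) = p.eval₂ ι ![1, x, 1, y] := by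
    intro p
    refine congrArg (fun f : MvPolynomial (Fin 4) ℂ →+* E => f p) (MvPolynomial.ringHom_ext
      (f := (φ.comp (chartRingHom A)).comp dehomBase) (g := eval₂Hom ι ![1, x, 1, y])
      (fun c => ?_) fun i => ?_)
    · simpa [dehomBase, φ] using hι c
    · fin_cases i <;> simp [dehomBase, x, y]
  have hsum : ∑ i, ∑ j, (A i j).eval₂ ι ![1, x, 1, y] * z i * z j = 0 := by
    have := congrArg φ (sum_chartCoord A)
    simpa only [map_sum, map_mul, hev, map_zero] using this
  have hsumr : ∑ i, ∑ j, (A (τ i) (τ j)).eval₂ ι ![1, x, 1, y] * r i * r j = 0 := by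
    have h1 : ∑ i, ∑ j, (A (τ i) (τ j)).eval₂ ι ![1, x, 1, y] * z (τ i) * z (τ j) = 0 := by
      rw [← hsum, ← Equiv.sum_comp τ fun i => ∑ j, (A i j).eval₂ ι ![1, x, 1, y] * z i * z j]
      exact Finset.sum_congr rfl fun i _ => Equiv.sum_comp τ fun j =>
        (A (τ i) j).eval₂ ι ![1, x, 1, y] * z (τ i) * z j
    rw [← mul_zero ((z 3)⁻¹ ^ 2), ← h1, Finset.mul_sum]
    refine Finset.sum_congr rfl fun i _ => ?_
    rw [Finset.mul_sum]
    refine Finset.sum_congr rfl fun j _ => ?_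
    simp only [r, div_eq_mul_inv]
    ring
  have hr3 : r 3 = 1 := by simp only [r, hτ]; exact div_self hz3
  have htop' : Subfield.closure (Set.range J ∪ {r 0}) = ⊤ := by
    have hJm : ∀ p, J p ∈ Subfield.closure (Set.range J ∪ {r 0}) := fun p =>
      Subfield.subset_closure (Or.inl ⟨p, rfl⟩)
    have hr : ∀ i, r i ∈ Subfield.closure (Set.range J ∪ {r 0}) := by
      intro i
      fin_cases i
      · exact Subfield.subset_closure (Or.inr rfl)
      · simpa [J] using hJm (X (.inr 2))
      · simpa [J] using hJm (X (.inr 3))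
      · exact hr3.symm ▸ one_mem _
    have hz : ∀ i, z i ∈ Subfield.closure (Set.range J ∪ {r 0}) := by
      have h3 : z 3 ∈ Subfield.closure (Set.range J ∪ {r 0}) := by
        have h0 := hr (τ.symm 0)
        have hz0 : z 0 = 1 := by simp [z, chartCoord]
        simp only [r, Equiv.apply_symm_apply, hz0, one_div] at h0
        simpa using inv_mem h0
      intro i
      have := mul_mem (hr (τ.symm i)) h3
      simpa only [r, Equiv.apply_symm_apply, div_mul_cancel₀ _ hz3] using this
    rw [eq_top_iff, ← htop, Subfield.closure_le]
    rintro _ ⟨p, rfl⟩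
    refine chartRing_closure_eq_top ψ (fun c => ?_) ?_ ?_ hz (fun i => ?_) p
    · rw [hι, ← hJC]
      exact hJm _
    · exact Set.mem_of_eq_of_mem hJx.symm (hJm _)
    · exact Set.mem_of_eq_of_mem hJy.symm (hJm _)
    · simpa [J] using hJm (X (.inl i))
  refine ⟨J, r, ?_, hJC, by simp [J], by simp [J], hr3, by rw [hJx, hJy]; exact hsumr, htop'⟩
  let a : Fin 4 → Fin 4 → MvPolynomial (Fin m ⊕ Fin 4) ℂ := fun i j =>
    (A (τ i) (τ j)).eval₂ C ![1, X (.inr 0), 1, X (.inr 1)]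
  have ha : ∀ G : MvPolynomial (Fin m ⊕ Fin 4) ℂ →+* E, (∀ c, G (C c) = ι c) →
      G (X (.inr 0)) = x → G (X (.inr 1)) = y → ∀ i j,
      G (a i j) = (A (τ i) (τ j)).eval₂ ι ![1, x, 1, y] := by
    intro G hC hx hy i j
    simp only [a]
    rw [hom_eval₂, show G.comp C = ι from RingHom.ext hC]
    congr 1
    ext i
    fin_cases i <;> simp [hx, hy]
  let w : Fin 4 → MvPolynomial (Fin m ⊕ Fin 4) ℂ := ![0, X (.inr 2), X (.inr 3), 1]
  have hw : ∀ i, J (w i) = if i = 0 then 0 else r i := by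
    intro i
    fin_cases i <;> simp [w, J, hr3]
  refine MvPolynomial.injective_of_closure_eq_top hI (r := r 0) (a := a 0 0)
    (b := ∑ i, (a 0 i + a i 0) * w i) (c := ∑ i, ∑ j, a i j * w i * w j) ?_ ?_ ?_ htop'
  · exact RingHom.ext fun c => (hIC c).trans (hJC c).symm
  · rw [ha J hJC hJx hJy, ← hev, map_ne_zero_iff _ hφ,
      map_ne_zero_iff _ (chartRingHom_injective h33)]
    exact dehomBase_ne_zero (hA _)
  · rw [← hsumr]
    simp only [map_mul, map_add, ha J hJC hJx hJy, hw, Fin.sum_univ_four, hr3]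
    simp
    ring

end StableCoordinates

section GenericLine

open MvPolynomial

variable {K E : Type} [Field K] [Field E] {n : ℕ}

/-- Restriction to the line through the generic point with constant direction `c`. -/
noncomputable def genericLine (T : MvPolynomial (Fin n) K →+* E) (c : Fin n → K) :
    MvPolynomial (Fin n) K →+* Polynomial E :=
  eval₂Hom (Polynomial.C.comp (T.comp C))
    fun i => Polynomial.C (T (X i)) + Polynomial.C (T (C (c i))) * Polynomial.X

theorem genericLine_C (T : MvPolynomial (Fin n) K →+* E) (c : Fin n → K) (a : K) :
    genericLine T c (C a) = Polynomial.C (T (C a)) := by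
  simp [genericLine]

theorem genericLine_X (T : MvPolynomial (Fin n) K →+* E) (c : Fin n → K) (i : Fin n) :
    genericLine T c (X i) =
      Polynomial.C (T (X i)) + Polynomial.C (T (C (c i))) * Polynomial.X := by
  simp [genericLine]

theorem coeff_zero_genericLine (T : MvPolynomial (Fin n) K →+* E) (c : Fin n → K)
    (p : MvPolynomial (Fin n) K) : (genericLine T c p).coeff 0 = T p := by
  refine congrArg (fun f : MvPolynomial (Fin n) K →+* E => f p) (MvPolynomial.ringHom_ext
    (f := Polynomial.constantCoeff.comp (genericLine T c)) (g := T) (fun a => ?_) fun i => ?_)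
  · simp [genericLine_C]
  · simp [genericLine_X]

theorem genericLine_injective {T : MvPolynomial (Fin n) K →+* E} (hT : Function.Injective T)
    (c : Fin n → K) : Function.Injective (genericLine T c) := by
  rw [injective_iff_map_eq_zero]
  intro p hp
  apply hT
  rw [← coeff_zero_genericLine T c, hp, map_zero, Polynomial.coeff_zero]

theorem genericLine_monomial (T : MvPolynomial (Fin n) K →+* E) (c : Fin n → K) (s : Fin n →₀ ℕ)
    (a : K) : ∃ N, (monomial s a).IsHomogeneous N ∧
      (genericLine T c (monomial s a)).natDegree ≤ N ∧
      (genericLine T c (monomial s a)).coeff N = T (C (eval c (monomial s a))) := by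
  refine induction_on_monomial (motive := fun p => ∃ N, p.IsHomogeneous N ∧
      (genericLine T c p).natDegree ≤ N ∧
      (genericLine T c p).coeff N = T (C (eval c p))) (fun a => ?_) ?_ s a
  · exact ⟨0, isHomogeneous_C _ _, by simp [genericLine_C], by simp [genericLine_C]⟩
  rintro p i ⟨N, h0, h1, h2⟩
  have h3 : (genericLine T c (X i)).natDegree ≤ 1 := by
    rw [genericLine_X, add_comm]
    exact Polynomial.natDegree_linear_le
  refine ⟨N + 1, h0.mul (isHomogeneous_X _ _), ?_, ?_⟩
  · rw [map_mul]
    exact Polynomial.natDegree_mul_le.trans (add_le_add h1 h3)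
  · rw [map_mul, Polynomial.coeff_mul_add_eq_of_natDegree_le h1 h3, h2]
    simp [genericLine_X]

theorem genericLine_coeff_totalDegree (T : MvPolynomial (Fin n) K →+* E) (c : Fin n → K)
    {p : MvPolynomial (Fin n) K} {N : ℕ} (hp : p.totalDegree ≤ N) :
    (genericLine T c p).natDegree ≤ N ∧
      (genericLine T c p).coeff N = T (C (eval c (homogeneousComponent N p))) := by
  have key : ∀ s ∈ p.support, (genericLine T c (monomial s (p.coeff s))).natDegree ≤ N ∧
      (genericLine T c (monomial s (p.coeff s))).coeff N =
        T (C (eval c (homogeneousComponent N (monomial s (p.coeff s))))) := by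
    intro s hs
    have hne : monomial s (p.coeff s) ≠ 0 := by
      rw [Ne, monomial_eq_zero]
      exact mem_support_iff.1 hs
    obtain ⟨M, h0, h1, h2⟩ := genericLine_monomial T c s (p.coeff s)
    have hMN : M ≤ N := by
      rw [← h0.totalDegree hne]
      refine (le_trans ?_ hp)
      rw [totalDegree_monomial _ (mem_support_iff.1 hs)]
      exact le_totalDegree hs
    refine ⟨h1.trans hMN, ?_⟩
    rw [homogeneousComponent_of_mem h0]
    split_ifs with h
    · rw [h, h2]
    · rw [Polynomial.coeff_eq_zero_of_natDegree_lt (lt_of_le_of_lt h1 (lt_of_le_of_ne hMN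
        (Ne.symm h)))]
      simp
  have hsum := p.support_sum_monomial_coeff
  constructor
  · rw [← hsum, map_sum]
    exact Polynomial.natDegree_sum_le_of_forall_le _ _ fun s hs => (key s hs).1
  · conv_lhs => rw [← hsum]
    conv_rhs => rw [← hsum]
    rw [map_sum, Polynomial.finsetSum_coeff, map_sum, map_sum, map_sum, map_sum]
    exact Finset.sum_congr rfl fun s hs => (key s hs).2

/-- In a generic direction, the restriction of finitely many polynomials to a line through the
generic point has constant leading coefficient. -/
theorem exists_genericLine [Infinite K] {T : MvPolynomial (Fin n) K →+* E}
    (hT : Function.Injective T) {ι : Type} [Fintype ι] (p : ι → MvPolynomial (Fin n) K) :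
    ∃ c, ∀ i, ∃ a, (genericLine T c (p i)).leadingCoeff = T (C a) := by
  classical
  have hQ : (∏ i, if p i = 0 then 1 else homogeneousComponent (p i).totalDegree (p i)) ≠ 0 := by
    rw [Finset.prod_ne_zero_iff]
    intro i _
    split_ifs with h
    · exact one_ne_zero
    · obtain ⟨s, hs, hd⟩ := Finset.exists_mem_eq_sup (p i).support (support_nonempty.2 h)
        fun s => s.sum fun _ e => e
      intro h0
      have h1 := congrArg (coeff s) h0
      rw [coeff_homogeneousComponent,
        if_pos (show s.degree = (p i).totalDegree from hd.symm), coeff_zero] at h1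
      exact mem_support_iff.1 hs h1
  obtain ⟨c, hc⟩ : ∃ c, eval c (∏ i, if p i = 0 then 1 else
      homogeneousComponent (p i).totalDegree (p i)) ≠ 0 := by
    by_contra! h
    exact hQ (MvPolynomial.funext fun c => by rw [h, map_zero])
  refine ⟨c, fun i => ?_⟩
  by_cases hi : p i = 0
  · exact ⟨0, by simp [hi]⟩
  rw [map_prod, Finset.prod_ne_zero_iff] at hc
  have hci := hc i (Finset.mem_univ i)
  rw [if_neg hi] at hci
  obtain ⟨h1, h2⟩ := genericLine_coeff_totalDegree T c (le_refl (p i).totalDegree)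
  refine ⟨eval c (homogeneousComponent (p i).totalDegree (p i)), ?_⟩
  rw [← h2, Polynomial.leadingCoeff, le_antisymm h1 (Polynomial.le_natDegree_of_ne_zero ?_)]
  rw [h2, map_ne_zero_iff _ hT, Ne, C_eq_zero]
  exact hci

/-- Through the generic point of a quadric bundle over a field of rational functions there is a
rational curve whose base coordinates have constant leading coefficients. -/
theorem ReducesToSpecial.exists_curve [Infinite K] [Algebra (MvPolynomial (Fin n) K) E]
    [IsFractionRing (MvPolynomial (Fin n) K) E] {V : ValuationSubring K} {D F : Fin 4 → ℕ}
    {A : Fin 4 → Fin 4 → MvPolynomial (Fin 4) V} (h : ReducesToSpecial D F A)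
    (x y : E) {ζ : Fin 4 → E} (hζ : ∃ i, ζ i ≠ 0)
    (hsum : ∑ i, ∑ j, (A i j).eval₂
      (((algebraMap (MvPolynomial (Fin n) K) E).comp C).comp V.subtype) ![1, x, 1, y] *
      ζ i * ζ j = 0) :
    ∃ P Z : Fin 4 → Polynomial E, (∃ i, Z i ≠ 0) ∧
      ∑ i, ∑ j, (A i j).eval₂ (Polynomial.C.comp
        (((algebraMap (MvPolynomial (Fin n) K) E).comp C).comp V.subtype)) P * Z i * Z j = 0 ∧
      (P 0).coeff 0 ≠ 0 ∧ (P 2).coeff 0 ≠ 0 ∧ (P 1).coeff 0 = x * (P 0).coeff 0 ∧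
      (P 3).coeff 0 = y * (P 2).coeff 0 ∧
      ∀ p, ∃ c : K, (P p).leadingCoeff = algebraMap (MvPolynomial (Fin n) K) E (C c) := by
  set T := algebraMap (MvPolynomial (Fin n) K) E with hTdef
  have hT : Function.Injective T := IsFractionRing.injective _ _
  obtain ⟨⟨x₁, x₀⟩, hx⟩ := IsLocalization.surj (nonZeroDivisors (MvPolynomial (Fin n) K)) x
  obtain ⟨⟨y₁, y₀⟩, hy⟩ := IsLocalization.surj (nonZeroDivisors (MvPolynomial (Fin n) K)) y
  have hx₀ : (x₀ : MvPolynomial (Fin n) K) ≠ 0 := nonZeroDivisors.coe_ne_zero x₀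
  have hy₀ : (y₀ : MvPolynomial (Fin n) K) ≠ 0 := nonZeroDivisors.coe_ne_zero y₀
  obtain ⟨b, hb⟩ := IsLocalization.exist_integer_multiples_of_finite
    (nonZeroDivisors (MvPolynomial (Fin n) K)) ζ
  have hb0 : (b : MvPolynomial (Fin n) K) ≠ 0 := nonZeroDivisors.coe_ne_zero b
  choose z hz using hb
  have hz' : ∀ i, T (z i) = T b * ζ i := fun i => (hz i).trans (Algebra.smul_def _ _)
  obtain ⟨k, l, hkl⟩ := h.scale ((T.comp C).comp V.subtype) ![1, x, 1, y] (T x₀) (T y₀)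
  let p : Fin 4 → MvPolynomial (Fin n) K := ![x₀, x₁, y₀, y₁]
  let w : Fin 4 → MvPolynomial (Fin n) K := fun i => x₀ ^ k i * y₀ ^ l i * z i
  have hpw : ∑ i, ∑ j, (A i j).eval₂ (C.comp V.subtype) p * w i * w j = 0 := by
    apply hT
    rw [map_zero, ← hkl (T b) ζ hsum]
    simp only [map_sum, map_mul, hom_eval₂]
    refine Finset.sum_congr rfl fun i _ => Finset.sum_congr rfl fun j _ => ?_
    congr 1
    · congr 1
      · rw [RingHom.comp_assoc]
        congr 1
        ext q
        fin_cases q <;> simp [p, ← hx, ← hy, hTdef, mul_comm]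
      · simp only [w, map_mul, map_pow, hz']
        ring
    · simp only [w, map_mul, map_pow, hz']
      ring
  obtain ⟨c, hc⟩ := exists_genericLine hT p
  refine ⟨fun q => genericLine T c (p q), fun i => genericLine T c (w i), ?_, ?_, ?_, ?_, ?_, ?_,
    hc⟩
  · obtain ⟨i, hi⟩ := hζ
    refine ⟨i, (map_ne_zero_iff _ (genericLine_injective hT c)).2 ?_⟩
    refine mul_ne_zero (mul_ne_zero (pow_ne_zero _ hx₀) (pow_ne_zero _ hy₀)) ?_
    intro h0
    have := hz' i
    rw [h0, map_zero, eq_comm, mul_eq_zero, map_eq_zero_iff _ hT] at this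
    exact this.elim hb0 hi
  · have := congrArg (genericLine T c) hpw
    simp only [map_sum, map_mul, hom_eval₂, map_zero] at this
    rw [← this]
    refine Finset.sum_congr rfl fun i _ => Finset.sum_congr rfl fun j _ => ?_
    rw [show (genericLine T c).comp (C.comp V.subtype) =
      Polynomial.C.comp ((T.comp C).comp V.subtype) from
      RingHom.ext fun a => genericLine_C T c a]
  · rw [coeff_zero_genericLine]
    exact (map_ne_zero_iff _ hT).2 hx₀
  · rw [coeff_zero_genericLine]
    exact (map_ne_zero_iff _ hT).2 hy₀
  · rw [coeff_zero_genericLine, coeff_zero_genericLine]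
    exact hx.symm
  · rw [coeff_zero_genericLine, coeff_zero_genericLine]
    exact hy.symm

end GenericLine

section VeryGeneral

open MvPolynomial

/-- Independent linear coordinates of a very general parameter are algebraically independent
over `ℚ`. -/
theorem veryGeneral_of_algebraicIndependent {P T : Type} [AddCommGroup P] [Module ℂ P] [Countable T]
    (l : T → P →ₗ[ℂ] ℂ)
    (hl : ∀ (n : ℕ) (f : Fin n → T), Function.Injective f → ∀ a : Fin n → ℂ,
      ∃ p, ∀ k, l (f k) p = a k)
    {Q : P → Prop} (hQ : ∀ p, AlgebraicIndependent ℚ (fun t => l t p) → Q p) :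
    VeryGeneral Q := by
  let F : MvPolynomial T ℚ → P → ℂ := fun G p => aeval (fun t => l t p) G
  have : Countable (MvPolynomial T ℚ) := by
    rw [← Cardinal.mk_le_aleph0_iff]
    exact cardinalMk_le_max.trans (by simp)
  refine ⟨F '' {0}ᶜ, (Set.to_countable _).image _, ?_, fun p hp => hQ p ?_⟩
  · rintro _ ⟨G, hG, rfl⟩
    obtain ⟨n, f, hf, q, rfl⟩ := exists_fin_rename G
    refine ⟨⟨n, fun k => l (f k), map (algebraMap ℚ ℂ) q, fun p => ?_⟩, ?_⟩
    · simp only [F, eval_map, aeval_def, eval₂_rename]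
      rfl
    · intro h0
      have hq : q ≠ 0 := by
        rintro rfl
        exact hG (map_zero _)
      have hq' : map (algebraMap ℚ ℂ) q ≠ 0 := by
        rwa [Ne, map_eq_zero_iff _ (map_injective _ (algebraMap ℚ ℂ).injective)]
      obtain ⟨a, ha⟩ : ∃ a, eval a (map (algebraMap ℚ ℂ) q) ≠ 0 := by
        by_contra! h
        exact hq' (MvPolynomial.funext fun a => by rw [h, map_zero])
      obtain ⟨p, hp⟩ := hl n f hf a
      apply ha
      have := congrFun h0 p
      simp only [F, Pi.zero_apply, aeval_def, eval₂_rename] at this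
      rw [eval_map, ← this, ← _root_.funext hp]
      rfl
  · refine (injective_iff_map_eq_zero _).2 ?_
    intro G hG
    by_contra h0
    exact hp _ ⟨G, h0, rfl⟩ hG

/-- Algebraically independent elements of a field can be specialised to arbitrary integers by a
valuation ring of residue characteristic zero. -/
theorem exists_valuationSubring_specialization {K T : Type} [Field K] [Algebra ℚ K] {v : T → K}
    (hv : AlgebraicIndependent ℚ v) (a : T → ℤ) :
    ∃ (V : ValuationSubring K) (hm : ∀ t, v t ∈ V), CharZero (IsLocalRing.ResidueField V) ∧
      ∀ t, IsLocalRing.residue V ⟨v t, hm t⟩ = (a t : IsLocalRing.ResidueField V) := by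
  let φ : MvPolynomial T ℚ →+* ℚ := eval fun t => (a t : ℚ)
  let S : Subring K := (Algebra.adjoin ℚ (Set.range v)).toSubring
  let e : S →+* MvPolynomial T ℚ := (hv.aevalEquiv.symm : _ →+* _)
  have he : ∀ t (ht : v t ∈ S), e ⟨v t, ht⟩ = X t := by
    intro t ht
    have : hv.aevalEquiv (X t) = ⟨v t, ht⟩ := Subtype.ext (by simp)
    exact (hv.aevalEquiv.symm_apply_eq).2 this.symm
  have hmem : ∀ t, v t ∈ S := fun t => Algebra.subset_adjoin ⟨t, rfl⟩
  obtain ⟨V, hSV, hI⟩ := Ideal.image_subset_nonunits_valuationSubring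
    (RingHom.ker (φ.comp e)) (RingHom.ker_ne_top _)
  refine ⟨V, fun t => hSV (hmem t), ?_, fun t => ?_⟩
  · refine charZero_of_inj_zero fun p h0 => ?_
    by_contra hp
    have h1 : ((p : ℚ)⁻¹ : ℚ) • (1 : K) ∈ S :=
      (Algebra.adjoin ℚ (Set.range v)).smul_mem (one_mem _) _
    have h2 : (p : V) * ⟨_, hSV h1⟩ = 1 := by
      apply Subtype.ext
      have hp0 : (p : ℚ) ≠ 0 := by exact_mod_cast hp
      change (p : K) * ((p : ℚ)⁻¹ • (1 : K)) = 1
      rw [Algebra.smul_def, mul_one, ← map_natCast (algebraMap ℚ K), ← map_mul,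
        mul_inv_cancel₀ hp0, map_one]
    have h3 := congrArg (IsLocalRing.residue V) h2
    rw [map_mul, map_natCast, h0, zero_mul, map_one] at h3
    exact zero_ne_one h3
  · rw [← map_intCast (IsLocalRing.residue V), ← sub_eq_zero, ← map_sub,
      IsLocalRing.residue_eq_zero_iff]
    have h4 : v t - a t ∈ V.nonunits := by
      apply hI
      refine ⟨⟨v t, hmem t⟩ - (a t : S), ?_, by simp⟩
      change φ (e _) = 0
      rw [map_sub, he, map_intCast, map_sub, map_intCast]
      simp [φ]
    obtain ⟨h5, h6⟩ := V.mem_nonunits_iff_exists_mem_maximalIdeal.1 h4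
    convert h6
    simp

end VeryGeneral

section Specialization

open MvPolynomial

theorem specialDiag_homogeneous₁ {R : Type} [CommRing R] {D E : Fin 4 → ℕ} (h : SpecialDegrees D E)
    (r : Fin 4) : (specialDiag D E (X 0) (X 1) (X 2) (X 3) r :
      MvPolynomial (Fin 4) R).IsWeightedHomogeneous p1p1Weight1 (D r) := by
  have hX : ∀ i, (X i : MvPolynomial (Fin 4) R).IsWeightedHomogeneous p1p1Weight1
    (p1p1Weight1 i) := fun i => isWeightedHomogeneous_X R _ i
  have h0 := hX 0
  have h1 := hX 1
  have h2 := hX 2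
  have h3 := hX 3
  simp only [p1p1Weight1, Matrix.cons_val] at h0 h1 h2 h3
  change IsWeightedHomogeneous p1p1Weight1 _ _ at h0 h1 h2 h3
  have a1 := h.one_le_D
  have a3 := h.three_le_D
  have hadd : IsWeightedHomogeneous p1p1Weight1 (X 0 + X 1 : MvPolynomial (Fin 4) R) 1 :=
    (weightedHomogeneousSubmodule R p1p1Weight1 1).add_mem h0 h1
  have hadd' : IsWeightedHomogeneous p1p1Weight1 (X 2 + X 3 : MvPolynomial (Fin 4) R) 0 :=
    (weightedHomogeneousSubmodule R p1p1Weight1 0).add_mem h2 h3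
  have hF : IsWeightedHomogeneous p1p1Weight1
      ((X 0 + X 1) ^ 2 * (X 2 + X 3) ^ 2 + X 0 * X 1 * (X 2 * X 3) : MvPolynomial (Fin 4) R) 2 :=
    (weightedHomogeneousSubmodule R p1p1Weight1 2).add_mem
      ((hadd.pow 2).mul (hadd'.pow 2)) ((h0.mul h1).mul (h2.mul h3))
  fin_cases r <;> simp only [specialDiag, Fin.zero_eta, Fin.mk_one, Fin.reduceFinMk,
    Matrix.cons_val]
  · convert (h0.pow (D 0)).mul (h2.pow (E 0)) using 1
    simp
  · convert (h1.mul (h0.pow (D 1 - 1))).mul (h2.pow (E 1)) using 1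
    simp; omega
  · convert (h0.pow (D 2)).mul (h3.mul (h2.pow (E 2 - 1))) using 1
    simp
  · convert (((h1.mul h3).mul hF).mul (h0.pow (D 3 - 3))).mul (h2.pow (E 3 - 3)) using 1
    simp; omega

theorem specialDiag_homogeneous₂ {R : Type} [CommRing R] {D E : Fin 4 → ℕ} (h : SpecialDegrees D E)
    (r : Fin 4) : (specialDiag D E (X 0) (X 1) (X 2) (X 3) r :
      MvPolynomial (Fin 4) R).IsWeightedHomogeneous p1p1Weight2 (E r) := by
  have hX : ∀ i, (X i : MvPolynomial (Fin 4) R).IsWeightedHomogeneous p1p1Weight2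
    (p1p1Weight2 i) := fun i => isWeightedHomogeneous_X R _ i
  have h0 := hX 0
  have h1 := hX 1
  have h2 := hX 2
  have h3 := hX 3
  simp only [p1p1Weight2, Matrix.cons_val] at h0 h1 h2 h3
  change IsWeightedHomogeneous p1p1Weight2 _ _ at h0 h1 h2 h3
  have a1 := h.one_le_E
  have a3 := h.three_le_E
  have hadd : IsWeightedHomogeneous p1p1Weight2 (X 0 + X 1 : MvPolynomial (Fin 4) R) 0 :=
    (weightedHomogeneousSubmodule R p1p1Weight2 0).add_mem h0 h1
  have hadd' : IsWeightedHomogeneous p1p1Weight2 (X 2 + X 3 : MvPolynomial (Fin 4) R) 1 :=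
    (weightedHomogeneousSubmodule R p1p1Weight2 1).add_mem h2 h3
  have hF : IsWeightedHomogeneous p1p1Weight2
      ((X 0 + X 1) ^ 2 * (X 2 + X 3) ^ 2 + X 0 * X 1 * (X 2 * X 3) : MvPolynomial (Fin 4) R) 2 :=
    (weightedHomogeneousSubmodule R p1p1Weight2 2).add_mem
      ((hadd.pow 2).mul (hadd'.pow 2)) ((h0.mul h1).mul (h2.mul h3))
  fin_cases r <;> simp only [specialDiag, Fin.zero_eta, Fin.mk_one, Fin.reduceFinMk,
    Matrix.cons_val]
  · convert (h0.pow (D 0)).mul (h2.pow (E 0)) using 1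
    simp
  · convert (h1.mul (h0.pow (D 1 - 1))).mul (h2.pow (E 1)) using 1
    simp
  · convert (h0.pow (D 2)).mul (h3.mul (h2.pow (E 2 - 1))) using 1
    simp; omega
  · convert (((h1.mul h3).mul hF).mul (h0.pow (D 3 - 3))).mul (h2.pow (E 3 - 3)) using 1
    simp; omega

end Specialization

section Parameters

open MvPolynomial

/-- The parameter space of quadratic forms of type `(dᵢ, eᵢ)`. -/
abbrev QuadricParam (d e : Fin 4 → ℕ) : Type :=
  Π i : Fin 4, Π j : Fin 4,
    ((weightedHomogeneousSubmodule ℂ p1p1Weight1 ((d i + d j) / 2) ⊓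
      weightedHomogeneousSubmodule ℂ p1p1Weight2 ((e i + e j) / 2) :
      Submodule ℂ (MvPolynomial (Fin 4) ℂ)))

/-- The indices of the coefficients of a quadratic form of type `(dᵢ, eᵢ)`. -/
abbrev QuadricIndex (d e : Fin 4 → ℕ) : Type :=
  {t : Fin 4 × Fin 4 × (Fin 4 →₀ ℕ) //
    Finsupp.weight p1p1Weight1 t.2.2 = (d t.1 + d t.2.1) / 2 ∧
    Finsupp.weight p1p1Weight2 t.2.2 = (e t.1 + e t.2.1) / 2}

/-- The coefficient of a quadratic form as a linear function on the parameter space. -/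
noncomputable def quadricCoeff {d e : Fin 4 → ℕ} (t : QuadricIndex d e) :
    QuadricParam d e →ₗ[ℂ] ℂ where
  toFun p := coeff t.1.2.2 (p t.1.1 t.1.2.1 : MvPolynomial (Fin 4) ℂ)
  map_add' p q := by simp
  map_smul' c p := by simp

theorem exists_quadricCoeff_eq {d e : Fin 4 → ℕ} {n : ℕ} {f : Fin n → QuadricIndex d e}
    (hf : Function.Injective f) (a : Fin n → ℂ) : ∃ p, ∀ k, quadricCoeff (f k) p = a k := by
  classical
  refine ⟨fun i j => ⟨∑ k, if (f k).1.1 = i ∧ (f k).1.2.1 = j then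
    monomial (f k).1.2.2 (a k) else 0, Submodule.sum_mem _ fun k _ => ?_⟩, fun k => ?_⟩
  · split_ifs with h
    · obtain ⟨rfl, rfl⟩ := h
      exact ⟨isWeightedHomogeneous_monomial _ _ _ (f k).2.1,
        isWeightedHomogeneous_monomial _ _ _ (f k).2.2⟩
    · exact zero_mem _
  · change coeff _ (∑ l, _) = _
    rw [coeff_sum, Finset.sum_eq_single k]
    · simp
    · intro l _ hlk
      split_ifs with h
      · rw [coeff_monomial, if_neg]
        intro h'
        exact hlk (hf (Subtype.ext (Prod.ext h.1 (Prod.ext h.2 h'))))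
      · exact coeff_zero _
    · simp

theorem quadric_homogeneous₁ {d e : Fin 4 → ℕ} (p : QuadricParam d e) (i j : Fin 4) :
    (p i j : MvPolynomial (Fin 4) ℂ).IsWeightedHomogeneous p1p1Weight1 ((d i + d j) / 2) :=
  (p i j).2.1

theorem quadric_homogeneous₂ {d e : Fin 4 → ℕ} (p : QuadricParam d e) (i j : Fin 4) :
    (p i j : MvPolynomial (Fin 4) ℂ).IsWeightedHomogeneous p1p1Weight2 ((e i + e j) / 2) :=
  (p i j).2.2

theorem coeff_eq_zero_of_index {d e : Fin 4 → ℕ} {R : Type} [CommRing R] {i j : Fin 4}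
    {q : MvPolynomial (Fin 4) R}
    (h₁ : q.IsWeightedHomogeneous p1p1Weight1 ((d i + d j) / 2))
    (h₂ : q.IsWeightedHomogeneous p1p1Weight2 ((e i + e j) / 2)) {s : Fin 4 →₀ ℕ}
    (hs : ¬ (Finsupp.weight p1p1Weight1 s = (d i + d j) / 2 ∧
      Finsupp.weight p1p1Weight2 s = (e i + e j) / 2)) : coeff s q = 0 := by
  by_contra h0
  exact hs ⟨h₁ h0, h₂ h0⟩

/-- A quadratic form with algebraically independent coefficients specialises to the special
diagonal form. -/
theorem exists_reducesToSpecial {d e : Fin 4 → ℕ} {p : QuadricParam d e}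
    (hp : AlgebraicIndependent ℚ fun t => quadricCoeff t p) (τ : Equiv.Perm (Fin 4))
    (hdeg : SpecialDegrees (d ∘ τ) (e ∘ τ)) :
    ∃ (V : ValuationSubring ℂ) (A : Fin 4 → Fin 4 → MvPolynomial (Fin 4) V),
      CharZero (IsLocalRing.ResidueField V) ∧ ReducesToSpecial (d ∘ τ) (e ∘ τ) A ∧
      ∀ i j, map V.subtype (A i j) = p (τ i) (τ j) := by
  classical
  obtain ⟨V, hV, hchar, hres⟩ := exists_valuationSubring_specialization hp fun t =>
    if t.1.1 = t.1.2.1 then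
      coeff t.1.2.2 (specialDiag (d ∘ τ) (e ∘ τ) (X 0) (X 1) (X 2) (X 3) (τ.symm t.1.1)) else 0
  have hA : ∀ i j, ∃ q, map V.subtype q = (p (τ i) (τ j) : MvPolynomial (Fin 4) ℂ) := by
    intro i j
    refine mem_range_map_iff_coeffs_subset.2 fun c hc => ?_
    obtain ⟨s, -, rfl⟩ := mem_coeffs_iff.1 hc
    by_cases hs : Finsupp.weight p1p1Weight1 s = (d (τ i) + d (τ j)) / 2 ∧
      Finsupp.weight p1p1Weight2 s = (e (τ i) + e (τ j)) / 2
    · exact ⟨⟨_, hV ⟨(τ i, τ j, s), hs⟩⟩, rfl⟩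
    · rw [coeff_eq_zero_of_index (quadric_homogeneous₁ p _ _) (quadric_homogeneous₂ p _ _) hs]
      exact ⟨0, rfl⟩
  choose A hA using hA
  have hcoeff : ∀ i j s, ((coeff s (A i j) : V) : ℂ) =
      coeff s (p (τ i) (τ j) : MvPolynomial (Fin 4) ℂ) := by
    intro i j s
    rw [← hA, coeff_map]
    rfl
  refine ⟨V, A, hchar, ⟨hdeg, ?_, ?_, ?_⟩, hA⟩
  · intro i j s hs
    refine quadric_homogeneous₁ p (τ i) (τ j) fun h0 => hs ?_
    rw [← hcoeff] at h0
    exact Subtype.ext h0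
  · intro i j s hs
    refine quadric_homogeneous₂ p (τ i) (τ j) fun h0 => hs ?_
    rw [← hcoeff] at h0
    exact Subtype.ext h0
  · intro i j
    ext s
    rw [coeff_map]
    by_cases hs : Finsupp.weight p1p1Weight1 s = (d (τ i) + d (τ j)) / 2 ∧
      Finsupp.weight p1p1Weight2 s = (e (τ i) + e (τ j)) / 2
    · have h1 := hres ⟨(τ i, τ j, s), hs⟩
      have h2 : (⟨_, hV ⟨(τ i, τ j, s), hs⟩⟩ : V) = coeff s (A i j) :=
        Subtype.ext (hcoeff i j s).symm
      rw [h2] at h1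
      rw [h1]
      simp only [EmbeddingLike.apply_eq_iff_eq, Equiv.symm_apply_apply]
      split_ifs with hij
      · rw [← eq_intCast (Int.castRingHom _), ← coeff_map, map_specialDiag]
        simp
      · simp
    · have h0 : coeff s (A i j) = 0 := Subtype.ext <| (hcoeff i j s).trans
        (coeff_eq_zero_of_index (quadric_homogeneous₁ p _ _) (quadric_homogeneous₂ p _ _) hs)
      rw [h0, map_zero]
      split_ifs with hij
      · subst hij
        have e1 : ∀ n : ℕ, (n + n) / 2 = n := fun n => by omega
        rw [e1, e1] at hs
        by_contra h0
        exact hs ⟨specialDiag_homogeneous₁ hdeg i (Ne.symm h0),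
          specialDiag_homogeneous₂ hdeg i (Ne.symm h0)⟩
      · simp

/-- The index of the coefficient that is the value at the base point `x₁ = y₁ = 0`. -/
noncomputable def baseIndex (d e : Fin 4 → ℕ) (t : Fin 4 × Fin 4) : QuadricIndex d e :=
  ⟨(t.1, t.2, Finsupp.single 0 ((d t.1 + d t.2) / 2) + Finsupp.single 2 ((e t.1 + e t.2) / 2)), by
    simp [Finsupp.weight_single, p1p1Weight1, p1p1Weight2]⟩

theorem eval_base_eq {d e : Fin 4 → ℕ} (p : QuadricParam d e) (i j : Fin 4) :
    eval ![1, 0, 1, 0] (p i j : MvPolynomial (Fin 4) ℂ) =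
      quadricCoeff (baseIndex d e (i, j)) p := by
  rw [eval_eq', Finset.sum_eq_single (baseIndex d e (i, j)).1.2.2]
  · simp [Fin.prod_univ_four, quadricCoeff, baseIndex]
  · intro t ht hts
    have w1 := quadric_homogeneous₁ p i j (mem_support_iff.1 ht)
    have w2 := quadric_homogeneous₂ p i j (mem_support_iff.1 ht)
    simp only [Finsupp.weight_apply, Finsupp.sum_fintype, zero_smul, implies_true,
      Fin.sum_univ_four, p1p1Weight1, p1p1Weight2] at w1 w2
    simp at w1 w2
    by_cases h13 : t 1 = 0 ∧ t 3 = 0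
    · exfalso
      apply hts
      ext k
      fin_cases k <;> simp [baseIndex] <;> omega
    · rw [Fin.prod_univ_four]
      rcases not_and_or.1 h13 with h | h <;> simp [h]
  · intro h
    rw [notMem_support_iff.1 h, zero_mul]

theorem algebraicIndependent_base {d e : Fin 4 → ℕ} {p : QuadricParam d e}
    (hp : AlgebraicIndependent ℚ fun t => quadricCoeff t p) :
    AlgebraicIndependent ℚ fun t : Fin 4 × Fin 4 =>
      eval ![1, 0, 1, 0] (p t.1 t.2 : MvPolynomial (Fin 4) ℂ) := by
  simp only [eval_base_eq]
  refine hp.comp (baseIndex d e) fun s t hst => ?_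
  have h := congrArg Subtype.val hst
  have h1 : s.1 = t.1 := (Prod.ext_iff.1 h).1
  have h2 : s.2 = t.2 := (Prod.ext_iff.1 (Prod.ext_iff.1 h).2).1
  exact Prod.ext h1 h2

theorem eval_diag_ne_zero {d e : Fin 4 → ℕ} {p : QuadricParam d e}
    (hp : AlgebraicIndependent ℚ fun t => quadricCoeff t p) (i : Fin 4) :
    eval ![1, 0, 1, 0] (p i i : MvPolynomial (Fin 4) ℂ) ≠ 0 :=
  (algebraicIndependent_base hp).ne_zero (i, i)

end Parameters

section NotStablyRational

open MvPolynomial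

noncomputable instance (k : Type) [Field k] (n : ℕ) :
    Algebra (MvPolynomial (Fin n) k) (ratFuncField k n) :=
  inferInstanceAs (Algebra _ (FractionRing (MvPolynomial (Fin n) k)))

instance (k : Type) [Field k] (n : ℕ) :
    IsFractionRing (MvPolynomial (Fin n) k) (ratFuncField k n) :=
  inferInstanceAs (IsFractionRing _ (FractionRing (MvPolynomial (Fin n) k)))

theorem exists_sq_offset {D : Fin 4 → ℕ} (h : ∀ i j, Even (D i + D j)) :
    ∃ (d : ℕ) (k : Fin 4 → ℕ), ∀ r, D r + 2 * k r = d := by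
  refine ⟨D 0 + D 1 + D 2 + D 3 + D 0, fun r => (D 0 + D 1 + D 2 + D 3 + D 0 - D r) / 2,
    fun r => ?_⟩
  have h0 := h r 0
  have h1 := h 0 1
  have h2 := h 2 3
  rw [Nat.even_iff] at h0 h1 h2
  fin_cases r <;> simp at * <;> omega

theorem exists_specialDegrees {d e : Fin 4 → ℕ} (hpard : ∀ i j, Even (d i + d j))
    (hpare : ∀ i j, Even (e i + e j))
    (hd3 : 3 ≤ d 3) (he3 : 3 ≤ e 3)
    (h : ¬ (d 2 = 0 ∨ (d 1 = 0 ∧ e 1 = 0 ∧ e 0 = 0) ∨ (e 0 = 0 ∧ e 1 = 0 ∧ e 2 = 0))) :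
    ∃ τ : Equiv.Perm (Fin 4), τ 3 = 3 ∧ SpecialDegrees (d ∘ τ) (e ∘ τ) := by
  have key : ∀ τ : Equiv.Perm (Fin 4), τ 3 = 3 → 1 ≤ d (τ 1) → 1 ≤ e (τ 2) →
      SpecialDegrees (d ∘ τ) (e ∘ τ) := fun τ h3 h1 h2 =>
    { one_le_D := h1
      one_le_E := h2
      three_le_D := by simpa [h3] using hd3
      three_le_E := by simpa [h3] using he3
      exists_D := exists_sq_offset fun i j => hpard _ _
      exists_E := exists_sq_offset fun i j => hpare _ _ }
  by_cases h1 : 1 ≤ e 1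
  · refine ⟨Equiv.swap 1 2, by decide, key _ (by decide) ?_ ?_⟩
    · rw [show Equiv.swap (1 : Fin 4) 2 1 = 2 by decide]; omega
    · rw [show Equiv.swap (1 : Fin 4) 2 2 = 1 by decide]; omega
  by_cases h0 : 1 ≤ e 0
  · let τ : Equiv.Perm (Fin 4) := Equiv.swap 0 1 * Equiv.swap 1 2
    refine ⟨τ, by decide, key _ (by decide) ?_ ?_⟩
    · rw [show τ 1 = 2 by decide]; omega
    · rw [show τ 2 = 0 by decide]; omega
  · exact ⟨1, rfl, key _ rfl (by simp; omega) (by simp; omega)⟩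

theorem not_isStablyRational {d e : Fin 4 → ℕ} {p : QuadricParam d e}
    (hp : AlgebraicIndependent ℚ fun t => quadricCoeff t p) {τ : Equiv.Perm (Fin 4)}
    (hτ : τ 3 = 3) (hdeg : SpecialDegrees (d ∘ τ) (e ∘ τ)) :
    ¬ IsStablyRationalFunctionField
      (p1p1BundleFFMap fun i j => (p i j : MvPolynomial (Fin 4) ℂ)) := by
  intro hst
  obtain ⟨m, n, ψ, hψ, hψC, htop⟩ := exists_embedding_of_isStablyRational hst
  obtain ⟨V, A, hchar, hA, hAp⟩ := exists_reducesToSpecial hp τ hdeg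
  let ι : ℂ →+* ratFuncField ℂ n := (algebraMap (MvPolynomial (Fin n) ℂ) (ratFuncField ℂ n)).comp C
  obtain ⟨J, r, hJ, hJC, hr1, hr2, hr3, hsum, htop⟩ :=
    exists_stable_coordinates (eval_diag_ne_zero hp) hψ htop (ι := ι) hψC τ hτ
  have hJι : J.comp C = ι := RingHom.ext hJC
  have hsum' : ∑ i, ∑ j, (A i j).eval₂ (ι.comp V.subtype)
      ![1, J (X (.inr 0)), 1, J (X (.inr 1))] * r i * r j = 0 := by
    rw [← hsum]
    refine Finset.sum_congr rfl fun i _ => Finset.sum_congr rfl fun j _ => ?_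
    rw [← hAp, eval₂_map]
  obtain ⟨P, Z, hZ0, hZ, hP0, hP2, hP1, hP3, hlead⟩ :=
    hA.exists_curve (J (X (.inr 0))) (J (X (.inr 1))) (ζ := r)
      ⟨3, by rw [hr3]; exact one_ne_zero⟩ hsum'
  refine hA.false_of_curve hJ hr1 hr2 hr3 ?_ htop hZ0 ?_ hP0 hP2 hP1 hP3 ?_
  · rw [← RingHom.comp_assoc, hJι]; exact hsum'
  · rw [← RingHom.comp_assoc V.subtype C J, hJι]; exact hZ
  · intro q
    obtain ⟨c, hc⟩ := hlead q
    exact ⟨c, hc.trans (hJC c).symm⟩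

end NotStablyRational

section Tsen

open Polynomial

theorem exists_isotropic_of_conicSplit {L : Type} [Field L] [CharZero L]
    (hL : ∀ a b : L, a ≠ 0 → b ≠ 0 → ConicSplit a b) (a : Fin 3 → Fin 3 → L) :
    ∃ v : Fin 3 → L, v ≠ 0 ∧ ∑ i, ∑ j, a i j * v i * v j = 0 := by
  have : Invertible (2 : L) := invertibleOfNonzero two_ne_zero
  let Q : QuadraticForm L (Fin 3 → L) := (Matrix.of a).toQuadraticForm'
  have hQ : ∀ v, Q v = ∑ i, ∑ j, a i j * v i * v j := by
    intro v
    simp only [Q, Matrix.toQuadraticForm', LinearMap.BilinMap.toQuadraticMap_apply,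
      Matrix.toLinearMap₂'_apply, Matrix.of_apply, smul_eq_mul]
    refine Finset.sum_congr rfl fun i _ => Finset.sum_congr rfl fun j _ => ?_
    ring
  obtain ⟨w, ⟨e⟩⟩ := Q.equivalent_weightedSumSquares
  have h3 : Module.finrank L (Fin 3 → L) = 3 := Module.finrank_fin_fun L
  revert w
  rw [h3]
  intro w e
  have key : ∀ u : Fin 3 → L, u ≠ 0 → ∑ i, w i * u i ^ 2 = 0 →
      ∃ v : Fin 3 → L, v ≠ 0 ∧ ∑ i, ∑ j, a i j * v i * v j = 0 := by
    intro u hu h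
    refine ⟨e.symm u, fun h0 => hu ?_, ?_⟩
    · have h1 := congrArg e h0
      rw [show e (e.symm u) = u from e.toLinearEquiv.apply_symm_apply u] at h1
      rw [h1]
      exact e.toLinearEquiv.map_zero
    · rw [← hQ, e.symm.map_app, QuadraticMap.weightedSumSquares_apply, ← h]
      refine Finset.sum_congr rfl fun i _ => ?_
      rw [smul_eq_mul, sq]
  by_cases h : ∃ i, w i = 0
  · obtain ⟨i, hi⟩ := h
    refine key (Pi.single i 1) (by simp) (Finset.sum_eq_zero fun j _ => ?_)
    rcases eq_or_ne j i with rfl | hj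
    · simp [hi]
    · simp [Pi.single_eq_of_ne hj]
  · push Not at h
    obtain ⟨u, v, z, hne, huv⟩ := hL (-(w 0 / w 2)) (-(w 1 / w 2)) (by simp [h]) (by simp [h])
    refine key ![u, v, z] ?_ ?_
    · intro h0
      have e0 := congrFun h0 0
      have e1 := congrFun h0 1
      have e2 := congrFun h0 2
      simp at e0 e1 e2
      tauto
    · have h2 := h 2
      simp only [Fin.sum_univ_three, Matrix.cons_val]
      field_simp at huv
      linear_combination -huv

variable {l : Type} [Field l] [IsAlgClosed l] [CharZero l]

omit [CharZero l] in
theorem conicSplit_polynomial {f g : l[X]} (hf : f ≠ 0) (hg : g ≠ 0) (L : Type) [Field L]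
    (φ : l[X] →+* L) (hφ : Function.Injective φ) : ConicSplit (φ f) (φ g) := by
  obtain ⟨a, b, -, -, h⟩ := legendre_descent_of_isSquare (f₀ := f) (g₀ := g) (by
    intro P hP f g _ _ _
    have hP0 : P ≠ 0 := hP.out.ne_zero
    have : Module.Finite l (AdjoinRoot P) := (AdjoinRoot.powerBasis hP0).finite
    obtain ⟨c, hc⟩ := (IsAlgClosed.algebraMap_bijective_of_isIntegral (k := l)
      (K := AdjoinRoot P)).2 (AdjoinRoot.mk P g)
    obtain ⟨s, hs⟩ := IsAlgClosed.exists_eq_mul_self c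
    exact ⟨algebraMap l _ s, by rw [← hc, hs, map_mul]⟩) _ f g hf hg rfl (ConicEquiv.refl f g)
  rw [h L φ hφ]
  obtain ⟨s, hs⟩ := IsAlgClosed.exists_eq_mul_self a
  exact ConicSplit.of_isSquare_left _ ⟨φ (C s), by rw [hs, C_mul, map_mul]⟩

/-- Tsen's theorem for ternary quadratic forms over the rational function field. -/
theorem exists_isotropic_ternary (a : Fin 3 → Fin 3 → l[X]) :
    ∃ σ : Fin 3 → l[X], σ ≠ 0 ∧ ∑ i, ∑ j, a i j * σ i * σ j = 0 := by
  let L := FractionRing l[X]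
  let φ := algebraMap l[X] L
  have hφ : Function.Injective φ := IsFractionRing.injective l[X] L
  have : CharZero L := charZero_of_injective_ringHom hφ
  obtain ⟨v, hv, h⟩ := exists_isotropic_of_conicSplit (L := L) (by
    intro a b ha hb
    obtain ⟨f, s, hs, rfl⟩ := IsFractionRing.div_surjective (A := l[X]) a
    obtain ⟨g, t, ht, rfl⟩ := IsFractionRing.div_surjective (A := l[X]) b
    have hs0 : φ s ≠ 0 := (map_ne_zero_iff φ hφ).2 (nonZeroDivisors.ne_zero hs)
    have ht0 : φ t ≠ 0 := (map_ne_zero_iff φ hφ).2 (nonZeroDivisors.ne_zero ht)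
    rw [← ConicSplit.mul_sq_left hs0, ← ConicSplit.mul_sq_right ht0]
    have e1 : φ f / φ s * φ s ^ 2 = φ (f * s) := by
      rw [map_mul, sq, ← mul_assoc, div_mul_cancel₀ _ ‹_›]
    have e2 : φ g / φ t * φ t ^ 2 = φ (g * t) := by
      rw [map_mul, sq, ← mul_assoc, div_mul_cancel₀ _ ‹_›]
    change ConicSplit (φ f / φ s * φ s ^ 2) (φ g / φ t * φ t ^ 2)
    rw [e1, e2]
    refine conicSplit_polynomial (mul_ne_zero ?_ (nonZeroDivisors.ne_zero hs))
      (mul_ne_zero ?_ (nonZeroDivisors.ne_zero ht)) L φ hφ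
    · rintro rfl; simp at ha
    · rintro rfl; simp at hb) fun i j => φ (a i j)
  obtain ⟨b, hb⟩ := IsLocalization.exist_integer_multiples_of_finite (nonZeroDivisors l[X]) v
  choose σ hσ using hb
  have hb0 : φ b ≠ 0 := (map_ne_zero_iff φ hφ).2 (nonZeroDivisors.coe_ne_zero b)
  have hσ' : ∀ i, φ (σ i) = φ b * v i := fun i => (hσ i).trans (Algebra.smul_def _ _)
  refine ⟨σ, fun h0 => hv ?_, hφ ?_⟩
  · funext i
    have := hσ' i
    rw [h0, Pi.zero_apply, map_zero, eq_comm] at this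
    exact (mul_eq_zero.1 this).resolve_left hb0
  · rw [map_zero, ← mul_zero (φ b ^ 2), ← h]
    simp only [map_sum, map_mul, hσ', Finset.mul_sum]
    refine Finset.sum_congr rfl fun i _ => Finset.sum_congr rfl fun j _ => ?_
    ring

end Tsen

section Quadratic

open Polynomial

variable {B : Type} [CommRing B]

theorem Polynomial.coeff_two_mul_of_natDegree_le_one {g h : B[X]} (hg : g.natDegree ≤ 1)
    (hh : h.natDegree ≤ 1) : (g * h).coeff 2 = g.coeff 1 * h.coeff 1 := by
  have hg2 : g.coeff 2 = 0 := coeff_eq_zero_of_natDegree_lt (by omega)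
  have hh2 : h.coeff 2 = 0 := coeff_eq_zero_of_natDegree_lt (by omega)
  rw [coeff_mul, Finset.Nat.sum_antidiagonal_eq_sum_range_succ fun i j => g.coeff i * h.coeff j]
  simp [Finset.sum_range_succ, hg2, hh2]

/-- A primitive quadratic polynomial whose discriminant is not a square is irreducible. -/
theorem Polynomial.irreducible_quadratic [IsDomain B] {a b c : B} (ha : a ≠ 0)
    (hprim : ∀ u, u ∣ a → u ∣ b → u ∣ c → IsUnit u) (hdisc : ¬ IsSquare (b ^ 2 - 4 * a * c)) :
    Irreducible (C a * X ^ 2 + C b * X + C c) := by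
  have hd : (C a * X ^ 2 + C b * X + C c).natDegree = 2 := natDegree_quadratic ha
  have c0 : (C a * X ^ 2 + C b * X + C c).coeff 0 = c := by simp
  have c1 : (C a * X ^ 2 + C b * X + C c).coeff 1 = b := by simp [coeff_X_pow, coeff_C]
  have c2 : (C a * X ^ 2 + C b * X + C c).coeff 2 = a := by simp
  have hconst : ∀ u, C u ∣ C a * X ^ 2 + C b * X + C c → IsUnit (C u) := by
    intro u hu
    rw [C_dvd_iff_dvd_coeff] at hu
    exact isUnit_C.2 (hprim u (c2 ▸ hu 2) (c1 ▸ hu 1) (c0 ▸ hu 0))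
  refine ⟨fun hu => ?_, fun g h hgh => ?_⟩
  · rw [natDegree_eq_zero_of_isUnit hu] at hd
    exact absurd hd (by norm_num)
  · have hne : g * h ≠ 0 := by
      intro h0
      rw [hgh, h0] at hd
      simp at hd
    have hdeg := natDegree_mul (left_ne_zero_of_mul hne) (right_ne_zero_of_mul hne)
    rw [← hgh, hd] at hdeg
    rcases (by omega : g.natDegree = 0 ∨ h.natDegree = 0 ∨ (g.natDegree ≤ 1 ∧ h.natDegree ≤ 1))
      with hg | hh | ⟨hg, hh⟩
    · left
      rw [eq_C_of_natDegree_eq_zero hg]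
      refine hconst _ ?_
      rw [← eq_C_of_natDegree_eq_zero hg]
      exact ⟨h, hgh⟩
    · right
      rw [eq_C_of_natDegree_eq_zero hh]
      refine hconst _ ?_
      rw [← eq_C_of_natDegree_eq_zero hh]
      exact ⟨g, by rw [hgh, mul_comm]⟩
    · exfalso
      apply hdisc
      rw [hgh, mul_coeff_zero] at c0
      rw [hgh, mul_coeff_one] at c1
      rw [hgh, coeff_two_mul_of_natDegree_le_one hg hh] at c2
      exact ⟨g.coeff 0 * h.coeff 1 - g.coeff 1 * h.coeff 0, by rw [← c0, ← c1, ← c2]; ring⟩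

theorem Polynomial.not_isSquare_quadratic [IsDomain B] {a b c : B} (ha : a ≠ 0)
    (hdisc : b ^ 2 - 4 * a * c ≠ 0) : ¬ IsSquare (C a * X ^ 2 + C b * X + C c) := by
  rintro ⟨s, hs⟩
  have hd : (C a * X ^ 2 + C b * X + C c).natDegree = 2 := natDegree_quadratic ha
  have c0 : (C a * X ^ 2 + C b * X + C c).coeff 0 = c := by simp
  have c1 : (C a * X ^ 2 + C b * X + C c).coeff 1 = b := by simp [coeff_X_pow, coeff_C]
  have c2 : (C a * X ^ 2 + C b * X + C c).coeff 2 = a := by simp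
  have hs0 : s ≠ 0 := by
    rintro rfl
    rw [hs] at hd
    simp at hd
  have hs1 : s.natDegree ≤ 1 := by
    rw [hs, natDegree_mul hs0 hs0] at hd
    omega
  rw [hs, mul_coeff_zero] at c0
  rw [hs, mul_coeff_one] at c1
  rw [hs, coeff_two_mul_of_natDegree_le_one hs1 hs1] at c2
  exact hdisc (by rw [← c0, ← c1, ← c2]; ring)

end Quadratic

section Prime

open MvPolynomial

/-- The chart polynomials as polynomials in the last fibre coordinate. -/
noncomputable def chartEquiv :
    MvPolynomial (Fin 5) ℂ ≃+* Polynomial (MvPolynomial (Fin 4) ℂ) :=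
  RingEquiv.ofRingHom chartToPolynomial
    (Polynomial.eval₂RingHom (rename Fin.castSucc).toRingHom (X 4))
    (by
      refine Polynomial.ringHom_ext (fun p => ?_) ?_
      · simpa using chartToPolynomial_rename p
      · simp [chartToPolynomial])
    (by
      refine MvPolynomial.ringHom_ext (fun c => ?_) fun i => ?_
      · simp [chartToPolynomial]
      · fin_cases i <;> simp [chartToPolynomial])

/-- The coefficients on the chart `x₀ = y₀ = 1`, in the two base coordinates. -/
noncomputable def dehomPlane : MvPolynomial (Fin 4) ℂ →+* MvPolynomial (Fin 2) ℂ :=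
  (aeval ![1, X 0, 1, X 1]).toRingHom

/-- The base coordinates among the coordinates of the chart. -/
noncomputable def planeInclusion : MvPolynomial (Fin 2) ℂ →+* MvPolynomial (Fin 4) ℂ :=
  (rename (Fin.castLE (by norm_num : 2 ≤ 4))).toRingHom

theorem planeInclusion_dehomPlane (p : MvPolynomial (Fin 4) ℂ) :
    planeInclusion (dehomPlane p) = dehomBase p := by
  have : planeInclusion.comp dehomPlane = dehomBase := by
    refine MvPolynomial.ringHom_ext (fun c => ?_) fun i => ?_
    · simp [planeInclusion, dehomPlane, dehomBase]
    · fin_cases i <;> simp [planeInclusion, dehomPlane, dehomBase]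
  exact RingHom.congr_fun this p

theorem mem_vars_of_mul_right {σ R : Type} [CommRing R] [IsDomain R] {p q : MvPolynomial σ R}
    (h : p * q ≠ 0) {i : σ} (hi : i ∈ p.vars) : i ∈ (p * q).vars := by
  classical
  have hv : ∀ r : MvPolynomial σ R, i ∈ r.vars ↔ degreeOf i r ≠ 0 := fun r => by
    rw [degreeOf_def, vars_def, Multiset.mem_toFinset, Ne, Multiset.count_eq_zero, not_not]
  rw [hv] at hi ⊢
  rw [degreeOf_mul_eq (left_ne_zero_of_mul h) (right_ne_zero_of_mul h)]
  omega

theorem exists_eval_eq_zero {σ K : Type} [Finite σ] [Field K] [IsAlgClosed K]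
    {u : MvPolynomial σ K} (hu : ¬ IsUnit u) : ∃ v, eval v u = 0 := by
  obtain ⟨I, hI, huI⟩ := exists_max_ideal_of_mem_nonunits hu
  obtain ⟨v, rfl⟩ := isMaximal_iff_eq_vanishingIdeal_singleton.1 hI
  exact ⟨v, by simpa [mem_vanishingIdeal_singleton_iff] using huI⟩

theorem eval_dehomBase (v : Fin 4 → ℂ) (p : MvPolynomial (Fin 4) ℂ) :
    eval v (dehomBase p) = eval ![1, v 0, 1, v 1] p := by
  have : (eval v).comp dehomBase = eval ![1, v 0, 1, v 1] := by
    refine MvPolynomial.ringHom_ext (fun c => ?_) fun i => ?_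
    · simp [dehomBase]
    · fin_cases i <;> simp [dehomBase]
  exact RingHom.congr_fun this p

/-- A quadratic form that does not vanish identically on any fibre has no content. -/
theorem isUnit_of_dvd_chart {A : Fin 4 → Fin 4 → MvPolynomial (Fin 4) ℂ}
    (hA : IsQuadricBundleP1P1 A) (ha : dehomBase (A 3 3) ≠ 0) {u : MvPolynomial (Fin 4) ℂ}
    (hua : u ∣ dehomBase (A 3 3)) (hub : u ∣ chartLinear A) (huc : u ∣ chartConst A) :
    IsUnit u := by
  classical
  by_contra hu
  obtain ⟨v, hv⟩ := exists_eval_eq_zero hu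
  have hvars : ∀ i ∈ u.vars, i = 0 ∨ i = 1 := by
    obtain ⟨w, hw⟩ := hua
    intro i hi
    have h1 := mem_vars_of_mul_right (q := w) (hw ▸ ha) hi
    rw [← hw, ← planeInclusion_dehomPlane] at h1
    obtain ⟨k, -, rfl⟩ := Finset.mem_image.1 (vars_rename _ _ h1)
    fin_cases k
    · exact Or.inl rfl
    · exact Or.inr rfl
  have hu0 : ∀ s t, eval ![v 0, v 1, s, t] u = 0 := by
    intro s t
    rw [← hv]
    refine hom_congr_vars (by ext; simp) (fun i hi _ => ?_) rfl
    rcases hvars i hi with rfl | rfl <;> simp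
  let N : Fin 4 → Fin 4 → ℂ := fun i j => eval ![1, v 0, 1, v 1] (A i j)
  have key : ∀ q, u ∣ q → ∀ s t, eval ![v 0, v 1, s, t] q = 0 := by
    rintro _ ⟨w, rfl⟩ s t
    rw [map_mul, hu0, zero_mul]
  have e1 : N 3 3 = 0 := by simpa [eval_dehomBase] using key _ hua 0 0
  have e2 : ∀ s t, (N 0 3 + N 3 0) + (N 1 3 + N 3 1) * s + (N 2 3 + N 3 2) * t = 0 := by
    intro s t
    simpa [chartLinear, eval_dehomBase, Fin.sum_univ_four] using key _ hub s t
  have e3 : ∀ s t, N 0 0 + (N 0 1 + N 1 0) * s + (N 0 2 + N 2 0) * t + N 1 1 * s ^ 2 +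
      (N 1 2 + N 2 1) * (s * t) + N 2 2 * t ^ 2 = 0 := by
    intro s t
    rw [← key _ huc s t]
    simp [chartConst, eval_dehomBase, Fin.sum_univ_four, N]
    ring
  obtain ⟨i, j, hij⟩ := hA.2 ![1, v 0, 1, v 1] (by simp) (by simp)
  apply hij
  rw [map_add]
  change N i j + N j i = 0
  have a00 := e2 0 0
  have a10 := e2 1 0
  have a01 := e2 0 1
  have b00 := e3 0 0
  have b10 := e3 1 0
  have b10' := e3 (-1) 0
  have b01 := e3 0 1
  have b01' := e3 0 (-1)
  have b11 := e3 1 1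
  fin_cases i <;> fin_cases j <;> simp <;> grind

theorem chartPoly_prime {A : Fin 4 → Fin 4 → MvPolynomial (Fin 4) ℂ}
    (hA : IsQuadricBundleP1P1 A)
    (hbase : AlgebraicIndependent ℚ fun t : Fin 4 × Fin 4 => eval ![1, 0, 1, 0] (A t.1 t.2)) :
    Prime (p1p1BundleChartPoly A) := by
  have ha : dehomBase (A 3 3) ≠ 0 := dehomBase_ne_zero (hbase.ne_zero (3, 3))
  rw [← MulEquiv.prime_iff chartEquiv]
  change Prime (chartToPolynomial _)
  rw [chartToPolynomial_chartPoly]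
  refine (Polynomial.irreducible_quadratic ha
    (fun u h1 h2 h3 => isUnit_of_dvd_chart hA ha h1 h2 h3) fun hsq => ?_).prime
  let π : MvPolynomial (Fin 4) ℂ →+* Polynomial ℂ := (aeval ![0, 0, Polynomial.X, 0]).toRingHom
  have hπ : ∀ q, π (dehomBase q) = Polynomial.C (eval ![1, 0, 1, 0] q) := by
    intro q
    have : π.comp dehomBase = Polynomial.C.comp (eval ![1, 0, 1, 0]) := by
      refine MvPolynomial.ringHom_ext (fun c => ?_) fun i => ?_
      · simp [dehomBase, π]
      · fin_cases i <;> simp [dehomBase, π]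
    exact RingHom.congr_fun this q
  let N : Fin 4 → Fin 4 → ℂ := fun i j => eval ![1, 0, 1, 0] (A i j)
  let Y : Fin 4 → Fin 4 → MvPolynomial (Fin 4 × Fin 4) ℚ := fun i j => X (i, j)
  let α : MvPolynomial (Fin 4 × Fin 4) ℚ := (Y 1 3 + Y 3 1) ^ 2 - 4 * Y 3 3 * Y 1 1
  let β : MvPolynomial (Fin 4 × Fin 4) ℚ :=
    2 * (Y 0 3 + Y 3 0) * (Y 1 3 + Y 3 1) - 4 * Y 3 3 * (Y 0 1 + Y 1 0)
  let γ : MvPolynomial (Fin 4 × Fin 4) ℚ := (Y 0 3 + Y 3 0) ^ 2 - 4 * Y 3 3 * Y 0 0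
  let ev : MvPolynomial (Fin 4 × Fin 4) ℚ →ₐ[ℚ] ℂ :=
    aeval fun t : Fin 4 × Fin 4 => eval ![1, 0, 1, 0] (A t.1 t.2)
  have hne : ∀ q, eval (fun t => if t.1 = t.2 then 1 else 0) q ≠ 0 → ev q ≠ 0 := by
    intro q hq h0
    have := hbase.eq_zero_of_aeval_eq_zero q h0
    rw [this, map_zero] at hq
    exact hq rfl
  have hα : ev α ≠ 0 := hne _ (by simp [α, Y])
  have hδ : ev (β ^ 2 - 4 * α * γ) ≠ 0 := hne _ (by simp [α, β, γ, Y])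
  have hδ' : ev β ^ 2 - 4 * ev α * ev γ ≠ 0 := by
    simpa only [map_sub, map_mul, map_pow, map_ofNat] using hδ
  refine Polynomial.not_isSquare_quadratic hα hδ' ?_
  have hX : ∀ i j, ev (Y i j) = N i j := fun i j => by simp [ev, Y, N]
  have h1 : π (chartLinear A) = Polynomial.C (N 0 3 + N 3 0) +
      Polynomial.C (N 1 3 + N 3 1) * Polynomial.X := by
    simp only [chartLinear, map_mul, map_add, hπ, Fin.sum_univ_four]
    simp [π, N]
  have h2 : π (chartConst A) = Polynomial.C (N 0 0) +
      Polynomial.C (N 0 1 + N 1 0) * Polynomial.X + Polynomial.C (N 1 1) * Polynomial.X ^ 2 := by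
    simp only [chartConst, map_mul, map_add, hπ, Fin.sum_univ_four]
    simp [π, N]
    ring
  have h3 : π (chartLinear A ^ 2 - 4 * dehomBase (A 3 3) * chartConst A) =
      Polynomial.C (ev α) * Polynomial.X ^ 2 + Polynomial.C (ev β) * Polynomial.X +
        Polynomial.C (ev γ) := by
    rw [map_sub, map_mul, map_mul, map_pow, h1, h2, hπ]
    simp only [α, β, γ, map_sub, map_add, map_mul, map_pow, hX, map_ofNat]
    simp only [N]
    ring
  rw [← h3]
  exact hsq.map π

end Prime

section Isotropic

open MvPolynomial

theorem eq_zero_of_isWeightedHomogeneous_zero {σ R : Type} [CommRing R] {w : σ → ℕ}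
    {p : MvPolynomial σ R} (hp : IsWeightedHomogeneous w p 0) {i : σ} (hi : i ∈ p.vars) :
    w i = 0 := by
  classical
  obtain ⟨s, hs, his⟩ := (mem_vars_iff_mem_support i).1 hi
  have h := hp (mem_support_iff.1 hs)
  have h1 := (Finset.sum_eq_zero_iff.1 h) i his
  rcases Nat.mul_eq_zero.1 h1 with h2 | h2
  · exact absurd h2 (Finsupp.mem_support_iff.1 his)
  · exact h2

theorem dehomPlane_eq_of_homogeneous₁ {p : MvPolynomial (Fin 4) ℂ}
    (hp : IsWeightedHomogeneous p1p1Weight1 p 0) :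
    dehomPlane p = Polynomial.aeval (R := ℂ) (X 1) (aeval ![0, 0, 1, Polynomial.X] p) := by
  change dehomPlane p = ((Polynomial.aeval (R := ℂ) (X 1 : MvPolynomial (Fin 2) ℂ)).toRingHom.comp
    (aeval (R := ℂ) ![0, 0, 1, (Polynomial.X : Polynomial ℂ)]).toRingHom) p
  refine hom_congr_vars (by ext; simp [dehomPlane]) (fun i hi _ => ?_) rfl
  have h := eq_zero_of_isWeightedHomogeneous_zero hp hi
  fin_cases i <;> simp [p1p1Weight1, dehomPlane] at h ⊢

theorem dehomPlane_eq_of_homogeneous₂ {p : MvPolynomial (Fin 4) ℂ}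
    (hp : IsWeightedHomogeneous p1p1Weight2 p 0) :
    dehomPlane p = Polynomial.aeval (R := ℂ) (X 0) (aeval ![1, Polynomial.X, 0, 0] p) := by
  change dehomPlane p = ((Polynomial.aeval (R := ℂ) (X 0 : MvPolynomial (Fin 2) ℂ)).toRingHom.comp
    (aeval (R := ℂ) ![1, (Polynomial.X : Polynomial ℂ), 0, 0]).toRingHom) p
  refine hom_congr_vars (by ext; simp [dehomPlane]) (fun i hi _ => ?_) rfl
  have h := eq_zero_of_isWeightedHomogeneous_zero hp hi
  fin_cases i <;> simp [p1p1Weight2, dehomPlane] at h ⊢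

theorem dehomPlane_eq_of_homogeneous {p : MvPolynomial (Fin 4) ℂ}
    (hp₁ : IsWeightedHomogeneous p1p1Weight1 p 0) (hp₂ : IsWeightedHomogeneous p1p1Weight2 p 0) :
    dehomPlane p = C (eval 0 p) := by
  change dehomPlane p = ((C : ℂ →+* MvPolynomial (Fin 2) ℂ).comp (eval 0)) p
  refine hom_congr_vars (by ext; simp [dehomPlane]) (fun i hi _ => ?_) rfl
  have h₁ := eq_zero_of_isWeightedHomogeneous_zero hp₁ hi
  have h₂ := eq_zero_of_isWeightedHomogeneous_zero hp₂ hi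
  fin_cases i <;> simp [p1p1Weight1, p1p1Weight2] at h₁ h₂

/-- Extend an isotropic vector by zero along an injective change of coefficients. -/
theorem exists_isotropic_extend {B L : Type} [CommRing B] [CommRing L] {n m : ℕ} (φ : B →+* L)
    (hφ : Function.Injective φ) {a : Fin n → Fin n → B} {M : Fin (n + m) → Fin (n + m) → L}
    (hM : ∀ i j, M (Fin.castAdd m i) (Fin.castAdd m j) = φ (a i j))
    (h : ∃ σ : Fin n → B, σ ≠ 0 ∧ ∑ i, ∑ j, a i j * σ i * σ j = 0) :
    ∃ σ : Fin (n + m) → L, σ ≠ 0 ∧ ∑ i, ∑ j, M i j * σ i * σ j = 0 := by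
  obtain ⟨σ, hσ, h⟩ := h
  refine ⟨Fin.addCases (fun i => φ (σ i)) fun _ => 0, fun h0 => hσ (funext fun i => ?_), ?_⟩
  · have := congrFun h0 (Fin.castAdd m i)
    rw [Fin.addCases_left] at this
    exact hφ (this.trans (map_zero φ).symm)
  · simp only [Fin.sum_univ_add, Fin.addCases_left, Fin.addCases_right, mul_zero, zero_mul,
      Finset.sum_const_zero, add_zero, hM, ← map_mul, ← map_sum, h, map_zero]

theorem exists_isotropic_binary {K : Type} [Field K] [IsAlgClosed K] [NeZero (2 : K)]
    (a : Fin 2 → Fin 2 → K) :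
    ∃ σ : Fin 2 → K, σ ≠ 0 ∧ ∑ i, ∑ j, a i j * σ i * σ j = 0 := by
  by_cases h0 : a 0 0 = 0
  · exact ⟨![1, 0], fun h => one_ne_zero (congrFun h 0), by simp [h0]⟩
  · obtain ⟨s, hs⟩ := IsAlgClosed.exists_eq_mul_self (discrim (a 0 0) (a 0 1 + a 1 0) (a 1 1))
    obtain ⟨x, hx⟩ := exists_quadratic_eq_zero h0 ⟨s, hs⟩
    refine ⟨![x, 1], fun h => one_ne_zero (congrFun h 1), ?_⟩
    simp only [Fin.sum_univ_two, Matrix.cons_val_zero, Matrix.cons_val_one]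
    linear_combination hx

theorem polynomial_aeval_X_injective {σ : Type} (i : σ) :
    Function.Injective (Polynomial.aeval (R := ℂ) (X i : MvPolynomial σ ℂ)) :=
  transcendental_iff_injective.1 (transcendental_X ℂ i)

/-- In the degenerate types, the quadric surface bundle has a rational section. -/
theorem exists_isotropic_dehomPlane {d e : Fin 4 → ℕ} (hlex : LexOrderedType d e)
    (p : QuadricParam d e)
    (h : d 2 = 0 ∨ (d 1 = 0 ∧ e 1 = 0 ∧ e 0 = 0) ∨ (e 0 = 0 ∧ e 1 = 0 ∧ e 2 = 0)) :
    ∃ σ : Fin 4 → MvPolynomial (Fin 2) ℂ, σ ≠ 0 ∧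
      ∑ i, ∑ j, dehomPlane (p i j : MvPolynomial (Fin 4) ℂ) * σ i * σ j = 0 := by
  have h01 : d 0 ≤ d 1 := by rcases hlex 0 with h | h <;> simp at h <;> omega
  have h12 : d 1 ≤ d 2 := by rcases hlex 1 with h | h <;> simp at h <;> omega
  have H₁ : ∀ i j, d i = 0 → d j = 0 →
      IsWeightedHomogeneous p1p1Weight1 (p i j : MvPolynomial (Fin 4) ℂ) 0 := fun i j hi hj => by
    simpa [hi, hj] using quadric_homogeneous₁ p i j
  have H₂ : ∀ i j, e i = 0 → e j = 0 →
      IsWeightedHomogeneous p1p1Weight2 (p i j : MvPolynomial (Fin 4) ℂ) 0 := fun i j hi hj => by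
    simpa [hi, hj] using quadric_homogeneous₂ p i j
  rcases h with h | ⟨h1, h2, h3⟩ | ⟨h1, h2, h3⟩
  · have hd : ∀ i : Fin 3, d (Fin.castAdd 1 i) = 0 := by
      intro i
      fin_cases i
      · exact (by omega : d 0 = 0)
      · exact (by omega : d 1 = 0)
      · exact h
    exact exists_isotropic_extend (n := 3) (m := 1) (Polynomial.aeval (R := ℂ) (X 1)).toRingHom
      (polynomial_aeval_X_injective 1)
      (fun i j => dehomPlane_eq_of_homogeneous₁ (H₁ _ _ (hd i) (hd j))) (exists_isotropic_ternary _)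
  · have hd : ∀ i : Fin 2, d (Fin.castAdd 2 i) = 0 ∧ e (Fin.castAdd 2 i) = 0 := by
      intro i
      fin_cases i
      · exact (by omega : d 0 = 0 ∧ e 0 = 0)
      · exact ⟨h1, h2⟩
    exact exists_isotropic_extend (n := 2) (m := 2) C (C_injective _ _)
      (fun i j => dehomPlane_eq_of_homogeneous (H₁ _ _ (hd i).1 (hd j).1)
        (H₂ _ _ (hd i).2 (hd j).2)) (exists_isotropic_binary _)
  · have he : ∀ i : Fin 3, e (Fin.castAdd 1 i) = 0 := by
      intro i
      fin_cases i
      · exact h1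
      · exact h2
      · exact h3
    exact exists_isotropic_extend (n := 3) (m := 1) (Polynomial.aeval (R := ℂ) (X 0)).toRingHom
      (polynomial_aeval_X_injective 0)
      (fun i j => dehomPlane_eq_of_homogeneous₂ (H₂ _ _ (he i) (he j))) (exists_isotropic_ternary _)

end Isotropic

section Projection

open MvPolynomial

theorem isRationalFunctionField_of_closure_eq_top {K F : Type} [Field K] [Field F] {n : ℕ}
    {J : MvPolynomial (Fin n) K →+* F} (hJ : Function.Injective J)
    (htop : Subfield.closure (Set.range J) = ⊤) :
    IsRationalFunctionField (J.comp C) := by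
  let : Algebra (MvPolynomial (Fin n) K) F := J.toAlgebra
  have : FaithfulSMul (MvPolynomial (Fin n) K) F :=
    (faithfulSMul_iff_algebraMap_injective _ _).2 hJ
  have : IsFractionRing (MvPolynomial (Fin n) K) F := by
    refine IsFractionRing.of_field _ _ fun z => ?_
    have hz : z ∈ Subfield.closure (Set.range J) := htop ▸ Subfield.mem_top z
    rw [Subfield.mem_closure_iff] at hz
    obtain ⟨x, hx, y, hy, rfl⟩ := hz
    rw [← RingHom.coe_range, Subring.closure_eq] at hx hy
    obtain ⟨x, rfl⟩ := hx
    obtain ⟨y, rfl⟩ := hy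
    exact ⟨x, y, rfl⟩
  let e := (FractionRing.algEquiv (MvPolynomial (Fin n) K) F).symm
  refine ⟨n, e.toRingEquiv, RingHom.ext fun c => ?_⟩
  exact e.commutes (C c)

/-- Projection of a quadric surface from a rational point: the coordinates of the generic point
are rational functions of those of its image. -/
theorem mem_of_projection {F : Type} [Field F] {S : Subfield F} {n : ℕ} {M : Fin n → Fin n → F}
    (hM : ∀ i j, M i j ∈ S) {σ w : Fin n → F} (hσS : ∀ i, σ i ∈ S)
    (hσ : ∑ i, ∑ j, M i j * σ i * σ j = 0) (hw : ∑ i, ∑ j, M i j * w i * w j = 0) {k l j : Fin n}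
    (hwk : w k = 1) (hl : σ l ≠ 0) (hj : σ l * w j - w l * σ j ≠ 0)
    (hS : ∀ i, (σ l * w i - w l * σ i) / (σ l * w j - w l * σ j) ∈ S)
    (hB : ∑ i, w i * ∑ j, (M i j + M j i) * σ j ≠ 0) (i : Fin n) : w i ∈ S := by
  set u : F := σ l * w j - w l * σ j with hu
  set v : Fin n → F := fun i => (σ l * w i - w l * σ i) / u with hv
  have huv : ∀ i, u * v i = σ l * w i - w l * σ i := fun i => mul_div_cancel₀ _ hj
  have hvw : ∀ i, σ l * w i = u * v i + w l * σ i := fun i => by rw [huv]; ring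
  set B : F := ∑ i, ∑ j, (M i j + M j i) * v i * σ j with hBdef
  set q : F := ∑ i, ∑ j, M i j * v i * v j with hq
  have hswap : ∑ i, ∑ j, M j i * σ i * σ j = 0 := by
    rw [Finset.sum_comm, ← hσ]
    exact Finset.sum_congr rfl fun i _ => Finset.sum_congr rfl fun j _ => by ring
  have hBu : u * B = σ l * ∑ i, w i * ∑ j, (M i j + M j i) * σ j := by
    have h1 : u * B = σ l * (∑ i, w i * ∑ j, (M i j + M j i) * σ j) -
        w l * (∑ i, ∑ j, M i j * σ i * σ j + ∑ i, ∑ j, M j i * σ i * σ j) := by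
      simp only [hBdef, Finset.mul_sum, ← Finset.sum_add_distrib, ← Finset.sum_sub_distrib]
      refine Finset.sum_congr rfl fun i _ => Finset.sum_congr rfl fun j _ => ?_
      linear_combination (M i j + M j i) * σ j * huv i
    rw [h1, hσ, hswap]
    ring
  have hB0 : B ≠ 0 := by
    intro h0
    rw [h0, mul_zero] at hBu
    exact mul_ne_zero hl hB hBu.symm
  have hcross : ∑ i, ∑ j, M j i * v i * σ j = ∑ i, ∑ j, M i j * σ i * v j := by
    rw [Finset.sum_comm]
    exact Finset.sum_congr rfl fun i _ => Finset.sum_congr rfl fun j _ => by ring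
  have hwl : w l = u * (-q / B) := by
    have h1 : σ l ^ 2 * ∑ i, ∑ j, M i j * w i * w j = u ^ 2 * q + u * w l * B +
        w l ^ 2 * ∑ i, ∑ j, M i j * σ i * σ j := by
      have h2 : B = ∑ i, ∑ j, M i j * v i * σ j + ∑ i, ∑ j, M i j * σ i * v j := by
        rw [← hcross]
        simp only [hBdef, ← Finset.sum_add_distrib, add_mul]
      rw [h2]
      simp only [hq, Finset.mul_sum, ← Finset.sum_add_distrib]
      refine Finset.sum_congr rfl fun i _ => Finset.sum_congr rfl fun j _ => ?_
      linear_combination M i j * (σ l * w j) * hvw i + M i j * (u * v i + w l * σ i) * hvw j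
    rw [hw, hσ] at h1
    have h3 : u * (u * q + w l * B) = 0 := by linear_combination -h1
    have h4 := (mul_eq_zero.1 h3).resolve_left hj
    field_simp
    linear_combination h4
  have hs : -q / B ∈ S := by
    refine div_mem (neg_mem (sum_mem fun i _ => sum_mem fun j _ => ?_))
      (sum_mem fun i _ => sum_mem fun j _ => ?_)
    · exact mul_mem (mul_mem (hM _ _) (hS i)) (hS j)
    · exact mul_mem (mul_mem (add_mem (hM _ _) (hM _ _)) (hS i)) (hσS j)
  have hmem : ∀ i, v i + -q / B * σ i ∈ S := fun i => add_mem (hS i) (mul_mem hs (hσS i))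
  have hmul : ∀ i, σ l * w i = u * (v i + -q / B * σ i) := fun i => by rw [hvw, hwl]; ring
  have huS : u ∈ S := by
    have h1 := hmul k
    rw [hwk, mul_one] at h1
    have h2 : v k + -q / B * σ k ≠ 0 := fun h0 => hl (by rw [h1, h0, mul_zero])
    rw [← mul_div_cancel_right₀ u h2, ← h1]
    exact div_mem (hσS l) (hmem k)
  rw [← mul_div_cancel_left₀ (w i) hl, hmul]
  exact div_mem (mul_mem huS (hmem i)) (hσS l)

variable {A : Fin 4 → Fin 4 → MvPolynomial (Fin 4) ℂ}

/-- The homogeneous fibre coordinates are linearly independent over the base. -/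
theorem chartCoord_linearIndependent (hA : dehomBase (A 3 3) ≠ 0)
    {c : Fin 4 → MvPolynomial (Fin 2) ℂ}
    (hc : ∑ i, chartRingHom A (planeInclusion (c i)) * chartCoord A i = 0) : c = 0 := by
  let p : MvPolynomial (Fin 5) ℂ :=
    ∑ i, rename Fin.castSucc (planeInclusion (c i)) * ![1, X 2, X 3, X 4] i
  have hp : chartMk A p = 0 := by
    rw [← hc]
    simp only [p, map_sum, map_mul]
    rfl
  have hp' : chartToPolynomial p = Polynomial.C (planeInclusion (c 3)) * Polynomial.X +
      Polynomial.C (planeInclusion (c 0) + planeInclusion (c 1) * X 2 +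
        planeInclusion (c 2) * X 3) := by
    simp only [p, Fin.sum_univ_four, map_add, map_mul, chartToPolynomial_rename]
    simp [chartToPolynomial]
    ring
  have h0 : chartToPolynomial p = 0 := by
    by_contra h0
    refine chartMk_ne_zero hA h0 ?_ hp
    rw [hp']
    exact lt_of_le_of_lt Polynomial.natDegree_linear_le (by norm_num)
  rw [h0] at hp'
  have h1 := congrArg (fun q => Polynomial.coeff q 1) hp'
  have h2 := congrArg (fun q => Polynomial.coeff q 0) hp'
  simp at h1 h2
  let ρ : MvPolynomial (Fin 2) ℂ → MvPolynomial (Fin 2) ℂ →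
      MvPolynomial (Fin 4) ℂ →+* MvPolynomial (Fin 2) ℂ :=
    fun s t => (aeval ![X 0, X 1, s, t]).toRingHom
  have hρ : ∀ s t q, ρ s t (planeInclusion q) = q := by
    intro s t q
    have : (ρ s t).comp planeInclusion = RingHom.id _ := by
      refine MvPolynomial.ringHom_ext (fun c => ?_) fun i => ?_
      · simp [ρ, planeInclusion]
      · fin_cases i <;> simp [ρ, planeInclusion]
    exact RingHom.congr_fun this q
  have h3 : ∀ s t, c 0 + c 1 * s + c 2 * t = 0 := by
    intro s t
    have := congrArg (ρ s t) h2
    simp only [map_add, map_mul, hρ] at this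
    simpa [ρ] using this.symm
  have e0 : c 0 = 0 := by simpa using h3 0 0
  have e1 : c 1 = 0 := by simpa [e0] using h3 1 0
  have e2 : c 2 = 0 := by simpa [e0] using h3 0 1
  have e3 : c 3 = 0 := by rw [← hρ 0 0 (c 3), ← h1, map_zero]
  funext i
  fin_cases i
  · exact e0
  · exact e1
  · exact e2
  · exact e3

theorem eval_dehomPlane (p : MvPolynomial (Fin 4) ℂ) :
    eval 0 (dehomPlane p) = eval ![1, 0, 1, 0] p := by
  have : (eval 0).comp dehomPlane = eval ![1, 0, 1, 0] := by
    refine MvPolynomial.ringHom_ext (fun c => ?_) fun i => ?_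
    · simp [dehomPlane]
    · fin_cases i <;> simp [dehomPlane]
  exact RingHom.congr_fun this p

theorem det_dehomPlane_ne_zero
    (hbase : AlgebraicIndependent ℚ fun t : Fin 4 × Fin 4 => eval ![1, 0, 1, 0] (A t.1 t.2)) :
    (Matrix.of fun i j => dehomPlane (A i j) + dehomPlane (A j i)).det ≠ 0 := by
  intro h0
  let D : MvPolynomial (Fin 4 × Fin 4) ℚ := (Matrix.of fun i j => X (i, j) + X (j, i)).det
  have hD : D = 0 := by
    refine hbase.eq_zero_of_aeval_eq_zero D ?_
    have h1 := congrArg (eval (0 : Fin 2 → ℂ)) h0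
    rw [RingHom.map_det, map_zero] at h1
    rw [AlgHom.map_det]
    refine Eq.trans ?_ h1
    congr 1
    ext i j
    simp only [AlgHom.mapMatrix_apply, RingHom.mapMatrix_apply, Matrix.map_apply, Matrix.of_apply,
      map_add, aeval_X, eval_dehomPlane]
  have h1 := congrArg (eval fun t => if t.1 = t.2 then (1 : ℚ) else 0) hD
  rw [RingHom.map_det, map_zero] at h1
  have h2 : (eval fun t : Fin 4 × Fin 4 => if t.1 = t.2 then (1 : ℚ) else 0).mapMatrix
      (Matrix.of fun i j => X (i, j) + X (j, i)) = Matrix.diagonal fun _ => 2 := by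
    ext i j
    by_cases h : i = j
    · subst h
      norm_num
    · simp [h, Ne.symm h]
  rw [h2, Matrix.det_diagonal] at h1
  simp at h1

theorem isRationalFunctionField_of_isotropic (hA : IsQuadricBundleP1P1 A)
    (hbase : AlgebraicIndependent ℚ fun t : Fin 4 × Fin 4 => eval ![1, 0, 1, 0] (A t.1 t.2))
    {σ : Fin 4 → MvPolynomial (Fin 2) ℂ} (hσ : σ ≠ 0)
    (hiso : ∑ i, ∑ j, dehomPlane (A i j) * σ i * σ j = 0) :
    IsRationalFunctionField (p1p1BundleFFMap A) := by
  have ha : dehomBase (A 3 3) ≠ 0 := dehomBase_ne_zero (hbase.ne_zero (3, 3))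
  have hprime := chartPoly_prime hA hbase
  have : (Ideal.span {p1p1BundleChartPoly A}).IsPrime :=
    (Ideal.span_singleton_prime hprime.ne_zero).2 hprime
  have : IsDomain (p1p1BundleChartRing A) :=
    inferInstanceAs (IsDomain (MvPolynomial (Fin 5) ℂ ⧸ Ideal.span {p1p1BundleChartPoly A}))
  let F := FractionRing (p1p1BundleChartRing A)
  let ι : p1p1BundleChartRing A →+* F := algebraMap _ _
  have hι : Function.Injective ι := IsFractionRing.injective _ _
  let I : MvPolynomial (Fin 4) ℂ →+* F := ι.comp (chartRingHom A)
  have hI : Function.Injective I := hι.comp (chartRingHom_injective ha)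
  let κ : MvPolynomial (Fin 2) ℂ →+* F := I.comp planeInclusion
  let w : Fin 4 → F := fun i => ι (chartCoord A i)
  have hindep : ∀ c : Fin 4 → MvPolynomial (Fin 2) ℂ, ∑ i, κ (c i) * w i = 0 → c = 0 := by
    intro c hc
    refine chartCoord_linearIndependent ha (hι ?_)
    rw [map_zero, ← hc, map_sum]
    exact Finset.sum_congr rfl fun i _ => map_mul _ _ _
  have hκ : Function.Injective κ := hI.comp (rename_injective _ (Fin.castLE_injective _))
  obtain ⟨l, hl⟩ := Function.ne_iff.1 hσ
  have hκl : κ (σ l) ≠ 0 := (map_ne_zero_iff κ hκ).2 hl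
  let u : Fin 4 → F := fun i => κ (σ l) * w i - w l * κ (σ i)
  have hu : ∀ i, i ≠ l → u i ≠ 0 := by
    intro i hi h0
    have := congrFun (hindep (Pi.single i (σ l) - Pi.single l (σ i)) ?_) i
    · simp [hi] at this
      exact hl this
    · simp only [Pi.sub_apply, map_sub, sub_mul, Finset.sum_sub_distrib]
      rw [Finset.sum_eq_single i, Finset.sum_eq_single l, Pi.single_eq_same, Pi.single_eq_same]
      · rw [mul_comm (κ (σ i))]
        exact h0
      · intro k _ hk
        rw [Pi.single_eq_of_ne hk, map_zero, zero_mul]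
      · simp
      · intro k _ hk
        rw [Pi.single_eq_of_ne hk, map_zero, zero_mul]
      · simp
  let τ : Equiv.Perm (Fin 4) := Equiv.swap 3 l
  have hτ3 : τ 3 = l := Equiv.swap_apply_left _ _
  have hτ0 : u (τ 0) ≠ 0 := hu _ fun h => by
    have := τ.injective (h.trans hτ3.symm)
    exact absurd this (by decide)
  let J : MvPolynomial (Fin 4) ℂ →+* F :=
    eval₂Hom (I.comp C) ![I (X 0), I (X 1), u (τ 1) / u (τ 0), u (τ 2) / u (τ 0)]
  let S : Subfield F := Subfield.closure (Set.range J)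
  have hJS : ∀ p, J p ∈ S := fun p => Subfield.subset_closure ⟨p, rfl⟩
  have hκS : ∀ p, κ p ∈ S := by
    intro p
    have : κ = J.comp planeInclusion := by
      refine MvPolynomial.ringHom_ext (fun c => ?_) fun i => ?_
      · simp [κ, J, planeInclusion]
      · fin_cases i <;> simp [κ, J, planeInclusion]
    rw [this]
    exact hJS _
  have huS : ∀ i, u i / u (τ 0) ∈ S := by
    intro i
    obtain ⟨k, rfl⟩ := τ.surjective i
    fin_cases k
    · exact div_self hτ0 ▸ one_mem S
    · simpa [J] using hJS (X 2)
    · simpa [J] using hJS (X 3)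
    · have : u (τ 3) = 0 := by
        rw [hτ3]
        simp only [u]
        ring
      exact (by rw [this, zero_div] : u (τ 3) / u (τ 0) = 0) ▸ zero_mem S
  have hwS : ∀ i, w i ∈ S := by
    refine mem_of_projection (M := fun i j => κ (dehomPlane (A i j))) (σ := fun i => κ (σ i))
      (fun i j => hκS _) (fun i => hκS _) ?_ ?_ (k := 0) ?_ hκl hτ0 huS ?_
    · simp only [← map_mul, ← map_sum, hiso, map_zero]
    · have := congrArg ι (sum_chartCoord A)
      simpa only [map_sum, map_mul, map_zero, κ, I, RingHom.comp_apply, planeInclusion_dehomPlane]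
        using this
    · simp [w, chartCoord]
    · intro h0
      apply hσ
      refine Matrix.eq_zero_of_mulVec_eq_zero (det_dehomPlane_ne_zero hbase) (hindep _ ?_)
      rw [← h0]
      refine Finset.sum_congr rfl fun i _ => ?_
      rw [mul_comm]
      simp [Matrix.mulVec, dotProduct]
  have htop : S = ⊤ := by
    rw [eq_top_iff]
    have hιS : ∀ a, ι a ∈ S := by
      intro a
      have h := chartRing_closure_eq_top (A := A) (m := 0) (eval₂Hom ι Fin.elim0) (S := S)
        (fun c => by simpa [J, I] using hJS (C c)) (by simpa [J, I] using hJS (X 0))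
        (by simpa [J, I] using hJS (X 1)) (fun i => by simpa using hwS i) (fun i => i.elim0) (C a)
      simpa using h
    rintro z -
    obtain ⟨a, b, -, rfl⟩ := IsFractionRing.div_surjective (A := p1p1BundleChartRing A) z
    exact div_mem (hιS a) (hιS b)
  have hJ : Function.Injective J := by
    refine MvPolynomial.injective_of_closure_eq_top (r := 0) (a := 1) (b := 0) (c := 0) hI
      (RingHom.ext fun c => by simp [J]) (by simp) (by simp) ?_
    rw [eq_top_iff, ← htop]
    exact Subfield.closure_mono Set.subset_union_left
  have hrat := isRationalFunctionField_of_closure_eq_top hJ htop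
  have hmap : J.comp C = p1p1BundleFFMap A := by
    refine RingHom.ext fun c => ?_
    have hc : rename Fin.castSucc (C c : MvPolynomial (Fin 4) ℂ) = C c := rename_C _ _
    simp only [J, I, RingHom.comp_apply, coe_eval₂Hom, eval₂_C]
    exact congrArg (fun q => ι (chartMk A q)) hc
  rw [hmap] at hrat
  exact hrat

end Projection

/-!
STATEMENT 13 (Corollary 5.2): Let `(dᵢ, eᵢ)` be a lexicographically ordered type with
`dᵢ, eᵢ ≥ 0`, all `dᵢ` of the same parity, all `eᵢ` of the same parity, `d₃ ≥ 3` and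
`e₃ ≥ 3`, and let `X → ℙ¹ × ℙ¹` be a very general quadric surface bundle of type
`(dᵢ, eᵢ)`. Then (1) `X` is rational if `d₂ = 0`, or `d₁ = e₁ = e₀ = 0`, or
`e₀ = e₁ = e₂ = 0`; and (2) `X` is not stably rational otherwise.
-/

theorem very_general_quadric_bundle_P1P1_stable_rationality
    (d e : Fin 4 → ℕ) (hlex : LexOrderedType d e)
    (hpard : ∀ i j, Even (d i + d j)) (hpare : ∀ i j, Even (e i + e j))
    (hd3 : 3 ≤ d 3) (he3 : 3 ≤ e 3) :
    VeryGeneral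
      (P := Π i : Fin 4, Π j : Fin 4,
        ((MvPolynomial.weightedHomogeneousSubmodule ℂ p1p1Weight1 ((d i + d j) / 2) ⊓
          MvPolynomial.weightedHomogeneousSubmodule ℂ p1p1Weight2 ((e i + e j) / 2) :
          Submodule ℂ (MvPolynomial (Fin 4) ℂ))))
      (fun p =>
        IsQuadricBundleP1P1 (fun i j => (p i j : MvPolynomial (Fin 4) ℂ)) →
          ((d 2 = 0 ∨ (d 1 = 0 ∧ e 1 = 0 ∧ e 0 = 0) ∨ (e 0 = 0 ∧ e 1 = 0 ∧ e 2 = 0)) →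
            IsRationalFunctionField
              (p1p1BundleFFMap (fun i j => (p i j : MvPolynomial (Fin 4) ℂ)))) ∧
          (¬ (d 2 = 0 ∨ (d 1 = 0 ∧ e 1 = 0 ∧ e 0 = 0) ∨ (e 0 = 0 ∧ e 1 = 0 ∧ e 2 = 0)) →
            ¬ IsStablyRationalFunctionField
              (p1p1BundleFFMap (fun i j => (p i j : MvPolynomial (Fin 4) ℂ))))) := by
  refine veryGeneral_of_algebraicIndependent quadricCoeff
    (fun n f hf a => exists_quadricCoeff_eq hf a)
    fun p hp hA => ⟨fun h => ?_, fun h => ?_⟩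
  · obtain ⟨σ, hσ, hiso⟩ := exists_isotropic_dehomPlane hlex p h
    exact isRationalFunctionField_of_isotropic hA (algebraicIndependent_base hp) hσ hiso
  · obtain ⟨τ, hτ, hdeg⟩ := exists_specialDegrees hpard hpare hd3 he3 h
    exact not_isStablyRational hp hτ hdeg
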